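/- arXiv:1604.04642 — 3 statements merged into one kernel-verified Lean document; each statement's English description precedes it below -/
import Mathlib

section
/- Let λ > 0 be a real number, let H be analytic on a neighborhood of the closed polydisc D̄ = {(x,y) : |x| ≤ p, |y| ≤ q} with all Taylor coefficients at the origin real and H(0,0) > 0, where p, q are positive real numbers. Suppose (p,q) is the unique zero of H in D̄ and is a smooth critical point in direction λ: H(p,q) = 0, λ·q·H_y(p,q) = p·H_x(p,q), and H_x(p,q) ≠ 0. Let β be a real number that is not a nonpositive integer, and let g = H^{−β} be the branch analytic near the origin with g(0,0) = H(0,0)^{−β} > 0 (real power), characterized by H·∂ₓg = −β·g·∂ₓH and H·∂_y g = −β·g·∂_y H; let a_{r,s} be its Taylor coefficients. Define χ₁ = H_y(p,q)/H_x(p,q), χ₂ = (χ₁²·H_{xx} − 2χ₁·H_{xy} + H_{yy})/(2H_x) at (p,q), and M = −2χ₂/p − χ₁²/p² − 1/(λq²), and assume M ≠ 0. Then −p·H_x(p,q) > 0 and −q²·M > 0, and for integer sequences r, s → ∞ with r − λs bounded, a_{r,s} ~ r^{β−3/2}·p^{−r}·q^{−s}·(−H_x(p,q)·p)^{−β}/(Γ(β)·√(−2π·q²·M)),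 where the real power and positive square root are taken. -/
open Filter Asymptotics Topology

open MeasureTheory Complex Set in
/-- Laplace integral of a power. -/
theorem lapl_gamma (β : ℝ) (hβ : 0 < β) (r : ℂ) (hr : 0 < r.re) :
    ∫ t : ℝ in Ioi 0, ((t : ℂ) ^ ((β : ℂ) - 1) * cexp (-(r * t))) = r ^ (-(β : ℂ)) * Complex.Gamma β := by
  set Φ : ℂ → ℂ := fun r => ∫ t : ℝ in Ioi 0, ((t : ℂ) ^ ((β : ℂ) - 1) * cexp (-(r * t)))
  set U : Set ℂ := {r | 0 < r.re}
  have hUo : IsOpen U := isOpen_lt continuous_const Complex.continuous_re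
  have hnorm : ∀ (b : ℝ) (r : ℂ) (t : ℝ), t ∈ Ioi (0:ℝ) →
      ‖((t : ℂ) ^ ((b : ℂ) - 1) * cexp (-(r * t)))‖ = t ^ (b - 1) * Real.exp (-r.re * t) := by
    intro b r t ht
    rw [norm_mul, Complex.norm_exp, show ((b : ℂ) - 1) = ((b - 1 : ℝ) : ℂ) by push_cast; ring,
      Complex.norm_cpow_eq_rpow_re_of_pos ht]
    simp
  have hmeas : ∀ (b : ℝ) (r : ℂ), AEStronglyMeasurable (fun t : ℝ => ((t : ℂ) ^ ((b : ℂ) - 1) * cexp (-(r * t)))) (volume.restrict (Ioi 0)) := by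
    intro b r
    refine ContinuousOn.aestronglyMeasurable ?_ measurableSet_Ioi
    intro t ht
    refine ContinuousAt.continuousWithinAt ?_
    refine ContinuousAt.mul ?_ (by fun_prop)
    refine ContinuousAt.cpow (by fun_prop) (by fun_prop) ?_
    left; simpa using ht
  have hIntg : ∀ (b : ℝ) (r : ℂ), 0 < b → 0 < r.re → Integrable (fun t : ℝ => ((t : ℂ) ^ ((b : ℂ) - 1) * cexp (-(r * t)))) (volume.restrict (Ioi 0)) := by
    intro b r hb hr
    have := integrableOn_rpow_mul_exp_neg_mul_rpow (p := 1) (s := b - 1) (b := r.re) (by linarith) one_pos hr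
    refine Integrable.mono' this (hmeas b r) ?_
    refine (ae_restrict_iff' measurableSet_Ioi).2 (Eventually.of_forall fun t ht => ?_)
    rw [hnorm b r t ht]; simp
  have hdiff : DifferentiableOn ℂ Φ U := by
    intro r0 hr0
    have hr0' : 0 < r0.re := hr0
    have hball : Metric.ball r0 (r0.re/2) ∈ 𝓝 r0 := Metric.ball_mem_nhds _ (by positivity)
    have key := hasDerivAt_integral_of_dominated_loc_of_deriv_le (μ := volume.restrict (Ioi (0:ℝ)))
      (F := fun (r : ℂ) (t : ℝ) => ((t : ℂ) ^ ((β : ℂ) - 1) * cexp (-(r * t))))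
      (F' := fun (r : ℂ) (t : ℝ) => -((t : ℂ) ^ (((β + 1 : ℝ) : ℂ) - 1) * cexp (-(r * t))))
      (x₀ := r0) (s := Metric.ball r0 (r0.re/2)) (bound := fun t => t ^ (β + 1 - 1) * Real.exp (-(r0.re/2) * t))
      hball (Eventually.of_forall fun r => hmeas β r) (hIntg β r0 hβ hr0') ((hmeas (β+1) r0).neg) ?_ ?_ ?_
    · exact key.2.differentiableAt.differentiableWithinAt
    · refine (ae_restrict_iff' measurableSet_Ioi).2 (Eventually.of_forall fun t ht r hrb => ?_)
      rw [norm_neg, hnorm _ r t ht]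
      have ht' : (0:ℝ) < t := ht
      have : r0.re / 2 ≤ r.re := by
        have h1 : |(r - r0).re| ≤ ‖r - r0‖ := Complex.abs_re_le_norm _
        rw [Metric.mem_ball, dist_eq_norm] at hrb
        have := abs_lt.1 (lt_of_le_of_lt h1 hrb)
        simp at this; linarith
      gcongr
    · have := integrableOn_rpow_mul_exp_neg_mul_rpow (p := 1) (s := β + 1 - 1) (b := r0.re/2) (by linarith) one_pos (by positivity)
      simpa [IntegrableOn] using this
    · refine (ae_restrict_iff' measurableSet_Ioi).2 (Eventually.of_forall fun t ht r hrb => ?_)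
      have ht' : (t : ℂ) ≠ 0 := by exact_mod_cast (ne_of_gt ht : t ≠ 0)
      have h1 : HasDerivAt (fun r : ℂ => cexp (-(r * t))) (cexp (-(r*t)) * (-(1 * (t:ℂ)))) r :=
        (((hasDerivAt_id r).mul_const (t:ℂ)).neg).cexp
      refine (h1.const_mul ((t : ℂ) ^ ((β : ℂ) - 1))).congr_deriv ?_
      have : (t : ℂ) ^ (((β + 1 : ℝ) : ℂ) - 1) = (t : ℂ) ^ ((β : ℂ) - 1) * t := by
        rw [show (((β + 1 : ℝ) : ℂ) - 1) = ((β : ℂ) - 1) + 1 by push_cast; ring, Complex.cpow_add _ _ ht', Complex.cpow_one]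
      rw [this]; ring
  have hdiff2 : DifferentiableOn ℂ (fun r : ℂ => r ^ (-(β : ℂ)) * Complex.Gamma β) U := by
    intro r hr
    refine DifferentiableAt.differentiableWithinAt ?_
    refine DifferentiableAt.mul_const ?_ _
    exact (differentiableAt_id).cpow (by fun_prop) (Or.inl hr)
  have hUc : IsPreconnected U := (convex_halfSpace_re_gt 0).isPreconnected
  have := (hdiff.analyticOnNhd hUo).eqOn_of_preconnected_of_frequently_eq (hdiff2.analyticOnNhd hUo) hUc
    (z₀ := 1) (by simp [U]) ?_
  · exact this hr
  · have hseq : Tendsto (fun n : ℕ => ((1 + 1 / ((n:ℝ) + 1) : ℝ) : ℂ)) atTop (𝓝[≠] 1) := by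
      refine tendsto_nhdsWithin_iff.2 ⟨?_, Eventually.of_forall fun n => ?_⟩
      · have := (tendsto_one_div_add_atTop_nhds_zero_nat (𝕜 := ℝ)).const_add 1
        simp only [add_zero] at this
        exact (Complex.continuous_ofReal.tendsto 1).comp this
      · simp only [mem_compl_iff, mem_singleton_iff]
        have : (0:ℝ) < 1 / ((n:ℝ)+1) := by positivity
        intro h
        have h2 : (1 + 1 / ((n:ℝ) + 1) : ℝ) = 1 := by exact_mod_cast h
        linarith
    refine hseq.frequently (Eventually.frequently (Eventually.of_forall fun n => ?_))
    have hpos : (0:ℝ) < 1 + 1 / ((n:ℝ)+1) := by positivity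
    have := Complex.integral_cpow_mul_exp_neg_mul_Ioi (a := β) (r := 1 + 1 / ((n:ℝ)+1)) (by simpa using hβ) hpos
    simp only [Φ]
    rw [this, Complex.cpow_neg, one_div, Complex.inv_cpow]
    rw [Complex.arg_ofReal_of_nonneg hpos.le]; exact Real.pi_pos.ne

open MeasureTheory Complex Set FourierTransform in
theorem gamma_fourier (β : ℝ) (hβ : 2 ≤ β) (z : ℝ) (hz : 0 < z) :
    ∫ u : ℝ, cexp (I * u) * ((z : ℂ) + I * u) ^ (-(β : ℂ)) = 2 * Real.pi * cexp (-z) / Complex.Gamma β := by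
  set f : ℝ → ℂ := fun t => if 0 < t then ((t : ℂ) ^ ((β : ℂ) - 1) * cexp (-(z * t))) else 0
  have hβ0 : 0 < β := by linarith
  have hΓ : Complex.Gamma β ≠ 0 := Complex.Gamma_ne_zero_of_re_pos (by simpa using hβ0)
  have hF : ∀ ξ : ℝ, 𝓕 f ξ = Complex.Gamma β * ((z : ℂ) + I * ((2 * Real.pi * ξ : ℝ) : ℂ)) ^ (-(β : ℂ)) := by
    intro ξ
    rw [Real.fourier_real_eq_integral_exp_smul]
    have := lapl_gamma β hβ0 ((z : ℂ) + I * ((2 * Real.pi * ξ : ℝ) : ℂ)) (by simpa using hz)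
    rw [mul_comm (Complex.Gamma _), ← this, ← integral_indicator measurableSet_Ioi]
    congr 1
    ext t
    by_cases ht : 0 < t
    · simp only [f, indicator, mem_Ioi, ht, if_true, smul_eq_mul]
      rw [mul_left_comm, ← Complex.exp_add]
      congr 2; push_cast; ring
    · simp [f, indicator, ht]
  have hfc : ContinuousAt f 1 := by
    have : f =ᶠ[𝓝 1] fun t => ((t : ℂ) ^ ((β : ℂ) - 1) * cexp (-(z * t))) := by
      filter_upwards [lt_mem_nhds (zero_lt_one' ℝ)] with t ht
      simp [f, ht]
    refine ContinuousAt.congr ?_ this.symm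
    refine ContinuousAt.mul ?_ (by fun_prop)
    exact ContinuousAt.cpow (by fun_prop) (by fun_prop) (by simp)
  have hfi : Integrable f := by
    have h0 : Integrable (indicator (Ioi 0) fun t : ℝ => (t ^ (β - 1) * Real.exp (-z * t ^ (1:ℝ)) : ℝ)) := by
      rw [integrable_indicator_iff measurableSet_Ioi]
      exact integrableOn_rpow_mul_exp_neg_mul_rpow (by linarith) one_pos hz
    refine Integrable.mono' h0 ?_ (Eventually.of_forall fun t => ?_)
    · have : f = indicator (Ioi 0) (fun t : ℝ => ((t : ℂ) ^ ((β : ℂ) - 1) * cexp (-(z * t)))) := by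
        ext t; simp [f, indicator]
      rw [this, aestronglyMeasurable_indicator_iff measurableSet_Ioi]
      refine ContinuousOn.aestronglyMeasurable ?_ measurableSet_Ioi
      intro t ht
      refine ContinuousAt.continuousWithinAt ?_
      refine ContinuousAt.mul ?_ (by fun_prop)
      refine ContinuousAt.cpow (by fun_prop) (by fun_prop) ?_
      left; simpa using ht
    · by_cases ht : 0 < t
      · simp only [f, indicator, mem_Ioi, ht, if_true]
        rw [norm_mul, Complex.norm_exp, show ((β : ℂ) - 1) = ((β - 1 : ℝ) : ℂ) by push_cast; ring,
          Complex.norm_cpow_eq_rpow_re_of_pos ht]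
        simp
      · simp [f, indicator, ht]
  have hmne : ∀ u : ℝ, (z : ℂ) + I * u ∈ slitPlane := fun u => Or.inl (by simpa using hz)
  have hGi : Integrable (fun u : ℝ => ((z : ℂ) + I * u) ^ (-(β : ℂ))) := by
    have h0 : Integrable (fun u : ℝ => (z ^ (-β) * (1 + (z⁻¹ * u) ^ 2)⁻¹ : ℝ)) :=
      (integrable_inv_one_add_sq.comp_mul_left' (inv_ne_zero hz.ne')).const_mul _
    refine h0.mono' ?_ (Eventually.of_forall fun u => ?_)
    · refine Continuous.aestronglyMeasurable ?_
      refine continuous_iff_continuousAt.2 fun u => ?_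
      exact ContinuousAt.cpow (by fun_prop) (by fun_prop) (hmne u)
    · rw [show (-(β:ℂ)) = ((-β : ℝ) : ℂ) by push_cast; ring, Complex.norm_cpow_of_ne_zero (slitPlane_ne_zero (hmne u))]
      simp only [ofReal_re, ofReal_im, mul_zero, Real.exp_zero, div_one]
      have hn : ‖(z : ℂ) + I * u‖ = z * Real.sqrt (1 + (z⁻¹ * u)^2) := by
        rw [mul_comm I, Complex.norm_add_mul_I]
        rw [show z ^ 2 + u ^ 2 = z ^ 2 * (1 + (z⁻¹ * u)^2) by field_simp]
        rw [Real.sqrt_mul (by positivity), Real.sqrt_sq hz.le]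
      rw [hn, Real.mul_rpow hz.le (Real.sqrt_nonneg _)]
      gcongr
      have h1 : 1 ≤ Real.sqrt (1 + (z⁻¹ * u)^2) := by
        rw [Real.one_le_sqrt]; nlinarith [sq_nonneg (z⁻¹ * u)]
      calc Real.sqrt (1 + (z⁻¹ * u)^2) ^ (-β) ≤ Real.sqrt (1 + (z⁻¹ * u)^2) ^ (-2 : ℝ) :=
            Real.rpow_le_rpow_of_exponent_le h1 (by linarith)
        _ = _ := by
            rw [Real.rpow_neg (Real.sqrt_nonneg _)]
            norm_cast
            rw [Real.sq_sqrt (by positivity)]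
  have hFi : Integrable (𝓕 f) := by
    have : (𝓕 f) = fun ξ : ℝ => Complex.Gamma β * ((z : ℂ) + I * ((2 * Real.pi * ξ : ℝ) : ℂ)) ^ (-(β : ℂ)) := funext hF
    rw [this]
    exact (hGi.comp_mul_left' (R := 2 * Real.pi) (by positivity)).const_mul _
  have hinv := hfi.fourierInv_fourier_eq hFi hfc
  rw [Real.fourierInv_eq_fourier_neg, Real.fourier_real_eq_integral_exp_smul] at hinv
  have h2 := Measure.integral_comp_mul_left (fun u : ℝ => cexp (I * u) * ((z : ℂ) + I * u) ^ (-(β : ℂ))) (2 * Real.pi)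
  have hf1 : f 1 = cexp (-z) := by simp [f]
  rw [hf1] at hinv
  have h3 : ∫ v : ℝ, cexp (↑(-2 * Real.pi * v * -1) * I) • 𝓕 f v = Complex.Gamma β * ∫ v : ℝ, cexp (I * ((2 * Real.pi * v : ℝ):ℂ)) * ((z : ℂ) + I * ((2 * Real.pi * v : ℝ):ℂ)) ^ (-(β : ℂ)) := by
    rw [← integral_const_mul]
    congr 1; ext v
    rw [hF, smul_eq_mul]
    rw [show (↑(-2 * Real.pi * v * -1) * I : ℂ) = I * ((2 * Real.pi * v : ℝ):ℂ) by push_cast; ring]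
    ring
  rw [h3, h2] at hinv
  rw [← hinv]
  have hpi : (Real.pi : ℂ) ≠ 0 := by exact_mod_cast Real.pi_ne_zero
  rw [abs_of_pos (by positivity : (0:ℝ) < (2 * Real.pi)⁻¹), Complex.real_smul]
  push_cast
  field_simp

theorem dom_bound (β : ℝ) (hβ : 4 ≤ β) (κ : ℝ) (hκ : 0 < κ) (u v X : ℝ) (hX : κ * (1 + |u| + v ^ 2) ≤ X) :
    X ^ (-β) ≤ κ ^ (-β) * ((1 + v ^ 2)⁻¹ * (1 + u ^ 2)⁻¹) := by
  have hY1 : 1 ≤ 1 + |u| + v ^ 2 := by nlinarith [abs_nonneg u, sq_nonneg v]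
  have hY0 : 0 < 1 + |u| + v ^ 2 := by linarith
  calc X ^ (-β) ≤ (κ * (1 + |u| + v ^ 2)) ^ (-β) :=
        Real.rpow_le_rpow_of_nonpos (by positivity) hX (by linarith)
    _ = κ ^ (-β) * (1 + |u| + v ^ 2) ^ (-β) := Real.mul_rpow hκ.le hY0.le
    _ ≤ κ ^ (-β) * (1 + |u| + v ^ 2) ^ (-4 : ℝ) := by
        gcongr ?_ * ?_
        exact Real.rpow_le_rpow_of_exponent_le hY1 (by linarith)
    _ ≤ _ := by
        gcongr
        rw [Real.rpow_neg hY0.le, ← mul_inv]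
        norm_cast
        gcongr
        set w := |u| with hw
        have hw0 : 0 ≤ w := abs_nonneg u
        rw [← sq_abs u, ← hw]
        have h1 : 1 + w ^ 2 ≤ (1 + w + v ^ 2) ^ 2 := by nlinarith [sq_nonneg v, mul_nonneg hw0 (sq_nonneg v), sq_nonneg (v^2)]
        have h2 : 1 + v ^ 2 ≤ (1 + w + v ^ 2) ^ 2 := by nlinarith [sq_nonneg v, mul_nonneg hw0 (sq_nonneg v), sq_nonneg (v^2)]
        calc (1 + v ^ 2) * (1 + w ^ 2) ≤ (1 + w + v ^ 2) ^ 2 * (1 + w + v ^ 2) ^ 2 := by gcongr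
          _ = _ := by ring

open MeasureTheory in
theorem dom_integrable : Integrable (fun z : ℝ × ℝ => (1 + z.1 ^ 2)⁻¹ * (1 + z.2 ^ 2)⁻¹) :=
  Integrable.mul_prod (f := fun v : ℝ => (1 + v ^ 2)⁻¹) (g := fun u : ℝ => (1 + u ^ 2)⁻¹)
    integrable_inv_one_add_sq integrable_inv_one_add_sq

open MeasureTheory Complex in
theorem limit_int (β : ℝ) (hβ : 4 ≤ β) (c0 B : ℝ) (hc : 0 < c0) (hB : 0 < B) :
    ∫ z : ℝ × ℝ, cexp (c0 + I * z.2) * ((c0 : ℂ) + I * z.2 + (B / 2 : ℝ) * (z.1 : ℂ) ^ 2) ^ (-(β : ℂ)) =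
      ((2 * Real.pi / Real.Gamma β * Real.sqrt (2 * Real.pi / B) : ℝ) : ℂ) := by
  have hre : ∀ z : ℝ × ℝ, ((c0 : ℂ) + I * z.2 + (B / 2 : ℝ) * (z.1 : ℂ) ^ 2).re = c0 + B / 2 * z.1 ^ 2 := by
    intro z
    rw [show ((c0 : ℂ) + I * z.2 + (B / 2 : ℝ) * (z.1 : ℂ) ^ 2) = ((c0 + B / 2 * z.1 ^ 2 : ℝ) : ℂ) + z.2 * I by push_cast; ring]
    simp only [Complex.add_re, Complex.ofReal_re, Complex.re_ofReal_mul, Complex.I_re]; ring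
  have him : ∀ z : ℝ × ℝ, ((c0 : ℂ) + I * z.2 + (B / 2 : ℝ) * (z.1 : ℂ) ^ 2).im = z.2 := by
    intro z
    rw [show ((c0 : ℂ) + I * z.2 + (B / 2 : ℝ) * (z.1 : ℂ) ^ 2) = ((c0 + B / 2 * z.1 ^ 2 : ℝ) : ℂ) + z.2 * I by push_cast; ring]
    simp only [Complex.add_im, Complex.ofReal_im, Complex.im_ofReal_mul, Complex.I_im]; ring
  have hpos : ∀ z : ℝ × ℝ, 0 < ((c0 : ℂ) + I * z.2 + (B / 2 : ℝ) * (z.1 : ℂ) ^ 2).re := by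
    intro z; rw [hre]; positivity
  have hIntg : Integrable (fun z : ℝ × ℝ => cexp (c0 + I * z.2) * ((c0 : ℂ) + I * z.2 + (B / 2 : ℝ) * (z.1 : ℂ) ^ 2) ^ (-(β : ℂ))) := by
    set κ : ℝ := min c0 (min 1 (B/2)) / 2
    have hκ : 0 < κ := by positivity
    refine Integrable.mono' (dom_integrable.const_mul (Real.exp c0 * κ ^ (-β))) ?_ (Eventually.of_forall fun z => ?_)
    · refine Continuous.aestronglyMeasurable ?_
      refine continuous_iff_continuousAt.2 fun z => ?_
      refine ContinuousAt.mul (by fun_prop) ?_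
      exact ContinuousAt.cpow (by fun_prop) (by fun_prop) (Or.inl (hpos z))
    · rw [norm_mul, Complex.norm_exp, show (-(β:ℂ)) = ((-β : ℝ) : ℂ) by push_cast; ring,
        Complex.norm_cpow_of_ne_zero (slitPlane_ne_zero (Or.inl (hpos z)))]
      simp only [ofReal_re, ofReal_im, mul_zero, Real.exp_zero, div_one]
      have he : (↑c0 + I * (z.2 : ℂ)).re = c0 := by simp
      rw [he, mul_assoc]
      gcongr
      refine dom_bound β hβ κ hκ z.2 z.1 _ ?_
      have h1 := Complex.re_le_norm ((c0 : ℂ) + I * z.2 + (B / 2 : ℝ) * (z.1 : ℂ) ^ 2)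
      have h2 := Complex.abs_im_le_norm ((c0 : ℂ) + I * z.2 + (B / 2 : ℝ) * (z.1 : ℂ) ^ 2)
      rw [hre] at h1
      rw [him] at h2
      have k1 : 2 * κ ≤ c0 := by simp only [κ]; linarith [min_le_left c0 (min 1 (B/2))]
      have k2 : 2 * κ ≤ 1 := by simp only [κ]; linarith [min_le_right c0 (min 1 (B/2)), min_le_left 1 (B/2)]
      have k3 : 2 * κ ≤ B/2 := by simp only [κ]; linarith [min_le_right c0 (min 1 (B/2)), min_le_right 1 (B/2)]
      nlinarith [mul_le_mul_of_nonneg_right k2 (abs_nonneg z.2), mul_le_mul_of_nonneg_right k3 (sq_nonneg z.1)]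
  have hprod := integral_prod _ hIntg
  rw [← Measure.volume_eq_prod] at hprod
  rw [hprod]
  have hinner : ∀ v : ℝ, ∫ u : ℝ, cexp (c0 + I * u) * ((c0 : ℂ) + I * u + (B / 2 : ℝ) * (v : ℂ) ^ 2) ^ (-(β : ℂ)) =
      ((2 * Real.pi / Real.Gamma β * Real.exp (-(B/2) * v ^ 2) : ℝ) : ℂ) := by
    intro v
    have := gamma_fourier β (by linarith) (c0 + B/2 * v^2) (by positivity)
    have h3 : ∀ u : ℝ, cexp (c0 + I * u) * ((c0 : ℂ) + I * u + (B / 2 : ℝ) * (v : ℂ) ^ 2) ^ (-(β : ℂ))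
      = cexp c0 * (cexp (I * u) * (((c0 + B/2 * v^2 : ℝ) : ℂ) + I * u) ^ (-(β : ℂ))) := by
      intro u
      rw [Complex.exp_add, mul_assoc]
      congr 3
      push_cast; ring
    simp_rw [h3]
    rw [integral_const_mul, this]
    rw [Complex.Gamma_ofReal]
    push_cast
    have h5 : cexp (-(↑B / 2) * (v:ℂ) ^ 2) = cexp c0 * cexp (-(↑c0 + ↑B / 2 * (v:ℂ) ^ 2)) := by
      rw [← Complex.exp_add]; congr 1; ring
    rw [h5]; ring
  simp only [hinner]
  rw [integral_complex_ofReal, integral_const_mul, integral_gaussian]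
  rw [show Real.pi / (B / 2) = 2 * Real.pi / B by field_simp]

open MeasureTheory in
theorem change_vars (Φ : ℝ → ℝ → ℂ) (n : ℝ) (hn : 0 < n) (μ : ℝ) :
    ∫ v : ℝ, ∫ u : ℝ, Φ (v / Real.sqrt n) (u / n - μ * (v / Real.sqrt n)) =
      ((n ^ (3 / 2 : ℝ) : ℝ) : ℂ) * ∫ θ : ℝ, ∫ t : ℝ, Φ θ t := by
  have h1 : ∀ θ : ℝ, ∫ u : ℝ, Φ θ (u / n - μ * θ) = (n : ℂ) * ∫ t : ℝ, Φ θ t := by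
    intro θ
    rw [Measure.integral_comp_div (fun t => Φ θ (t - μ * θ)) n, integral_sub_right_eq_self (fun t => Φ θ t),
      abs_of_pos hn, Complex.real_smul]
  simp_rw [h1]
  rw [Measure.integral_comp_div (fun θ => (n : ℂ) * ∫ t : ℝ, Φ θ t) (Real.sqrt n), integral_const_mul,
    abs_of_nonneg (Real.sqrt_nonneg n), Complex.real_smul, ← mul_assoc]
  congr 1
  rw [← Complex.ofReal_mul]
  congr 1
  rw [show (3 / 2 : ℝ) = 1 / 2 + 1 by norm_num, Real.rpow_add hn, Real.rpow_one, Real.sqrt_eq_rpow]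

/-- Unnormalised coefficient integral. -/
noncomputable def Iint (f : ℂ × ℂ → ℂ) (a b : ℝ) (r s : ℕ) : ℂ :=
  ∫ θ in (-Real.pi)..Real.pi, ∫ t in (-Real.pi)..Real.pi,
    f ((a : ℂ) + t * Complex.I, (b : ℂ) + θ * Complex.I) *
      Complex.exp (r * ((a : ℂ) + t * Complex.I) + s * ((b : ℂ) + θ * Complex.I))

open MeasureTheory Set in
theorem Iint_eq (f : ℂ × ℂ → ℂ) (a b : ℝ) (r s : ℕ) :
    Iint f a b r s = ∫ θ : ℝ, ∫ t : ℝ, (Ioc (-Real.pi) Real.pi ×ˢ Ioc (-Real.pi) Real.pi).indicator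
      (fun x : ℝ × ℝ => f ((a : ℂ) + x.2 * Complex.I, (b : ℂ) + x.1 * Complex.I) *
      Complex.exp (r * ((a : ℂ) + x.2 * Complex.I) + s * ((b : ℂ) + x.1 * Complex.I))) (θ, t) := by
  have hpi : -Real.pi ≤ Real.pi := by linarith [Real.pi_pos]
  rw [Iint, intervalIntegral.integral_of_le hpi, ← integral_indicator measurableSet_Ioc]
  congr 1; ext θ
  by_cases hθ : θ ∈ Ioc (-Real.pi) Real.pi
  · rw [indicator_of_mem hθ, intervalIntegral.integral_of_le hpi, ← integral_indicator measurableSet_Ioc]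
    congr 1; ext t
    by_cases ht : t ∈ Ioc (-Real.pi) Real.pi
    · rw [indicator_of_mem ht, indicator_of_mem (mk_mem_prod hθ ht)]
    · rw [indicator_of_notMem ht, indicator_of_notMem (fun h => ht h.2)]
  · rw [indicator_of_notMem hθ]
    rw [integral_eq_zero_of_ae]
    refine Eventually.of_forall fun t => ?_
    simp only [Pi.zero_apply]
    rw [indicator_of_notMem (fun h => hθ h.1)]

section seqs
variable (lam : ℝ) (hlam : 0 < lam) (r s : ℕ → ℕ) (hr : Tendsto r atTop atTop)
    (hb : ∃ C : ℝ, ∀ k, |(r k : ℝ) - lam * (s k : ℝ)| ≤ C)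

theorem seq_inv (r : ℕ → ℕ) (hr : Tendsto r atTop atTop) : Tendsto (fun k => ((r k : ℝ))⁻¹) atTop (𝓝 0) :=
  tendsto_inv_atTop_zero.comp (tendsto_natCast_atTop_atTop.comp hr)

theorem seq_ratio (lam : ℝ) (hlam : 0 < lam) (r s : ℕ → ℕ) (hr : Tendsto r atTop atTop)
    (hb : ∃ C : ℝ, ∀ k, |(r k : ℝ) - lam * (s k : ℝ)| ≤ C) :
    Tendsto (fun k => (s k : ℝ) / (r k : ℝ)) atTop (𝓝 (1 / lam)) := by
  obtain ⟨C, hC⟩ := hb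
  have h0 := seq_inv r hr
  have h1 : Tendsto (fun k => ((r k : ℝ) - lam * s k) * ((r k : ℝ))⁻¹) atTop (𝓝 0) := by
    have h2 : Tendsto (fun k => C * ((r k : ℝ))⁻¹) atTop (𝓝 0) := by simpa using h0.const_mul C
    refine squeeze_zero_norm (fun k => ?_) h2
    rw [norm_mul, Real.norm_eq_abs, Real.norm_eq_abs, abs_of_nonneg (by positivity : (0:ℝ) ≤ ((r k : ℝ))⁻¹)]
    gcongr
    exact hC k
  have h3 : Tendsto (fun k => (1 - ((r k : ℝ) - lam * s k) * ((r k : ℝ))⁻¹) / lam) atTop (𝓝 ((1 - 0) / lam)) :=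
    (h1.const_sub 1).div_const lam
  rw [sub_zero] at h3
  refine h3.congr' ?_
  filter_upwards [hr.eventually_gt_atTop 0] with k hk
  have : (r k : ℝ) ≠ 0 := by exact_mod_cast hk.ne'
  field_simp
  ring

theorem seq_sqrt (r : ℕ → ℕ) (hr : Tendsto r atTop atTop) : Tendsto (fun k => (Real.sqrt (r k : ℝ))⁻¹) atTop (𝓝 0) :=
  tendsto_inv_atTop_zero.comp (Real.tendsto_sqrt_atTop.comp (tendsto_natCast_atTop_atTop.comp hr))

end seqs

open Complex in
theorem pointwise_nh (lam A B : ℝ)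
    (h : ℂ × ℂ → ℂ)
    (happ : ∀ ε > 0, ∀ᶠ z in 𝓝 (0 : ℂ × ℂ),
      ‖h z - (A * (z.1 + z.2 / lam) - A * B / 2 * z.2 ^ 2)‖ ≤ ε * (‖z.1 + z.2 / lam‖ + ‖z.2‖ ^ 2))
    (u v : ℝ) (r : ℕ → ℕ) (hr : Tendsto r atTop atTop) (z : ℕ → ℂ × ℂ)
    (hz1 : ∀ k, (z k).1 = ((r k : ℝ)⁻¹ : ℝ) + ((u / r k - 1 / lam * (v / Real.sqrt (r k)) : ℝ) : ℂ) * I)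
    (hz2 : ∀ k, (z k).2 = ((r k : ℝ)⁻¹ : ℝ) + ((v / Real.sqrt (r k) : ℝ) : ℂ) * I) :
    Tendsto z atTop (𝓝 0) ∧
    Tendsto (fun k => (r k : ℂ) * h (z k)) atTop
      (𝓝 (A * (((1 + 1 / lam : ℝ) : ℂ) + I * u + (B / 2 : ℝ) * (v : ℂ) ^ 2))) := by
  have h0 := seq_inv r hr
  have hs := seq_sqrt r hr
  have c0 : Tendsto (fun k => (((r k : ℝ)⁻¹ : ℝ) : ℂ)) atTop (𝓝 0) :=
    (Complex.continuous_ofReal.tendsto' 0 0 (by simp)).comp h0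
  have cs : Tendsto (fun k => (((Real.sqrt (r k : ℝ))⁻¹ : ℝ) : ℂ)) atTop (𝓝 0) :=
    (Complex.continuous_ofReal.tendsto' 0 0 (by simp)).comp hs
  have t2 : Tendsto (fun k => (z k).2) atTop (𝓝 0) := by
    have := c0.add ((cs.const_mul (v : ℂ)).mul_const I)
    simp only [mul_zero, zero_mul, add_zero] at this
    refine this.congr fun k => ?_
    rw [hz2]; push_cast; ring
  have t1 : Tendsto (fun k => (z k).1) atTop (𝓝 0) := by
    have := c0.add (((c0.const_mul (u : ℂ)).sub ((cs.const_mul (v : ℂ)).const_mul ((1 / lam : ℝ) : ℂ))).mul_const I)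
    simp only [mul_zero, zero_mul, add_zero, sub_zero] at this
    refine this.congr fun k => ?_
    rw [hz1]; push_cast; ring
  have hz : Tendsto z atTop (𝓝 0) := by
    have := t1.prodMk_nhds t2
    exact this
  refine ⟨hz, ?_⟩
  have ew : ∀ k, 0 < r k → (r k : ℂ) * ((z k).1 + (z k).2 / lam) = ((1 + 1 / lam : ℝ) : ℂ) + I * u := by
    intro k hk
    have : (r k : ℂ) ≠ 0 := by exact_mod_cast hk.ne'
    rw [hz1, hz2]; push_cast
    field_simp
    ring
  have hsq : ∀ k, ((Real.sqrt (r k : ℝ) : ℝ) : ℂ) ^ 2 = (r k : ℂ) := by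
    intro k
    rw [← Complex.ofReal_pow, Real.sq_sqrt (Nat.cast_nonneg _)]; simp
  have et : ∀ k, 0 < r k → (r k : ℂ) * (z k).2 ^ 2 = (((r k : ℝ)⁻¹ : ℝ) : ℂ) + 2 * v * (((Real.sqrt (r k : ℝ))⁻¹ : ℝ) : ℂ) * I - (v : ℂ) ^ 2 := by
    intro k hk
    have hq := hsq k
    have hs0 : ((Real.sqrt (r k : ℝ) : ℝ) : ℂ) ≠ 0 := by
      have : 0 < Real.sqrt (r k : ℝ) := Real.sqrt_pos.2 (by exact_mod_cast hk)
      exact_mod_cast this.ne'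
    rw [hz2]; push_cast
    rw [← hq]
    set q := ((Real.sqrt (r k : ℝ) : ℝ) : ℂ)
    field_simp
    ring_nf
    simp only [I_sq]
    ring
  have tt : Tendsto (fun k => (r k : ℂ) * (z k).2 ^ 2) atTop (𝓝 (-(v : ℂ) ^ 2)) := by
    have := (c0.add ((cs.const_mul (2 * v : ℂ)).mul_const I)).sub_const ((v : ℂ) ^ 2)
    simp only [mul_zero, zero_mul, add_zero, zero_sub] at this
    refine this.congr' ?_
    filter_upwards [hr.eventually_gt_atTop 0] with k hk
    rw [et k hk]
  have tmain : Tendsto (fun k => (r k : ℂ) * (A * ((z k).1 + (z k).2 / lam) - A * B / 2 * (z k).2 ^ 2)) atTop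
      (𝓝 (A * (((1 + 1 / lam : ℝ) : ℂ) + I * u + (B / 2 : ℝ) * (v : ℂ) ^ 2))) := by
    have := (tt.const_mul ((A : ℂ) * B / 2)).const_sub ((A : ℂ) * (((1 + 1 / lam : ℝ) : ℂ) + I * u))
    have h2 : ((A : ℂ) * (((1 + 1 / lam : ℝ) : ℂ) + I * u)) - (A : ℂ) * B / 2 * (-(v : ℂ) ^ 2) =
      A * (((1 + 1 / lam : ℝ) : ℂ) + I * u + (B / 2 : ℝ) * (v : ℂ) ^ 2) := by push_cast; ring
    rw [h2] at this
    refine this.congr' ?_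
    filter_upwards [hr.eventually_gt_atTop 0] with k hk
    rw [← ew k hk]; ring
  have terr : Tendsto (fun k => (r k : ℂ) * (h (z k) - (A * ((z k).1 + (z k).2 / lam) - A * B / 2 * (z k).2 ^ 2))) atTop (𝓝 0) := by
    rw [Metric.tendsto_nhds]
    intro ε hε
    set K : ℝ := ‖((1 + 1 / lam : ℝ) : ℂ) + I * u‖ + (‖(v : ℂ) ^ 2‖ + 1)
    have hK : 0 < K := by positivity
    have e1 := hz.eventually (happ (ε / (2 * K)) (by positivity))
    have e2 : ∀ᶠ k in atTop, ‖(r k : ℂ) * (z k).2 ^ 2‖ < ‖(v : ℂ) ^ 2‖ + 1 := by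
      have := tt.norm
      rw [norm_neg] at this
      exact this.eventually (gt_mem_nhds (by linarith))
    filter_upwards [e1, e2, hr.eventually_gt_atTop 0] with k h1 h2 hk
    rw [dist_zero_right, norm_mul]
    calc ‖(r k : ℂ)‖ * ‖h (z k) - (A * ((z k).1 + (z k).2 / lam) - A * B / 2 * (z k).2 ^ 2)‖
        ≤ ‖(r k : ℂ)‖ * (ε / (2 * K) * (‖(z k).1 + (z k).2 / lam‖ + ‖(z k).2‖ ^ 2)) := by gcongr
      _ = ε / (2 * K) * (‖(r k : ℂ) * ((z k).1 + (z k).2 / lam)‖ + ‖(r k : ℂ) * (z k).2 ^ 2‖) := by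
          rw [norm_mul, norm_mul, norm_pow]; ring
      _ ≤ ε / (2 * K) * K := by
          rw [ew k hk]
          gcongr
          simp only [K]
          gcongr
      _ < ε := by
          rw [div_mul_eq_mul_div, div_lt_iff₀ (by positivity)]
          nlinarith
  have := tmain.add terr
  rw [add_zero] at this
  refine this.congr fun k => ?_
  ring

/-- The rescaled point. -/
noncomputable def zpt (lam n : ℝ) (w : ℝ × ℝ) : ℂ × ℂ :=
  (((n⁻¹ : ℝ) : ℂ) + ((w.2 / n - 1 / lam * (w.1 / Real.sqrt n) : ℝ) : ℂ) * Complex.I,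
   ((n⁻¹ : ℝ) : ℂ) + ((w.1 / Real.sqrt n : ℝ) : ℂ) * Complex.I)

/-- The rescaled box. -/
def zbox (lam n : ℝ) : Set (ℝ × ℝ) :=
  {w | w.1 / Real.sqrt n ∈ Set.Ioc (-Real.pi) Real.pi ∧
    w.2 / n - 1 / lam * (w.1 / Real.sqrt n) ∈ Set.Ioc (-Real.pi) Real.pi}

/-- Rescaled integrand. -/
noncomputable def zPsi (lam β : ℝ) (f : ℂ × ℂ → ℂ) (n s : ℕ) : ℝ × ℝ → ℂ :=
  (zbox lam n).indicator (fun w => (((n : ℝ) ^ (-β) : ℝ) : ℂ) * (f (zpt lam n w) *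
    Complex.exp (n * (zpt lam n w).1 + s * (zpt lam n w).2)))

theorem zpt_cont (lam n : ℝ) : Continuous (zpt lam n) := by
  unfold zpt; fun_prop

theorem zbox_meas (lam n : ℝ) : MeasurableSet (zbox lam n) := by
  apply MeasurableSet.inter
  · exact (by fun_prop : Measurable (fun w : ℝ × ℝ => w.1 / Real.sqrt n)) measurableSet_Ioc
  · exact (by fun_prop : Measurable (fun w : ℝ × ℝ => w.2 / n - 1 / lam * (w.1 / Real.sqrt n))) measurableSet_Ioc

theorem zpt_sum (lam n : ℝ) (hl : lam ≠ 0) (hn : 0 < n) (w : ℝ × ℝ) :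
    (zpt lam n w).1 + (zpt lam n w).2 / lam = ((n⁻¹ : ℝ) : ℂ) * (((1 + 1 / lam : ℝ) : ℂ) + Complex.I * w.2) := by
  have hl' : (lam : ℂ) ≠ 0 := by exact_mod_cast hl
  simp only [zpt]
  push_cast
  field_simp
  ring

theorem zpt_snd_norm (lam n : ℝ) (hn : 0 < n) (w : ℝ × ℝ) :
    w.1 ^ 2 / n ≤ ‖(zpt lam n w).2‖ ^ 2 := by
  have h := Complex.abs_im_le_norm (zpt lam n w).2
  have h2 : ((zpt lam n w).2).im = w.1 / Real.sqrt n := by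
    simp only [zpt, Complex.add_im, Complex.ofReal_im, Complex.mul_I_im, Complex.ofReal_re, zero_add]
  rw [h2] at h
  calc w.1 ^ 2 / n = |w.1 / Real.sqrt n| ^ 2 := by
        rw [sq_abs, div_pow, Real.sq_sqrt hn.le]
    _ ≤ _ := by gcongr

open MeasureTheory in
theorem Iint_zPsi (lam β : ℝ) (f : ℂ × ℂ → ℂ) (n s : ℕ) (hn : 0 < n)
    (hIntg : Integrable (zPsi lam β f n s)) :
    (((n : ℝ) ^ (3 / 2 - β) : ℝ) : ℂ) * Iint f ((n : ℝ)⁻¹) ((n : ℝ)⁻¹) n s = ∫ w, zPsi lam β f n s w := by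
  have hn' : (0 : ℝ) < n := by exact_mod_cast hn
  rw [Measure.volume_eq_prod] at hIntg ⊢
  rw [integral_prod _ hIntg]
  rw [Iint_eq, sub_eq_add_neg, Real.rpow_add hn', Complex.ofReal_mul]
  rw [show ∀ a b c : ℂ, a * b * c = b * (a * c) by intros; ring]
  rw [← change_vars (fun θ t => _) n hn' (1 / lam), ← integral_const_mul]
  congr 1; ext v
  rw [← integral_const_mul]
  congr 1; ext u
  unfold zPsi
  by_cases hw : ((v, u) : ℝ × ℝ) ∈ zbox lam n
  · rw [Set.indicator_of_mem hw, Set.indicator_of_mem (Set.mk_mem_prod hw.1 hw.2)]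
    rfl
  · rw [Set.indicator_of_notMem hw, Set.indicator_of_notMem (fun h => hw ⟨h.1, h.2⟩), mul_zero]

open MeasureTheory in
theorem zPsi_meas (lam β : ℝ) (f : ℂ × ℂ → ℂ) (n s : ℕ) (hn : 0 < n)
    (hf : ContinuousOn f {z | 0 < z.1.re ∧ 0 < z.2.re}) :
    AEStronglyMeasurable (zPsi lam β f n s) volume := by
  have hn' : (0 : ℝ) < n := by exact_mod_cast hn
  refine AEStronglyMeasurable.indicator ?_ (zbox_meas lam n)
  refine Continuous.aestronglyMeasurable ?_
  have h1 : Continuous (fun w => f (zpt lam n w)) := by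
    refine hf.comp_continuous (zpt_cont lam n) fun w => ?_
    simp [zpt, hn']
  have h2 := zpt_cont lam n
  exact continuous_const.mul (h1.mul (Complex.continuous_exp.comp
    ((continuous_const.mul h2.fst).add (continuous_const.mul h2.snd))))

theorem zPsi_bound (lam β : ℝ) (hlam : 0 < lam) (hβ : 4 ≤ β) (h F L : ℂ × ℂ → ℂ) (c : ℝ) (hc : 0 < c)
    (hlow : ∀ z : ℂ × ℂ, 0 ≤ z.1.re → z.1.re ≤ 1 → |z.1.im| ≤ Real.pi → 0 ≤ z.2.re → z.2.re ≤ 1 →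
      |z.2.im| ≤ Real.pi → c * (‖z.1 + z.2 / lam‖ + ‖z.2‖ ^ 2) ≤ ‖h z‖)
    (MF : ℝ) (hMF : ∀ z : ℂ × ℂ, 0 ≤ z.1.re → z.1.re ≤ 1 → |z.1.im| ≤ Real.pi → 0 ≤ z.2.re → z.2.re ≤ 1 →
      |z.2.im| ≤ Real.pi → ‖F z‖ ≤ MF)
    (hL : ∀ z : ℂ × ℂ, 0 < z.1.re → 0 < z.2.re → Complex.exp (L z) = h z)
    (n s : ℕ) (hn : 0 < n) (E : ℝ) (hE : (s : ℝ) / n ≤ E) (w : ℝ × ℝ) :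
    ‖zPsi lam β (fun z => F z * Complex.exp (-(β : ℂ) * L z)) n s w‖ ≤
      MF * Real.exp (1 + E) * (c / 2) ^ (-β) * ((1 + w.1 ^ 2)⁻¹ * (1 + w.2 ^ 2)⁻¹) := by
  have hn' : (0 : ℝ) < n := by exact_mod_cast hn
  have hMF0 : 0 ≤ MF := (norm_nonneg _).trans (hMF 0 (by simp) (by simp) (by simp [Real.pi_pos.le]) (by simp) (by simp) (by simp [Real.pi_pos.le]))
  by_cases hw : w ∈ zbox lam n
  swap
  · rw [zPsi, Set.indicator_of_notMem hw, norm_zero]; positivity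
  rw [zPsi, Set.indicator_of_mem hw]
  obtain ⟨hw1, hw2⟩ := hw
  set z := zpt lam n w with hz
  have r1 : z.1.re = (n : ℝ)⁻¹ := by simp [hz, zpt]
  have r2 : z.2.re = (n : ℝ)⁻¹ := by simp [hz, zpt]
  have i1 : z.1.im = w.2 / n - 1 / lam * (w.1 / Real.sqrt n) := by
    simp only [hz, zpt, Complex.add_im, Complex.ofReal_im, Complex.mul_I_im, Complex.ofReal_re, zero_add]
  have i2 : z.2.im = w.1 / Real.sqrt n := by
    simp only [hz, zpt, Complex.add_im, Complex.ofReal_im, Complex.mul_I_im, Complex.ofReal_re, zero_add]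
  have hinv : (0 : ℝ) < (n : ℝ)⁻¹ := by positivity
  have hinv1 : (n : ℝ)⁻¹ ≤ 1 := inv_le_one_of_one_le₀ (by exact_mod_cast hn)
  have p1 : |z.1.im| ≤ Real.pi := by rw [i1, abs_le]; exact ⟨hw2.1.le, hw2.2⟩
  have p2 : |z.2.im| ≤ Real.pi := by rw [i2, abs_le]; exact ⟨hw1.1.le, hw1.2⟩
  have hlo := hlow z (by rw [r1]; exact hinv.le) (by rwa [r1]) p1 (by rw [r2]; exact hinv.le) (by rwa [r2]) p2
  have hF := hMF z (by rw [r1]; exact hinv.le) (by rwa [r1]) p1 (by rw [r2]; exact hinv.le) (by rwa [r2]) p2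
  have hLz := hL z (by rwa [r1]) (by rwa [r2])
  have hnorm : ‖h z‖ = Real.exp (L z).re := by rw [← hLz, Complex.norm_exp]
  have hX : c / 2 * (1 + |w.2| + w.1 ^ 2) ≤ n * ‖h z‖ := by
    have a1 : ‖z.1 + z.2 / lam‖ = (n : ℝ)⁻¹ * ‖((1 + 1 / lam : ℝ) : ℂ) + Complex.I * w.2‖ := by
      rw [hz, zpt_sum lam n hlam.ne' hn', norm_mul, Complex.norm_real, Real.norm_of_nonneg hinv.le]
    have a2 := zpt_snd_norm lam n hn' w
    have a3 := Complex.abs_re_le_norm (((1 + 1 / lam : ℝ) : ℂ) + Complex.I * w.2)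
    have a4 := Complex.abs_im_le_norm (((1 + 1 / lam : ℝ) : ℂ) + Complex.I * w.2)
    have e3 : (((1 + 1 / lam : ℝ) : ℂ) + Complex.I * w.2).re = 1 + 1 / lam := by simp
    have e4 : (((1 + 1 / lam : ℝ) : ℂ) + Complex.I * w.2).im = w.2 := by simp
    rw [e3] at a3; rw [e4] at a4
    have hl : 0 < 1 / lam := by positivity
    rw [abs_of_pos (by positivity)] at a3
    rw [← hz] at a2
    calc c / 2 * (1 + |w.2| + w.1 ^ 2) ≤ c * (‖((1 + 1 / lam : ℝ) : ℂ) + Complex.I * w.2‖ + w.1 ^ 2) := by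
          nlinarith [sq_nonneg w.1, mul_nonneg hc.le (sq_nonneg w.1)]
      _ = n * (c * ((n : ℝ)⁻¹ * ‖((1 + 1 / lam : ℝ) : ℂ) + Complex.I * w.2‖ + w.1 ^ 2 / n)) := by
          field_simp
      _ ≤ n * (c * (‖z.1 + z.2 / lam‖ + ‖z.2‖ ^ 2)) := by rw [a1]; gcongr
      _ ≤ n * ‖h z‖ := by gcongr
  have hd := dom_bound β hβ (c / 2) (by positivity) w.2 w.1 _ hX
  have hexp : ‖Complex.exp (-(β : ℂ) * L z)‖ = ‖h z‖ ^ (-β) := by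
    rw [Complex.norm_exp, hnorm, ← Real.exp_mul]
    congr 1
    simp [mul_comm]
  have hexp2 : ‖Complex.exp (n * z.1 + s * z.2)‖ ≤ Real.exp (1 + E) := by
    rw [Complex.norm_exp]
    apply Real.exp_le_exp.2
    simp only [Complex.add_re, Complex.mul_re, Complex.natCast_re, Complex.natCast_im, zero_mul, sub_zero, r1, r2]
    rw [mul_inv_cancel₀ hn'.ne', ← div_eq_mul_inv]
    linarith
  rw [norm_mul, norm_mul, norm_mul, hexp, Complex.norm_real, Real.norm_of_nonneg (by positivity)]
  calc (n : ℝ) ^ (-β) * (‖F z‖ * ‖h z‖ ^ (-β) * ‖Complex.exp (n * z.1 + s * z.2)‖)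
      = ‖F z‖ * ‖Complex.exp (n * z.1 + s * z.2)‖ * (n * ‖h z‖) ^ (-β) := by
        rw [Real.mul_rpow hn'.le (norm_nonneg _)]; ring
    _ ≤ MF * Real.exp (1 + E) * ((c / 2) ^ (-β) * ((1 + w.1 ^ 2)⁻¹ * (1 + w.2 ^ 2)⁻¹)) := by
        gcongr
    _ = _ := by ring

theorem zPsi_pointwise (lam A B β : ℝ) (hlam : 0 < lam) (hA : 0 < A) (hB : 0 < B) (h F L : ℂ × ℂ → ℂ)
    (happ : ∀ ε > 0, ∀ᶠ z in 𝓝 (0 : ℂ × ℂ),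
      ‖h z - (A * (z.1 + z.2 / lam) - A * B / 2 * z.2 ^ 2)‖ ≤ ε * (‖z.1 + z.2 / lam‖ + ‖z.2‖ ^ 2))
    (hF : ContinuousOn F {z | 0 ≤ z.1.re ∧ 0 ≤ z.2.re})
    (hL : ∀ z : ℂ × ℂ, 0 < z.1.re → 0 < z.2.re → Complex.exp (L z) = h z)
    (hLlog : ∀ᶠ z in 𝓝 (0 : ℂ × ℂ), 0 < z.1.re → 0 < z.2.re → L z = Complex.log (h z))
    (r s : ℕ → ℕ) (hr : Tendsto r atTop atTop)
    (hb : ∃ C : ℝ, ∀ k, |(r k : ℝ) - lam * (s k : ℝ)| ≤ C) (w : ℝ × ℝ) :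
    Tendsto (fun k => zPsi lam β (fun z => F z * Complex.exp (-(β : ℂ) * L z)) (r k) (s k) w) atTop
      (𝓝 (F 0 * ((A ^ (-β) : ℝ) : ℂ) * (Complex.exp ((1 + 1 / lam : ℝ) + Complex.I * w.2) *
        (((1 + 1 / lam : ℝ) : ℂ) + Complex.I * w.2 + (B / 2 : ℝ) * (w.1 : ℂ) ^ 2) ^ (-(β : ℂ))))) := by
  obtain ⟨hz0, hnh⟩ := pointwise_nh lam A B h happ w.2 w.1 r hr (fun k => zpt lam (r k) w)
    (fun k => rfl) (fun k => rfl)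
  set Z : ℂ := ((1 + 1 / lam : ℝ) : ℂ) + Complex.I * w.2 + (B / 2 : ℝ) * (w.1 : ℂ) ^ 2 with hZ
  have hl : 0 < 1 / lam := by positivity
  have hZre : Z.re = 1 + 1 / lam + B / 2 * w.1 ^ 2 := by
    rw [hZ, show (((1 + 1 / lam : ℝ) : ℂ) + Complex.I * w.2 + (B / 2 : ℝ) * (w.1 : ℂ) ^ 2) = ((1 + 1 / lam + B / 2 * w.1 ^ 2 : ℝ) : ℂ) + w.2 * Complex.I by push_cast; ring]
    rw [Complex.add_re, Complex.ofReal_re, Complex.re_ofReal_mul, Complex.I_re, mul_zero, add_zero]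
  have hZpos : 0 < Z.re := by rw [hZre]; positivity
  have hZne : Z ≠ 0 := fun h0 => by rw [h0] at hZpos; simp at hZpos
  have hpos : ∀ᶠ k in atTop, 0 < r k := hr.eventually_gt_atTop 0
  have tF : Tendsto (fun k => F (zpt lam (r k) w)) atTop (𝓝 (F 0)) := by
    have := hF 0 (by simp)
    refine this.tendsto.comp (tendsto_nhdsWithin_iff.2 ⟨hz0, Eventually.of_forall fun k => ?_⟩)
    simp [zpt]
  have hAZ : ((A : ℂ) * Z) ∈ Complex.slitPlane := by
    left; rw [Complex.re_ofReal_mul]; positivity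
  have tP : Tendsto (fun k => ((r k : ℂ) * h (zpt lam (r k) w)) ^ (-(β : ℂ))) atTop
      (𝓝 (((A ^ (-β) : ℝ) : ℂ) * Z ^ (-(β : ℂ)))) := by
    have h1 := hnh.cpow (tendsto_const_nhds (x := (-(β : ℂ)))) hAZ
    convert h1 using 2
    rw [Complex.cpow_def_of_ne_zero hZne, Complex.cpow_def_of_ne_zero (mul_ne_zero (by exact_mod_cast hA.ne') hZne),
      Complex.log_ofReal_mul hA hZne, Complex.ofReal_cpow hA.le, Complex.cpow_def_of_ne_zero (by exact_mod_cast hA.ne'),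
      ← Complex.exp_add, Complex.ofReal_log hA.le]
    congr 1; push_cast; ring
  have tE : Tendsto (fun k => Complex.exp ((r k : ℂ) * (zpt lam (r k) w).1 + (s k : ℂ) * (zpt lam (r k) w).2)) atTop
      (𝓝 (Complex.exp ((1 + 1 / lam : ℝ) + Complex.I * w.2))) := by
    refine (Complex.continuous_exp.tendsto _).comp ?_
    have t1 : Tendsto (fun k => ((1 + (s k : ℝ) / r k : ℝ) : ℂ)) atTop (𝓝 ((1 + 1 / lam : ℝ) : ℂ)) :=
      (Complex.continuous_ofReal.tendsto _).comp ((seq_ratio lam hlam r s hr hb).const_add 1)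
    have t2 : Tendsto (fun k => (((Real.sqrt (r k : ℝ))⁻¹ * (w.1 * ((s k : ℝ) - r k / lam)) : ℝ) : ℂ)) atTop (𝓝 ((0 : ℝ) : ℂ)) := by
      refine (Complex.continuous_ofReal.tendsto _).comp ?_
      obtain ⟨C, hC⟩ := hb
      have h2 : Tendsto (fun k => (Real.sqrt (r k : ℝ))⁻¹ * (|w.1| * (C / lam))) atTop (𝓝 0) := by
        simpa using (seq_sqrt r hr).mul_const (|w.1| * (C / lam))
      refine squeeze_zero_norm (fun k => ?_) h2
      rw [Real.norm_eq_abs, abs_mul, abs_mul, abs_of_nonneg (by positivity : 0 ≤ (Real.sqrt (r k : ℝ))⁻¹)]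
      gcongr
      rw [show (s k : ℝ) - r k / lam = -((r k : ℝ) - lam * s k) / lam by field_simp; ring, abs_div, abs_neg, abs_of_pos hlam]
      gcongr
      exact hC k
    have t3 : Tendsto (fun k => ((1 + (s k : ℝ) / r k : ℝ) : ℂ) + (Complex.I * w.2 + Complex.I * (((Real.sqrt (r k : ℝ))⁻¹ * (w.1 * ((s k : ℝ) - r k / lam)) : ℝ) : ℂ))) atTop
      (𝓝 (((1 + 1 / lam : ℝ) : ℂ) + (Complex.I * w.2 + Complex.I * ((0 : ℝ) : ℂ)))) :=
      t1.add ((t2.const_mul Complex.I).const_add _)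
    rw [Complex.ofReal_zero, mul_zero, add_zero] at t3
    refine t3.congr' ?_
    filter_upwards [hpos] with k hk
    have hk1 : (r k : ℂ) ≠ 0 := by exact_mod_cast hk.ne'
    have hk2 : ((Real.sqrt (r k : ℝ) : ℝ) : ℂ) ≠ 0 := by
      have : (0:ℝ) < r k := by exact_mod_cast hk
      exact_mod_cast (Real.sqrt_pos.2 this).ne'
    have hl' : (lam : ℂ) ≠ 0 := by exact_mod_cast hlam.ne'
    simp only [zpt]
    push_cast
    field_simp
    ring
  have tall := (tF.mul tP).mul tE
  refine (tall.congr' ?_).trans (le_of_eq ?_)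
  · have e1 : ∀ᶠ k in atTop, zpt lam (r k) w ∈ {z : ℂ × ℂ | |z.1.im| < Real.pi ∧ |z.2.im| < Real.pi} := by
      refine hz0.eventually_mem ?_
      refine IsOpen.mem_nhds ?_ (by simp [Real.pi_pos])
      exact (isOpen_lt (continuous_abs.comp (Complex.continuous_im.comp continuous_fst)) continuous_const).inter
        (isOpen_lt (continuous_abs.comp (Complex.continuous_im.comp continuous_snd)) continuous_const)
    filter_upwards [hpos, e1, hz0.eventually hLlog] with k hk hbox hlog
    have hk' : (0:ℝ) < r k := by exact_mod_cast hk
    have i1 : (zpt lam (r k) w).1.im = w.2 / r k - 1 / lam * (w.1 / Real.sqrt (r k)) := by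
      simp only [zpt, Complex.add_im, Complex.ofReal_im, Complex.mul_I_im, Complex.ofReal_re, zero_add]
    have i2 : (zpt lam (r k) w).2.im = w.1 / Real.sqrt (r k) := by
      simp only [zpt, Complex.add_im, Complex.ofReal_im, Complex.mul_I_im, Complex.ofReal_re, zero_add]
    have r1 : 0 < (zpt lam (r k) w).1.re := by simpa [zpt] using hk
    have r2 : 0 < (zpt lam (r k) w).2.re := by simpa [zpt] using hk
    have hmem : w ∈ zbox lam (r k) := by
      obtain ⟨b1, b2⟩ := hbox
      rw [i1, abs_lt] at b1; rw [i2, abs_lt] at b2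
      exact ⟨⟨b2.1, b2.2.le⟩, ⟨b1.1, b1.2.le⟩⟩
    rw [zPsi, Set.indicator_of_mem hmem]
    have hh := hlog r1 r2
    have hhne : h (zpt lam (r k) w) ≠ 0 := by rw [← hL _ r1 r2]; exact Complex.exp_ne_zero _
    rw [hh, Complex.cpow_def_of_ne_zero (mul_ne_zero (by exact_mod_cast hk.ne') hhne)]
    have : Complex.log ((r k : ℂ) * h (zpt lam (r k) w)) = ((Real.log (r k) : ℝ) : ℂ) + Complex.log (h (zpt lam (r k) w)) := by
      rw [← Complex.log_ofReal_mul hk' hhne]; norm_cast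
    rw [this, Complex.ofReal_cpow hk'.le, Complex.cpow_def_of_ne_zero (by exact_mod_cast hk'.ne'), ← Complex.ofReal_log hk'.le,
      show (((Real.log (r k) : ℝ) : ℂ) + Complex.log (h (zpt lam (r k) w))) * -(β : ℂ) = ((Real.log (r k) : ℝ) : ℂ) * ((-β : ℝ) : ℂ) + -(β : ℂ) * Complex.log (h (zpt lam (r k) w)) by push_cast; ring,
      Complex.exp_add]
    ring
  · congr 1; ring

open MeasureTheory in
theorem core_base (lam A B β : ℝ) (hlam : 0 < lam) (hA : 0 < A) (hB : 0 < B) (hβ : 4 ≤ β) (h F L : ℂ × ℂ → ℂ)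
    (c : ℝ) (hc : 0 < c)
    (hlow : ∀ z : ℂ × ℂ, 0 ≤ z.1.re → z.1.re ≤ 1 → |z.1.im| ≤ Real.pi → 0 ≤ z.2.re → z.2.re ≤ 1 →
      |z.2.im| ≤ Real.pi → c * (‖z.1 + z.2 / lam‖ + ‖z.2‖ ^ 2) ≤ ‖h z‖)
    (happ : ∀ ε > 0, ∀ᶠ z in 𝓝 (0 : ℂ × ℂ),
      ‖h z - (A * (z.1 + z.2 / lam) - A * B / 2 * z.2 ^ 2)‖ ≤ ε * (‖z.1 + z.2 / lam‖ + ‖z.2‖ ^ 2))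
    (hF : ContinuousOn F {z | 0 ≤ z.1.re ∧ 0 ≤ z.2.re})
    (hLc : ContinuousOn L {z | 0 < z.1.re ∧ 0 < z.2.re})
    (hL : ∀ z : ℂ × ℂ, 0 < z.1.re → 0 < z.2.re → Complex.exp (L z) = h z)
    (hLlog : ∀ᶠ z in 𝓝 (0 : ℂ × ℂ), 0 < z.1.re → 0 < z.2.re → L z = Complex.log (h z))
    (r s : ℕ → ℕ) (hr : Tendsto r atTop atTop)
    (hb : ∃ C : ℝ, ∀ k, |(r k : ℝ) - lam * (s k : ℝ)| ≤ C) :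
    Tendsto (fun k => (((r k : ℝ) ^ (3 / 2 - β) : ℝ) : ℂ) *
      Iint (fun z => F z * Complex.exp (-(β : ℂ) * L z)) ((r k : ℝ)⁻¹) ((r k : ℝ)⁻¹) (r k) (s k)) atTop
      (𝓝 (4 * Real.pi ^ 2 * F 0 * ((A ^ (-β) / (Real.Gamma β * Real.sqrt (2 * Real.pi * B)) : ℝ) : ℂ))) := by
  obtain ⟨MF, hMF⟩ : ∃ MF, ∀ z : ℂ × ℂ, 0 ≤ z.1.re → z.1.re ≤ 1 → |z.1.im| ≤ Real.pi → 0 ≤ z.2.re → z.2.re ≤ 1 →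
      |z.2.im| ≤ Real.pi → ‖F z‖ ≤ MF := by
    have hcomp : IsCompact ((Set.Icc (0:ℝ) 1 ×ℂ Set.Icc (-Real.pi) Real.pi) ×ˢ (Set.Icc (0:ℝ) 1 ×ℂ Set.Icc (-Real.pi) Real.pi)) :=
      (isCompact_Icc.reProdIm isCompact_Icc).prod (isCompact_Icc.reProdIm isCompact_Icc)
    obtain ⟨MF, hMF⟩ := hcomp.exists_bound_of_continuousOn (hF.mono (fun z hz => ⟨hz.1.1.1, hz.2.1.1⟩))
    refine ⟨MF, fun z h1 h2 h3 h4 h5 h6 => hMF z ⟨⟨⟨h1, h2⟩, abs_le.1 h3⟩, ⟨⟨h4, h5⟩, abs_le.1 h6⟩⟩⟩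
  have hf : ContinuousOn (fun z => F z * Complex.exp (-(β : ℂ) * L z)) {z | 0 < z.1.re ∧ 0 < z.2.re} :=
    (hF.mono fun z hz => ⟨hz.1.le, hz.2.le⟩).mul (Complex.continuous_exp.comp_continuousOn (continuousOn_const.mul hLc))
  have hpos : ∀ᶠ k in atTop, 0 < r k := hr.eventually_gt_atTop 0
  have hE : ∀ᶠ k in atTop, (s k : ℝ) / r k ≤ 1 / lam + 1 :=
    (seq_ratio lam hlam r s hr hb).eventually_le_const (by linarith)
  have hdomint : Integrable (fun w : ℝ × ℝ => MF * Real.exp (1 + (1 / lam + 1)) * (c / 2) ^ (-β) * ((1 + w.1 ^ 2)⁻¹ * (1 + w.2 ^ 2)⁻¹)) :=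
    dom_integrable.const_mul _
  have hDCT := tendsto_integral_filter_of_dominated_convergence (μ := (volume : Measure (ℝ × ℝ))) (l := atTop)
    (F := fun k => zPsi lam β (fun z => F z * Complex.exp (-(β : ℂ) * L z)) (r k) (s k)) _
    (by filter_upwards [hpos] with k hk using zPsi_meas lam β _ (r k) (s k) hk hf)
    (by
      filter_upwards [hpos, hE] with k hk hEk
      exact Eventually.of_forall fun w => zPsi_bound lam β hlam hβ h F L c hc hlow MF hMF hL (r k) (s k) hk _ hEk w)
    hdomint
    (Eventually.of_forall fun w => zPsi_pointwise lam A B β hlam hA hB h F L happ hF hL hLlog r s hr hb w)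
  rw [integral_const_mul, limit_int β hβ (1 + 1 / lam) B (by positivity) hB] at hDCT
  refine (hDCT.congr' ?_).trans (le_of_eq ?_)
  · filter_upwards [hpos, hE] with k hk hEk
    rw [Iint_zPsi]
    · exact hk
    · exact hdomint.mono' (zPsi_meas lam β _ (r k) (s k) hk hf)
        (Eventually.of_forall fun w => zPsi_bound lam β hlam hβ h F L c hc hlow MF hMF hL (r k) (s k) hk _ hEk w)
  · congr 1
    have hs : Real.sqrt (2 * Real.pi / B) = 2 * Real.pi / Real.sqrt (2 * Real.pi * B) := by
      have hpi := Real.pi_pos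
      rw [eq_div_iff (by positivity), ← Real.sqrt_mul (by positivity), show 2 * Real.pi / B * (2 * Real.pi * B) = (2 * Real.pi) ^ 2 by field_simp]
      exact Real.sqrt_sq (by positivity)
    have hΓ : Real.Gamma β ≠ 0 := (Real.Gamma_pos_of_pos (by linarith)).ne'
    have hsq : Real.sqrt (2 * Real.pi * B) ≠ 0 := by have := Real.pi_pos; positivity
    rw [hs]
    have hΓ' : ((Real.Gamma β : ℝ) : ℂ) ≠ 0 := by exact_mod_cast hΓ
    have hsq' : ((Real.sqrt (2 * Real.pi * B) : ℝ) : ℂ) ≠ 0 := by exact_mod_cast hsq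
    push_cast
    field_simp
    ring

theorem Iint_rec (β : ℝ) (h F L : ℂ × ℂ → ℂ)
    (hFan : AnalyticOnNhd ℂ F {z | 0 ≤ z.1.re ∧ 0 ≤ z.2.re})
    (hhan : AnalyticOnNhd ℂ h {z | 0 ≤ z.1.re ∧ 0 ≤ z.2.re})
    (hLd : DifferentiableOn ℂ L {z | 0 < z.1.re ∧ 0 < z.2.re})
    (hL : ∀ z : ℂ × ℂ, 0 < z.1.re → 0 < z.2.re → Complex.exp (L z) = h z)
    (hFp : ∀ z : ℂ × ℂ, F (z + (2 * Real.pi * Complex.I, 0)) = F z)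
    (hLp : ∀ z : ℂ × ℂ, L (z + (2 * Real.pi * Complex.I, 0)) = L z)
    (a b : ℝ) (ha : 0 < a) (hb : 0 < b) (r s : ℕ) :
    (r : ℂ) * Iint (fun z => F z * Complex.exp (-(β : ℂ) * L z)) a b r s =
      Iint (fun z => (-(fderiv ℂ F z (1, 0) * h z) + β * F z * fderiv ℂ h z (1, 0)) *
        Complex.exp (-((β + 1 : ℝ) : ℂ) * L z)) a b r s := by
  have hQo : IsOpen {z : ℂ × ℂ | 0 < z.1.re ∧ 0 < z.2.re} :=
    (isOpen_lt continuous_const (Complex.continuous_re.comp continuous_fst)).inter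
      (isOpen_lt continuous_const (Complex.continuous_re.comp continuous_snd))
  have hFdc : ContinuousOn (fun z => fderiv ℂ F z (1, 0)) {z | 0 ≤ z.1.re ∧ 0 ≤ z.2.re} :=
    hFan.fderiv.continuousOn.clm_apply continuousOn_const
  have hhdc : ContinuousOn (fun z => fderiv ℂ h z (1, 0)) {z | 0 ≤ z.1.re ∧ 0 ≤ z.2.re} :=
    hhan.fderiv.continuousOn.clm_apply continuousOn_const
  unfold Iint
  rw [← intervalIntegral.integral_const_mul]
  congr 1; ext θ
  rw [← intervalIntegral.integral_const_mul, ← sub_eq_zero]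
  set zt : ℝ → ℂ × ℂ := fun t => ((a : ℂ) + t * Complex.I, (b : ℂ) + θ * Complex.I) with hzt
  have hztc : Continuous zt := by fun_prop
  have hmem : ∀ t, zt t ∈ {z : ℂ × ℂ | 0 < z.1.re ∧ 0 < z.2.re} := by
    intro t; simp [hzt, ha, hb]
  have hmem' : ∀ t, zt t ∈ {z : ℂ × ℂ | 0 ≤ z.1.re ∧ 0 ≤ z.2.re} := fun t => ⟨(hmem t).1.le, (hmem t).2.le⟩
  have cF : Continuous (fun t => F (zt t)) := hFan.continuousOn.comp_continuous hztc hmem'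
  have ch : Continuous (fun t => h (zt t)) := hhan.continuousOn.comp_continuous hztc hmem'
  have cL : Continuous (fun t => L (zt t)) := hLd.continuousOn.comp_continuous hztc hmem
  have cFd : Continuous (fun t => fderiv ℂ F (zt t) (1, 0)) := hFdc.comp_continuous hztc hmem'
  have chd : Continuous (fun t => fderiv ℂ h (zt t) (1, 0)) := hhdc.comp_continuous hztc hmem'
  have cE : Continuous (fun t : ℝ => Complex.exp (r * ((a : ℂ) + t * Complex.I) + s * ((b : ℂ) + θ * Complex.I))) := by fun_prop
  have cP : ∀ γ : ℂ, Continuous (fun t => Complex.exp (γ * L (zt t))) := fun γ =>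
    Complex.continuous_exp.comp (continuous_const.mul cL)
  rw [← intervalIntegral.integral_sub]
  rotate_left
  · exact (continuous_const.mul ((cF.mul (cP _)).mul cE)).intervalIntegrable _ _
  · exact ((((cFd.mul ch).neg.add ((continuous_const.mul cF).mul chd)).mul (cP _)).mul cE).intervalIntegrable _ _
  have hD : ∀ t : ℝ, HasDerivAt (fun t : ℝ => F (zt t) * Complex.exp (-(β : ℂ) * L (zt t)) *
      Complex.exp (r * ((a : ℂ) + t * Complex.I) + s * ((b : ℂ) + θ * Complex.I)) / Complex.I)
      ((r : ℂ) * (F (zt t) * Complex.exp (-(β : ℂ) * L (zt t)) * Complex.exp (r * ((a : ℂ) + t * Complex.I) + s * ((b : ℂ) + θ * Complex.I)))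
        - (-(fderiv ℂ F (zt t) (1, 0) * h (zt t)) + β * F (zt t) * fderiv ℂ h (zt t) (1, 0)) *
        Complex.exp (-((β + 1 : ℝ) : ℂ) * L (zt t)) * Complex.exp (r * ((a : ℂ) + t * Complex.I) + s * ((b : ℂ) + θ * Complex.I))) t := by
    intro t
    have hin : HasDerivAt (fun t : ℝ => (a : ℂ) + t * Complex.I) Complex.I t := by
      simpa using ((Complex.ofRealCLM.hasDerivAt (x := t)).mul_const Complex.I).const_add (a : ℂ)
    have hzd : HasDerivAt zt (Complex.I, 0) t := hin.prodMk (hasDerivAt_const t _)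
    have key : ∀ G : ℂ × ℂ → ℂ, DifferentiableAt ℂ G (zt t) →
        HasDerivAt (fun t => G (zt t)) (Complex.I * fderiv ℂ G (zt t) (1, 0)) t := by
      intro G hG
      have h1 := (hG.hasFDerivAt.restrictScalars ℝ).comp_hasDerivAt t hzd
      refine h1.congr_deriv ?_
      have : ((Complex.I, 0) : ℂ × ℂ) = Complex.I • ((1, 0) : ℂ × ℂ) := by simp
      rw [ContinuousLinearMap.coe_restrictScalars', this, map_smul, smul_eq_mul]
    have dF := key F (hFan _ (hmem' t)).differentiableAt
    have dh := key h (hhan _ (hmem' t)).differentiableAt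
    have dL := key L ((hLd _ (hmem t)).differentiableAt (hQo.mem_nhds (hmem t)))
    have hLz := hL _ (hmem t).1 (hmem t).2
    have hder : Complex.exp (L (zt t)) * fderiv ℂ L (zt t) (1, 0) = fderiv ℂ h (zt t) (1, 0) := by
      have h1 := dL.cexp
      have h2 : HasDerivAt (fun t => h (zt t)) (Complex.exp (L (zt t)) * (Complex.I * fderiv ℂ L (zt t) (1, 0))) t := by
        refine h1.congr_of_eventuallyEq (Eventually.of_forall fun t => ?_)
        exact (hL _ (hmem t).1 (hmem t).2).symm
      have h3 := h2.unique dh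
      refine mul_left_cancel₀ Complex.I_ne_zero ?_
      rw [← h3]; ring
    have dE : HasDerivAt (fun t : ℝ => Complex.exp (r * ((a : ℂ) + t * Complex.I) + s * ((b : ℂ) + θ * Complex.I)))
        (Complex.exp (r * ((a : ℂ) + t * Complex.I) + s * ((b : ℂ) + θ * Complex.I)) * (r * Complex.I)) t :=
      ((hin.const_mul (r : ℂ)).add_const _).cexp
    have dP := (dL.const_mul (-(β : ℂ))).cexp
    have := ((dF.mul dP).mul dE).div_const Complex.I
    refine this.congr_deriv ?_
    have e1 : Complex.exp (-((β + 1 : ℝ) : ℂ) * L (zt t)) * Complex.exp (L (zt t)) = Complex.exp (-(β : ℂ) * L (zt t)) := by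
      rw [← Complex.exp_add]; congr 1; push_cast; ring
    simp only [Pi.mul_apply]
    rw [← hder, ← hLz, ← e1]
    generalize Complex.exp (-((β + 1 : ℝ) : ℂ) * L (zt t)) = X
    generalize Complex.exp (L (zt t)) = Y
    generalize Complex.exp (r * ((a : ℂ) + t * Complex.I) + s * ((b : ℂ) + θ * Complex.I)) = Z
    have hI := Complex.I_ne_zero
    rw [div_eq_iff hI]
    ring
  rw [intervalIntegral.integral_eq_sub_of_hasDerivAt (fun t _ => hD t)]
  · have hz : zt Real.pi = zt (-Real.pi) + (2 * Real.pi * Complex.I, 0) := by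
      simp only [hzt, Prod.mk_add_mk, add_zero]
      congr 1; push_cast; ring
    have hE : Complex.exp (r * ((a : ℂ) + (Real.pi : ℝ) * Complex.I) + s * ((b : ℂ) + θ * Complex.I)) =
        Complex.exp (r * ((a : ℂ) + ((-Real.pi : ℝ) : ℂ) * Complex.I) + s * ((b : ℂ) + θ * Complex.I)) := by
      rw [Complex.exp_eq_exp_iff_exists_int]
      refine ⟨r, ?_⟩
      push_cast; ring
    rw [hE, hz, hFp, hLp, sub_self]
  · exact ((continuous_const.mul ((cF.mul (cP _)).mul cE)).sub ((((cFd.mul ch).neg.add ((continuous_const.mul cF).mul chd)).mul (cP _)).mul cE)).intervalIntegrable _ _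

theorem core_gen (lam A B : ℝ) (hlam : 0 < lam) (hA : 0 < A) (hB : 0 < B) (h L : ℂ × ℂ → ℂ)
    (c : ℝ) (hc : 0 < c)
    (hlow : ∀ z : ℂ × ℂ, 0 ≤ z.1.re → z.1.re ≤ 1 → |z.1.im| ≤ Real.pi → 0 ≤ z.2.re → z.2.re ≤ 1 →
      |z.2.im| ≤ Real.pi → c * (‖z.1 + z.2 / lam‖ + ‖z.2‖ ^ 2) ≤ ‖h z‖)
    (happ : ∀ ε > 0, ∀ᶠ z in 𝓝 (0 : ℂ × ℂ),
      ‖h z - (A * (z.1 + z.2 / lam) - A * B / 2 * z.2 ^ 2)‖ ≤ ε * (‖z.1 + z.2 / lam‖ + ‖z.2‖ ^ 2))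
    (h0 : h 0 = 0) (hd0 : fderiv ℂ h 0 (1, 0) = A)
    (hhan : AnalyticOnNhd ℂ h {z | 0 ≤ z.1.re ∧ 0 ≤ z.2.re})
    (hLd : DifferentiableOn ℂ L {z | 0 < z.1.re ∧ 0 < z.2.re})
    (hL : ∀ z : ℂ × ℂ, 0 < z.1.re → 0 < z.2.re → Complex.exp (L z) = h z)
    (hhp : ∀ z : ℂ × ℂ, h (z + (2 * Real.pi * Complex.I, 0)) = h z)
    (hLp : ∀ z : ℂ × ℂ, L (z + (2 * Real.pi * Complex.I, 0)) = L z)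
    (hLlog : ∀ᶠ z in 𝓝 (0 : ℂ × ℂ), 0 < z.1.re → 0 < z.2.re → L z = Complex.log (h z))
    (r s : ℕ → ℕ) (hr : Tendsto r atTop atTop)
    (hb : ∃ C : ℝ, ∀ k, |(r k : ℝ) - lam * (s k : ℝ)| ≤ C) (N : ℕ) :
    ∀ (β : ℝ) (_ : ∀ m : ℕ, β ≠ -(m : ℝ)) (_ : 4 ≤ β + N) (F : ℂ × ℂ → ℂ)
    (_ : AnalyticOnNhd ℂ F {z | 0 ≤ z.1.re ∧ 0 ≤ z.2.re})
    (_ : ∀ z : ℂ × ℂ, F (z + (2 * Real.pi * Complex.I, 0)) = F z),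
    Tendsto (fun k => (((r k : ℝ) ^ (3 / 2 - β) : ℝ) : ℂ) *
      Iint (fun z => F z * Complex.exp (-(β : ℂ) * L z)) ((r k : ℝ)⁻¹) ((r k : ℝ)⁻¹) (r k) (s k)) atTop
      (𝓝 (4 * Real.pi ^ 2 * F 0 * ((A ^ (-β) / (Real.Gamma β * Real.sqrt (2 * Real.pi * B)) : ℝ) : ℂ))) := by
  induction N with
  | zero =>
    intro β hβ hβN F hF hFp
    exact core_base lam A B β hlam hA hB (by simpa using hβN) h F L c hc hlow happ hF.continuousOn hLd.continuousOn hL hLlog r s hr hb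
  | succ N ih =>
    intro β hβ hβN F hF hFp
    have hper : ∀ G : ℂ × ℂ → ℂ, (∀ z : ℂ × ℂ, G (z + (2 * Real.pi * Complex.I, 0)) = G z) →
        ∀ z, fderiv ℂ G (z + (2 * Real.pi * Complex.I, 0)) = fderiv ℂ G z := by
      intro G hG z
      rw [← fderiv_comp_add_right]
      congr 1; ext z; exact hG z
    have hdan : ∀ G : ℂ × ℂ → ℂ, AnalyticOnNhd ℂ G {z | 0 ≤ z.1.re ∧ 0 ≤ z.2.re} →
        AnalyticOnNhd ℂ (fun z => fderiv ℂ G z (1, 0)) {z | 0 ≤ z.1.re ∧ 0 ≤ z.2.re} := by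
      intro G hG
      exact (ContinuousLinearMap.apply ℂ ℂ ((1, 0) : ℂ × ℂ)).comp_analyticOnNhd hG.fderiv
    have h1 := ih (β + 1) (fun m hm => hβ (m + 1) (by push_cast; linarith)) (by push_cast at hβN; linarith)
      (fun z => -(fderiv ℂ F z (1, 0) * h z) + β * F z * fderiv ℂ h z (1, 0))
      ((((hdan F hF).mul hhan).neg).add
        ((analyticOnNhd_const.mul hF).mul (hdan h hhan)))
      (fun z => by simp only [hper F hFp, hper h hhp, hFp, hhp])
    refine (h1.congr' ?_).trans (le_of_eq ?_)
    · filter_upwards [hr.eventually_gt_atTop 0] with k hk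
      have hk' : (0:ℝ) < r k := by exact_mod_cast hk
      rw [← Iint_rec β h F L hF hhan hLd hL hFp hLp _ _ (by positivity) (by positivity), ← mul_assoc]
      congr 1
      rw [show (3 / 2 - β) = (3 / 2 - (β + 1)) + 1 by ring, Real.rpow_add hk', Real.rpow_one]
      push_cast; rfl
    · have hβ0 : β ≠ 0 := by simpa using hβ 0
      congr 1
      rw [h0, hd0, Real.Gamma_add_one hβ0, neg_add, Real.rpow_add hA, Real.rpow_neg_one]
      have hΓ' : ((Real.Gamma β : ℝ) : ℂ) ≠ 0 := by exact_mod_cast Real.Gamma_ne_zero hβ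
      have hsq' : ((Real.sqrt (2 * Real.pi * B) : ℝ) : ℂ) ≠ 0 := by
        have := Real.pi_pos
        exact_mod_cast (by positivity : Real.sqrt (2 * Real.pi * B) ≠ 0)
      have hβ' : (β : ℂ) ≠ 0 := by exact_mod_cast hβ0
      have hA' : (A : ℂ) ≠ 0 := by exact_mod_cast hA.ne'
      push_cast
      field_simp
      ring

theorem radius1 (G : ℂ → ℂ) (hG : DifferentiableOn ℂ G {z | 0 < z.re})
    (hp : ∀ z, G (z + 2 * Real.pi * Complex.I) = G z) (a a' : ℝ) (ha : 0 < a) (ha' : 0 < a') :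
    ∫ t in (-Real.pi)..Real.pi, G ((a : ℂ) + t * Complex.I) = ∫ t in (-Real.pi)..Real.pi, G ((a' : ℂ) + t * Complex.I) := by
  have h := Complex.integral_boundary_rect_eq_zero_of_differentiableOn G
    (⟨a, -Real.pi⟩) (⟨a', Real.pi⟩) (hG.mono (by
      intro z hz
      have := hz.1
      simp only [Set.mem_preimage, Set.mem_uIcc] at this
      show 0 < z.re
      rcases this with h | h <;> linarith))
  simp only at h
  have e : ∀ x : ℝ, G ((x : ℂ) + (Real.pi : ℝ) * Complex.I) = G ((x : ℂ) + ((-Real.pi : ℝ) : ℂ) * Complex.I) := by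
    intro x
    rw [← hp ((x : ℂ) + ((-Real.pi : ℝ) : ℂ) * Complex.I)]
    congr 1; push_cast; ring
  simp_rw [e] at h
  rw [sub_self, zero_add, sub_eq_zero, smul_eq_mul, smul_eq_mul] at h
  exact (mul_left_cancel₀ Complex.I_ne_zero h).symm

theorem Iint_radius (f : ℂ × ℂ → ℂ) (hf : DifferentiableOn ℂ f {z | 0 < z.1.re ∧ 0 < z.2.re})
    (hp1 : ∀ z : ℂ × ℂ, f (z + (2 * Real.pi * Complex.I, 0)) = f z)
    (hp2 : ∀ z : ℂ × ℂ, f (z + (0, 2 * Real.pi * Complex.I)) = f z)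
    (a b a' b' : ℝ) (ha : 0 < a) (hb : 0 < b) (ha' : 0 < a') (hb' : 0 < b') (r s : ℕ) :
    Iint f a b r s = Iint f a' b' r s := by
  have hexp : ∀ (z w : ℂ) (n : ℕ), Complex.exp (n * (z + 2 * Real.pi * Complex.I) + w) = Complex.exp (n * z + w) := by
    intro z w n
    rw [Complex.exp_eq_exp_iff_exists_int]
    exact ⟨n, by push_cast; ring⟩
  have step1 : Iint f a b r s = Iint f a' b r s := by
    unfold Iint
    congr 1; ext θ
    refine radius1 (fun z => f (z, (b : ℂ) + θ * Complex.I) * Complex.exp (r * z + s * ((b : ℂ) + θ * Complex.I))) ?_ ?_ a a' ha ha'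
    · have h1 : DifferentiableOn ℂ (fun z : ℂ => f (z, (b : ℂ) + θ * Complex.I)) {z | 0 < z.re} :=
        hf.comp (by fun_prop) (fun z hz => ⟨hz, by simpa using hb⟩)
      exact h1.mul (by fun_prop)
    · intro z
      rw [hexp, ← hp1 (z, _)]
      simp
  rw [step1]
  unfold Iint
  have hcont : ∀ b : ℝ, 0 < b → Continuous (fun w : ℝ × ℝ => f ((a' : ℂ) + w.2 * Complex.I, (b : ℂ) + w.1 * Complex.I) *
      Complex.exp (r * ((a' : ℂ) + w.2 * Complex.I) + s * ((b : ℂ) + w.1 * Complex.I))) := by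
    intro b hb
    refine Continuous.mul (hf.continuousOn.comp_continuous (by fun_prop) (fun w => ?_)) (by fun_prop)
    simp [ha', hb]
  have hswap : ∀ b : ℝ, 0 < b → (∫ θ in (-Real.pi)..Real.pi, ∫ t in (-Real.pi)..Real.pi,
    f ((a' : ℂ) + t * Complex.I, (b : ℂ) + θ * Complex.I) *
      Complex.exp (r * ((a' : ℂ) + t * Complex.I) + s * ((b : ℂ) + θ * Complex.I))) = ∫ t in (-Real.pi)..Real.pi, ∫ θ in (-Real.pi)..Real.pi,
    f ((a' : ℂ) + t * Complex.I, (b : ℂ) + θ * Complex.I) *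
      Complex.exp (r * ((a' : ℂ) + t * Complex.I) + s * ((b : ℂ) + θ * Complex.I)) := by
    intro b hb
    refine MeasureTheory.intervalIntegral_intervalIntegral_swap (F := fun θ t => f ((a' : ℂ) + t * Complex.I, (b : ℂ) + θ * Complex.I) *
      Complex.exp (r * ((a' : ℂ) + t * Complex.I) + s * ((b : ℂ) + θ * Complex.I))) ?_
    refine ((hcont b hb).continuousOn.integrableOn_compact (K := Set.uIcc (-Real.pi) Real.pi ×ˢ Set.uIcc (-Real.pi) Real.pi) (isCompact_uIcc.prod isCompact_uIcc)).mono_set ?_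
    exact Set.prod_mono Set.uIoc_subset_uIcc Set.uIoc_subset_uIcc
  rw [hswap b hb, hswap b' hb']
  congr 1; ext t
  refine radius1 (fun z => f ((a' : ℂ) + t * Complex.I, z) * Complex.exp (r * ((a' : ℂ) + t * Complex.I) + s * z)) ?_ ?_ b b' hb hb'
  · have h1 : DifferentiableOn ℂ (fun z : ℂ => f ((a' : ℂ) + t * Complex.I, z)) {z | 0 < z.re} :=
      hf.comp (by fun_prop) (fun z hz => ⟨by simpa using ha', hz⟩)
    exact h1.mul (by fun_prop)
  · intro z
    rw [add_comm _ ((s : ℂ) * _), hexp, ← hp2 (_, z), add_comm ((s : ℂ) * _)]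
    simp

open MeasureTheory in
theorem coef1D (b : ℕ → ℂ) (x0 : ℂ) (ρ : ℝ) (hx : ‖x0‖ = ρ) (hs : Summable (fun m => b m * x0 ^ m)) (r : ℕ) :
    ∫ t in (-Real.pi)..Real.pi, (∑' m, b m * ((ρ : ℂ) * Complex.exp (-(t * Complex.I))) ^ m) * Complex.exp (r * (t * Complex.I)) =
      2 * Real.pi * b r * (ρ : ℂ) ^ r := by
  have hρ : 0 ≤ ρ := hx ▸ norm_nonneg _
  have hsn : Summable (fun m => ‖b m‖ * ρ ^ m) := by
    have := hs.norm
    simpa [norm_mul, norm_pow, hx] using this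
  have hn : ∀ (m : ℕ) (t : ℝ), ‖b m * ((ρ : ℂ) * Complex.exp (-(t * Complex.I))) ^ m‖ = ‖b m‖ * ρ ^ m := by
    intro m t
    rw [norm_mul, norm_pow, norm_mul, Complex.norm_real, Real.norm_of_nonneg hρ, Complex.norm_exp]
    simp
  have hn2 : ∀ t : ℝ, ‖Complex.exp (r * (t * Complex.I))‖ = 1 := by
    intro t; rw [Complex.norm_exp]; simp
  have hH := intervalIntegral.hasSum_integral_of_dominated_convergence (μ := volume) (a := -Real.pi) (b := Real.pi)
    (F := fun m t => b m * ((ρ : ℂ) * Complex.exp (-(t * Complex.I))) ^ m * Complex.exp (r * (t * Complex.I)))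
    (f := fun t => (∑' m, b m * ((ρ : ℂ) * Complex.exp (-(t * Complex.I))) ^ m) * Complex.exp (r * (t * Complex.I)))
    (fun m _ => ‖b m‖ * ρ ^ m)
    (fun m => (by fun_prop : Continuous (fun t : ℝ => b m * ((ρ : ℂ) * Complex.exp (-(t * Complex.I))) ^ m * Complex.exp (r * (t * Complex.I)))).aestronglyMeasurable)
    (fun m => Eventually.of_forall fun t _ => by rw [norm_mul, hn, hn2, mul_one])
    (Eventually.of_forall fun t _ => hsn)
    intervalIntegrable_const
    (Eventually.of_forall fun t _ => by
      refine HasSum.mul_right _ (Summable.hasSum ?_)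
      exact Summable.of_norm (by simpa only [hn] using hsn))
  have hval : ∀ m, ∫ t in (-Real.pi)..Real.pi, b m * ((ρ : ℂ) * Complex.exp (-(t * Complex.I))) ^ m * Complex.exp (r * (t * Complex.I)) =
      if m = r then 2 * Real.pi * b r * (ρ : ℂ) ^ r else 0 := by
    intro m
    have e1 : ∀ t : ℝ, b m * ((ρ : ℂ) * Complex.exp (-(t * Complex.I))) ^ m * Complex.exp (r * (t * Complex.I)) =
        b m * (ρ : ℂ) ^ m * Complex.exp ((((r : ℂ) - m) * Complex.I) * t) := by
      intro t
      rw [mul_pow, ← Complex.exp_nat_mul, mul_assoc, mul_assoc, ← Complex.exp_add, ← mul_assoc]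
      congr 2; ring
    simp_rw [e1]
    rw [intervalIntegral.integral_const_mul]
    split_ifs with hm
    · subst hm
      simp
      ring
    · have hne : ((r : ℂ) - m) * Complex.I ≠ 0 := by
        refine mul_ne_zero (sub_ne_zero.2 ?_) Complex.I_ne_zero
        exact_mod_cast Ne.symm hm
      rw [integral_exp_mul_complex hne]
      have : Complex.exp (((r : ℂ) - m) * Complex.I * (Real.pi : ℝ)) = Complex.exp (((r : ℂ) - m) * Complex.I * ((-Real.pi : ℝ) : ℂ)) := by
        rw [Complex.exp_eq_exp_iff_exists_int]
        exact ⟨(r : ℤ) - m, by push_cast; ring⟩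
      rw [this, sub_self, zero_div, mul_zero]
  simp_rw [hval] at hH
  exact (hH.unique (hasSum_ite_eq r _))

theorem coef_extract (p q T : ℝ) (hp : 0 < p) (hq : 0 < q) (a : ℕ → ℕ → ℂ) (g : ℂ → ℂ → ℂ)
    (hg : ∀ x y : ℂ, ‖x‖ = p * Real.exp (-T) → ‖y‖ = q * Real.exp (-T) →
      g x y = ∑' m : ℕ, ∑' n : ℕ, a m n * x ^ m * y ^ n)
    (hg0 : ∀ x y : ℂ, ‖x‖ = p * Real.exp (-T) → ‖y‖ = q * Real.exp (-T) → g x y ≠ 0) (r s : ℕ)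
    (hne : Iint (fun z => g (p * Complex.exp (-z.1)) (q * Complex.exp (-z.2))) T T r s ≠ 0) :
    Iint (fun z => g (p * Complex.exp (-z.1)) (q * Complex.exp (-z.2))) T T r s =
      4 * Real.pi ^ 2 * a r s * (p : ℂ) ^ r * (q : ℂ) ^ s := by
  set ρ₁ := p * Real.exp (-T) with hρ₁
  set ρ₂ := q * Real.exp (-T) with hρ₂
  have hρ₁p : 0 < ρ₁ := by positivity
  have hρ₂p : 0 < ρ₂ := by positivity
  have nrm : ∀ (ρ : ℝ), 0 < ρ → ∀ t : ℝ, ‖(ρ : ℂ) * Complex.exp (-(t * Complex.I))‖ = ρ := by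
    intro ρ hρ t
    rw [norm_mul, Complex.norm_real, Real.norm_of_nonneg hρ.le, Complex.norm_exp]
    simp
  set S : ℕ → ℂ → ℂ := fun m y => ∑' n, a m n * y ^ n with hS
  have hg' : ∀ x y : ℂ, ‖x‖ = ρ₁ → ‖y‖ = ρ₂ → g x y = ∑' m, S m y * x ^ m := by
    intro x y hx hy
    rw [hg x y hx hy]
    congr 1; ext m
    rw [hS]
    simp only
    rw [← tsum_mul_right]
    congr 1; ext n; ring
  have hsum : ∀ y : ℂ, ‖y‖ = ρ₂ → Summable (fun m => S m y * (ρ₁ : ℂ) ^ m) := by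
    intro y hy
    by_contra hns
    have hx : ‖(ρ₁ : ℂ)‖ = ρ₁ := by rw [Complex.norm_real, Real.norm_of_nonneg hρ₁p.le]
    apply hg0 (ρ₁ : ℂ) y hx hy
    rw [hg' _ _ hx hy, tsum_eq_zero_of_not_summable hns]
  have hx0 : ∀ t : ℝ, (p : ℂ) * Complex.exp (-((T : ℂ) + t * Complex.I)) = (ρ₁ : ℂ) * Complex.exp (-(t * Complex.I)) := by
    intro t
    rw [hρ₁, neg_add, Complex.exp_add]; push_cast; ring
  have hy0 : ∀ t : ℝ, (q : ℂ) * Complex.exp (-((T : ℂ) + t * Complex.I)) = (ρ₂ : ℂ) * Complex.exp (-(t * Complex.I)) := by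
    intro t
    rw [hρ₂, neg_add, Complex.exp_add]; push_cast; ring
  have hI : Iint (fun z => g (p * Complex.exp (-z.1)) (q * Complex.exp (-z.2))) T T r s =
      (2 * Real.pi * (ρ₁ : ℂ) ^ r * Complex.exp (r * T + s * T)) *
      ∫ θ in (-Real.pi)..Real.pi, S r ((ρ₂ : ℂ) * Complex.exp (-(θ * Complex.I))) * Complex.exp (s * (θ * Complex.I)) := by
    unfold Iint
    rw [← intervalIntegral.integral_const_mul]
    congr 1; ext θ
    have h1 := coef1D (fun m => S m ((ρ₂ : ℂ) * Complex.exp (-(θ * Complex.I)))) (ρ₁ : ℂ) ρ₁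
      (by rw [Complex.norm_real, Real.norm_of_nonneg hρ₁p.le]) (hsum _ (nrm ρ₂ hρ₂p θ)) r
    have h2 : ∀ t : ℝ, g (p * Complex.exp (-((T : ℂ) + t * Complex.I))) (q * Complex.exp (-((T : ℂ) + θ * Complex.I))) *
      Complex.exp (r * ((T : ℂ) + t * Complex.I) + s * ((T : ℂ) + θ * Complex.I)) =
      (Complex.exp (r * T + s * T) * Complex.exp (s * (θ * Complex.I))) * ((∑' m, S m ((ρ₂ : ℂ) * Complex.exp (-(θ * Complex.I))) * ((ρ₁ : ℂ) * Complex.exp (-(t * Complex.I))) ^ m) *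
        Complex.exp (r * (t * Complex.I))) := by
      intro t
      rw [hx0, hy0, hg' _ _ (nrm ρ₁ hρ₁p t) (nrm ρ₂ hρ₂p θ),
        show (r : ℂ) * ((T : ℂ) + t * Complex.I) + s * ((T : ℂ) + θ * Complex.I) = (r * T + s * T) + s * (θ * Complex.I) + r * (t * Complex.I) by ring,
        Complex.exp_add, Complex.exp_add]
      ring
    simp_rw [h2]
    rw [intervalIntegral.integral_const_mul, h1]
    ring
  have hex : ∃ y0 : ℂ, ‖y0‖ = ρ₂ ∧ S r y0 ≠ 0 := by
    by_contra hcon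
    push Not at hcon
    apply hne
    rw [hI]
    simp [hcon _ (nrm ρ₂ hρ₂p _)]
  obtain ⟨y0, hy0n, hSy0⟩ := hex
  have hs0 : Summable (fun n => a r n * y0 ^ n) := by
    by_contra hns
    exact hSy0 (tsum_eq_zero_of_not_summable hns)
  rw [hI, hS]
  simp only
  rw [coef1D (fun n => a r n) y0 ρ₂ hy0n hs0 s]
  have e1 : (ρ₁ : ℂ) ^ r * Complex.exp (r * T) = (p : ℂ) ^ r := by
    rw [Complex.exp_nat_mul, ← mul_pow, hρ₁]; congr 1
    push_cast
    rw [mul_assoc, ← Complex.exp_add]; simp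
  have e2 : (ρ₂ : ℂ) ^ s * Complex.exp (s * T) = (q : ℂ) ^ s := by
    rw [Complex.exp_nat_mul, ← mul_pow, hρ₂]; congr 1
    push_cast
    rw [mul_assoc, ← Complex.exp_add]; simp
  rw [← e1, ← e2, Complex.exp_add]
  ring

theorem log_branch (U : Set (ℂ × ℂ)) (hUo : IsOpen U) (hUc : Convex ℝ U) (z0 : ℂ × ℂ) (hz0 : z0 ∈ U)
    (G : ℂ × ℂ → ℂ) (hG : DifferentiableOn ℂ G U) (hG0 : ∀ z ∈ U, G z ≠ 0) (w0 : ℂ) (hw0 : Complex.exp w0 = G z0) :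
    ∃ l : ℂ × ℂ → ℂ, DifferentiableOn ℂ l U ∧ (∀ z ∈ U, Complex.exp (l z) = G z) ∧ l z0 = w0 := by
  have := hUc.contractibleSpace ⟨z0, hz0⟩
  have hsc : IsSimplyConnected U := by
    unfold IsSimplyConnected; infer_instance
  obtain ⟨f, hfc, hf⟩ := Complex.exists_continuousOn_eqOn_exp_comp hsc hUo hG.continuousOn
    (by rintro ⟨z, hz, h⟩; exact hG0 z hz h)
  have hfe : ∀ z ∈ U, Complex.exp (f z) = G z := fun z hz => hf hz
  have hdiff : DifferentiableOn ℂ f U := by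
    intro z1 hz1
    have hd : ContinuousAt f z1 := hfc.continuousAt (hUo.mem_nhds hz1)
    have hGd : DifferentiableAt ℂ G z1 := (hG z1 hz1).differentiableAt (hUo.mem_nhds hz1)
    have ev : ∀ᶠ z in 𝓝 z1, f z = f z1 + Complex.log (G z / G z1) := by
      have h1 : ∀ᶠ z in 𝓝 z1, ‖f z - f z1‖ < 1 := by
        have := (hd.sub_const (f z1)).norm
        have h2 : Tendsto (fun z => ‖f z - f z1‖) (𝓝 z1) (𝓝 0) := by simpa [ContinuousAt] using this
        exact h2.eventually_lt_const one_pos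
      filter_upwards [h1, hUo.mem_nhds hz1] with z hz hzU
      rw [← hfe z hzU, ← hfe z1 hz1, ← Complex.exp_sub, Complex.log_exp]
      · ring
      · have := (Complex.abs_im_le_norm (f z - f z1)).trans hz.le
        have hp := Real.pi_gt_three
        linarith [(abs_le.1 this).1]
      · have := (Complex.abs_im_le_norm (f z - f z1)).trans hz.le
        have hp := Real.pi_gt_three
        linarith [(abs_le.1 this).2]
    have hd2 : DifferentiableAt ℂ (fun z => f z1 + Complex.log (G z / G z1)) z1 := by
      have hq : DifferentiableAt ℂ (fun z => G z / G z1) z1 := by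
        simp only [div_eq_mul_inv]
        exact hGd.mul_const _
      refine DifferentiableAt.const_add _ (DifferentiableAt.clog hq ?_)
      rw [div_self (hG0 z1 hz1)]
      exact Complex.one_mem_slitPlane
    exact (hd2.congr_of_eventuallyEq ev).differentiableWithinAt
  refine ⟨fun z => f z + (w0 - f z0), hdiff.add_const _, fun z hz => ?_, by ring⟩
  rw [Complex.exp_add, hfe z hz, Complex.exp_sub, hw0, hfe z0 hz0, div_self (hG0 z0 hz0), mul_one]

theorem partial1 (G : ℂ × ℂ → ℂ) (z : ℂ × ℂ) (hG : DifferentiableAt ℂ G z) :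
    HasDerivAt (fun x => G (x, z.2)) (fderiv ℂ G z (1, 0)) z.1 := by
  have h1 : HasDerivAt (fun x : ℂ => (x, z.2)) ((1, 0) : ℂ × ℂ) z.1 := (hasDerivAt_id z.1).prodMk (hasDerivAt_const _ _)
  exact hG.hasFDerivAt.comp_hasDerivAt z.1 h1

theorem partial2 (G : ℂ × ℂ → ℂ) (z : ℂ × ℂ) (hG : DifferentiableAt ℂ G z) :
    HasDerivAt (fun y => G (z.1, y)) (fderiv ℂ G z (0, 1)) z.2 := by
  have h1 : HasDerivAt (fun y : ℂ => (z.1, y)) ((0, 1) : ℂ × ℂ) z.2 := (hasDerivAt_const _ _).prodMk (hasDerivAt_id z.2)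
  exact hG.hasFDerivAt.comp_hasDerivAt z.2 h1

theorem branch_eq (β : ℝ) (H g : ℂ → ℂ → ℂ) (l : ℂ × ℂ → ℂ) (c0 : ℝ) (hc0 : 0 < c0)
    (hl : ∀ᶠ z in 𝓝 (0 : ℂ × ℂ), DifferentiableAt ℂ l z)
    (hH : ∀ᶠ z in 𝓝 (0 : ℂ × ℂ), DifferentiableAt ℂ (fun z : ℂ × ℂ => H z.1 z.2) z)
    (hle : ∀ᶠ z in 𝓝 (0 : ℂ × ℂ), Complex.exp (l z) = H z.1 z.2)
    (hl0 : l 0 = (Real.log c0 : ℝ))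
    (hgan : AnalyticAt ℂ (fun z : ℂ × ℂ => g z.1 z.2) (0, 0))
    (hg0 : g 0 0 = ((c0 ^ (-β) : ℝ) : ℂ))
    (hgx : ∀ᶠ z : ℂ × ℂ in 𝓝 (0, 0),
      H z.1 z.2 * deriv (fun x => g x z.2) z.1
        = -(β : ℂ) * g z.1 z.2 * deriv (fun x => H x z.2) z.1)
    (hgy : ∀ᶠ z : ℂ × ℂ in 𝓝 (0, 0),
      H z.1 z.2 * deriv (fun y => g z.1 y) z.2
        = -(β : ℂ) * g z.1 z.2 * deriv (fun y => H z.1 y) z.2) :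
    ∀ᶠ z in 𝓝 (0 : ℂ × ℂ), g z.1 z.2 = Complex.exp (-(β : ℂ) * l z) := by
  have hgd : ∀ᶠ z in 𝓝 (0 : ℂ × ℂ), DifferentiableAt ℂ (fun z : ℂ × ℂ => g z.1 z.2) z :=
    hgan.eventually_analyticAt.mono fun z hz => hz.differentiableAt
  have hgx' : ∀ᶠ z : ℂ × ℂ in 𝓝 0, H z.1 z.2 * deriv (fun x => g x z.2) z.1
        = -(β : ℂ) * g z.1 z.2 * deriv (fun x => H x z.2) z.1 := hgx
  have hgy' : ∀ᶠ z : ℂ × ℂ in 𝓝 0, H z.1 z.2 * deriv (fun y => g z.1 y) z.2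
        = -(β : ℂ) * g z.1 z.2 * deriv (fun y => H z.1 y) z.2 := hgy
  have hall := hl.and (hH.and (hle.eventually_nhds.and (hgd.and (hgx'.and hgy'))))
  obtain ⟨δ, hδ, hball⟩ := Metric.eventually_nhds_iff_ball.1 hall
  set φ : ℂ × ℂ → ℂ := fun z => g z.1 z.2 * Complex.exp (β * l z) with hφ
  have hφd : ∀ z ∈ Metric.ball (0 : ℂ × ℂ) δ, DifferentiableAt ℂ φ z := by
    intro z hz
    obtain ⟨h1, h2, h3, h4, h5, h6⟩ := hball z hz
    exact h4.mul (h1.const_mul _).cexp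
  have hφ0 : Set.EqOn (fderiv ℂ φ) 0 (Metric.ball (0 : ℂ × ℂ) δ) := by
    intro z hz
    obtain ⟨h1, h2, h3, h4, h5, h6⟩ := hball z hz
    have hne : H z.1 z.2 ≠ 0 := by rw [← h3.self_of_nhds]; exact Complex.exp_ne_zero _
    have hHd : fderiv ℂ (fun z : ℂ × ℂ => H z.1 z.2) z = Complex.exp (l z) • fderiv ℂ l z := by
      have : HasFDerivAt (fun z => Complex.exp (l z)) (Complex.exp (l z) • fderiv ℂ l z) z := h1.hasFDerivAt.cexp
      exact (this.congr_of_eventuallyEq (h3.mono fun w hw => hw.symm)).fderiv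
    have hprod : fderiv ℂ φ z = (g z.1 z.2) • (Complex.exp (β * l z) • ((β : ℂ) • fderiv ℂ l z)) + Complex.exp (β * l z) • fderiv ℂ (fun z : ℂ × ℂ => g z.1 z.2) z :=
      (h4.hasFDerivAt.mul (h1.hasFDerivAt.const_mul (β : ℂ)).cexp).fderiv
    have a1 : deriv (fun x => g x z.2) z.1 = fderiv ℂ (fun z : ℂ × ℂ => g z.1 z.2) z (1, 0) := (partial1 _ z h4).deriv
    have a2 : deriv (fun y => g z.1 y) z.2 = fderiv ℂ (fun z : ℂ × ℂ => g z.1 z.2) z (0, 1) := (partial2 _ z h4).deriv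
    have a3 : deriv (fun x => H x z.2) z.1 = fderiv ℂ (fun z : ℂ × ℂ => H z.1 z.2) z (1, 0) := (partial1 _ z h2).deriv
    have a4 : deriv (fun y => H z.1 y) z.2 = fderiv ℂ (fun z : ℂ × ℂ => H z.1 z.2) z (0, 1) := (partial2 _ z h2).deriv
    rw [a1, a3, hHd, h3.self_of_nhds] at h5
    rw [a2, a4, hHd, h3.self_of_nhds] at h6
    have b1 : fderiv ℂ φ z (1, 0) = 0 := by
      rw [hprod]
      simp only [add_apply, smul_apply, smul_eq_mul] at h5 ⊢
      refine mul_left_cancel₀ hne ?_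
      linear_combination Complex.exp (β * l z) * h5
    have b2 : fderiv ℂ φ z (0, 1) = 0 := by
      rw [hprod]
      simp only [add_apply, smul_apply, smul_eq_mul] at h6 ⊢
      refine mul_left_cancel₀ hne ?_
      linear_combination Complex.exp (β * l z) * h6
    refine ContinuousLinearMap.ext fun w => ?_
    have : w = w.1 • ((1, 0) : ℂ × ℂ) + w.2 • ((0, 1) : ℂ × ℂ) := by ext <;> simp
    rw [this, map_add, map_smul, map_smul, b1, b2]
    simp
  filter_upwards [Metric.ball_mem_nhds (0 : ℂ × ℂ) hδ] with z hz
  have hconst := Metric.isOpen_ball.is_const_of_fderiv_eq_zero (convex_ball (0 : ℂ × ℂ) δ).isPreconnected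
    (fun z hz => (hφd z hz).differentiableWithinAt) hφ0 hz (Metric.mem_ball_self hδ)
  have h1 : φ 0 = 1 := by
    simp only [hφ, Prod.fst_zero, Prod.snd_zero]
    rw [hg0, hl0, Real.rpow_def_of_pos hc0]
    push_cast
    rw [← Complex.exp_add]
    simp only [mul_neg]
    rw [mul_comm, neg_add_cancel, Complex.exp_zero]
  rw [h1] at hconst
  simp only [hφ] at hconst
  rw [neg_mul, Complex.exp_neg]
  exact eq_inv_of_mul_eq_one_left hconst

noncomputable def cj (z : ℂ × ℂ) : ℂ × ℂ := (starRingEnd ℂ z.1, starRingEnd ℂ z.2)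

theorem cj_cont : Continuous cj := by unfold cj; fun_prop

theorem cj_analytic (G : ℂ × ℂ → ℂ) (z : ℂ × ℂ) (hG : AnalyticAt ℂ G (cj z)) :
    AnalyticAt ℝ (fun z => starRingEnd ℂ (G (cj z))) z := by
  have h1 : AnalyticAt ℝ G (cj z) := hG.restrictScalars
  have h2 : AnalyticAt ℝ cj z := by
    have a : AnalyticAt ℝ (fun z : ℂ × ℂ => starRingEnd ℂ z.1) z :=
      ((Complex.conjCLE : ℂ →L[ℝ] ℂ).comp (ContinuousLinearMap.fst ℝ ℂ ℂ)).analyticAt z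
    have b : AnalyticAt ℝ (fun z : ℂ × ℂ => starRingEnd ℂ z.2) z :=
      ((Complex.conjCLE : ℂ →L[ℝ] ℂ).comp (ContinuousLinearMap.snd ℝ ℂ ℂ)).analyticAt z
    exact a.prod b
  have h3 : AnalyticAt ℝ (fun z => G (cj z)) z := h1.comp h2
  have h4 : AnalyticAt ℝ (fun w : ℂ => starRingEnd ℂ w) (G (cj z)) :=
    (Complex.conjCLE : ℂ →L[ℝ] ℂ).analyticAt _
  exact AnalyticAt.fun_comp h4 h3

theorem real_symm (G : ℂ × ℂ → ℂ) (p q : ℝ) (hp : 0 < p) (hq : 0 < q)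
    (hG : AnalyticOnNhd ℂ G {z : ℂ × ℂ | ‖z.1‖ ≤ p ∧ ‖z.2‖ ≤ q})
    (hnear : ∀ᶠ z in 𝓝 (0 : ℂ × ℂ), starRingEnd ℂ (G (cj z)) = G z) :
    (∀ z : ℂ × ℂ, ‖z.1‖ ≤ p → ‖z.2‖ ≤ q → starRingEnd ℂ (G (cj z)) = G z) ∧
    ∀ᶠ z in 𝓝 (((p : ℂ), (q : ℂ)) : ℂ × ℂ), starRingEnd ℂ (G (cj z)) = G z := by
  set K := {z : ℂ × ℂ | ‖z.1‖ ≤ p ∧ ‖z.2‖ ≤ q} with hK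
  have hPK : (((p : ℂ), (q : ℂ)) : ℂ × ℂ) ∈ K := by
    simp [hK, abs_of_pos hp, abs_of_pos hq]
  have hev := (hG _ hPK).eventually_analyticAt
  obtain ⟨δ, hδ, hball⟩ := Metric.eventually_nhds_iff_ball.1 hev
  have hU : AnalyticOnNhd ℂ G (K ∪ Metric.ball ((p : ℂ), (q : ℂ)) δ) := by
    rintro z (hz | hz)
    · exact hG z hz
    · exact hball z hz
  have hcj : ∀ z ∈ K ∪ Metric.ball ((p : ℂ), (q : ℂ)) δ, cj z ∈ K ∪ Metric.ball ((p : ℂ), (q : ℂ)) δ := by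
    rintro z (hz | hz)
    · left
      simpa [hK, cj] using hz
    · right
      have e1 : ∀ (w : ℂ) (t : ℝ), dist (starRingEnd ℂ w) (t : ℂ) = dist w t := by
        intro w t
        rw [← Complex.conj_ofReal t, Complex.dist_conj_conj, Complex.conj_ofReal]
      rw [Metric.mem_ball, Prod.dist_eq] at hz ⊢
      simpa [cj, e1] using hz
  have hKc : Convex ℝ K := by
    have : K = Metric.closedBall (0:ℂ) p ×ˢ Metric.closedBall (0:ℂ) q := by
      ext z; simp [hK]
    rw [this]
    exact (convex_closedBall _ _).prod (convex_closedBall _ _)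
  have hpre : IsPreconnected (K ∪ Metric.ball ((p : ℂ), (q : ℂ)) δ) :=
    IsPreconnected.union _ hPK (Metric.mem_ball_self hδ) hKc.isPreconnected (convex_ball _ _).isPreconnected
  have h0 : (0 : ℂ × ℂ) ∈ K ∪ Metric.ball ((p : ℂ), (q : ℂ)) δ := by
    left; simp [hK, hp.le, hq.le]
  have key := AnalyticOnNhd.eqOn_of_preconnected_of_eventuallyEq (𝕜 := ℝ)
    (f := fun z => starRingEnd ℂ (G (cj z))) (g := G) (fun z hz => cj_analytic G z (hU _ (hcj z hz)))
    (fun z hz => (hU z hz).restrictScalars) hpre h0 hnear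
  refine ⟨fun z h1 h2 => key (Or.inl ⟨h1, h2⟩), ?_⟩
  filter_upwards [Metric.ball_mem_nhds _ hδ] with z hz
  exact key (Or.inr hz)

/-- positivity on the real box -/
theorem real_pos (G : ℂ × ℂ → ℂ) (p q : ℝ) (hp : 0 < p) (hq : 0 < q)
    (hG : AnalyticOnNhd ℂ G {z : ℂ × ℂ | ‖z.1‖ ≤ p ∧ ‖z.2‖ ≤ q})
    (hs : ∀ z : ℂ × ℂ, ‖z.1‖ ≤ p → ‖z.2‖ ≤ q → starRingEnd ℂ (G (cj z)) = G z)
    (c0 : ℝ) (hc0 : 0 < c0) (hG0 : G 0 = c0)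
    (hz : ∀ z : ℂ × ℂ, ‖z.1‖ ≤ p → ‖z.2‖ ≤ q → G z = 0 → z.1 = p ∧ z.2 = q)
    (x y : ℝ) (hx : 0 ≤ x) (hy : 0 ≤ y) (hxp : x ≤ p) (hyq : y ≤ q) (hne : x ≠ p ∨ y ≠ q) :
    ∃ v : ℝ, 0 < v ∧ G (x, y) = v := by
  have hin : ∀ t ∈ Set.Icc (0:ℝ) 1, ‖((t * x : ℝ) : ℂ)‖ ≤ p ∧ ‖((t * y : ℝ) : ℂ)‖ ≤ q := by
    intro t ht
    rw [Complex.norm_real, Complex.norm_real, Real.norm_of_nonneg (mul_nonneg ht.1 hx), Real.norm_of_nonneg (mul_nonneg ht.1 hy)]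
    exact ⟨by nlinarith [ht.2, ht.1], by nlinarith [ht.2, ht.1]⟩
  set f : ℝ → ℝ := fun t => (G (((t * x : ℝ) : ℂ), ((t * y : ℝ) : ℂ))).re with hf
  have hreal : ∀ t ∈ Set.Icc (0:ℝ) 1, G (((t * x : ℝ) : ℂ), ((t * y : ℝ) : ℂ)) = f t := by
    intro t ht
    have := hs (((t * x : ℝ) : ℂ), ((t * y : ℝ) : ℂ)) (hin t ht).1 (hin t ht).2
    have e : cj (((t * x : ℝ) : ℂ), ((t * y : ℝ) : ℂ)) = (((t * x : ℝ) : ℂ), ((t * y : ℝ) : ℂ)) := by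
      simp [cj]
    rw [e] at this
    exact (Complex.conj_eq_iff_re.1 this).symm
  have hcont : ContinuousOn f (Set.Icc 0 1) := by
    refine Complex.continuous_re.comp_continuousOn ?_
    refine hG.continuousOn.comp (t := {z : ℂ × ℂ | ‖z.1‖ ≤ p ∧ ‖z.2‖ ≤ q}) (by fun_prop) ?_
    intro t ht
    exact hin t ht
  have h0 : f 0 = c0 := by
    have : G (((0 * x : ℝ) : ℂ), ((0 * y : ℝ) : ℂ)) = c0 := by
      rw [← hG0]; congr 1; ext <;> simp
    simp only [hf, this, Complex.ofReal_re]
  have h1 : 0 < f 1 := by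
    by_contra hcon
    push Not at hcon
    have := intermediate_value_Icc' zero_le_one hcont
    obtain ⟨t, ht, hft⟩ := this ⟨hcon, by rw [h0]; exact hc0.le⟩
    have h2 := hz _ (hin t ht).1 (hin t ht).2 (by rw [hreal t ht, hft]; simp)
    have h3 : t * x = p := Complex.ofReal_injective h2.1
    have h4 : t * y = q := Complex.ofReal_injective h2.2
    have ht1 : t = 1 := by
      by_contra hne1
      have : t < 1 := lt_of_le_of_ne ht.2 hne1
      nlinarith [ht.1]
    subst ht1
    rcases hne with h | h
    · exact h (by linarith)
    · exact h (by linarith)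
  refine ⟨f 1, h1, ?_⟩
  rw [← hreal 1 (by simp)]
  simp

theorem near_symm (H : ℂ → ℂ → ℂ) (c : ℕ → ℕ → ℝ) (ε : ℝ) (hε : 0 < ε)
    (hcoef : ∀ x y : ℂ, ‖x‖ < ε → ‖y‖ < ε →
      H x y = ∑' m : ℕ, ∑' n : ℕ, ((c m n : ℂ)) * x ^ m * y ^ n) :
    (∀ᶠ z in 𝓝 (0 : ℂ × ℂ), starRingEnd ℂ (H (cj z).1 (cj z).2) = H z.1 z.2) ∧ H 0 0 = c 0 0 := by
  constructor
  · filter_upwards [Metric.ball_mem_nhds (0 : ℂ × ℂ) hε] with z hz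
    rw [mem_ball_zero_iff, Prod.norm_def, max_lt_iff] at hz
    rw [hcoef z.1 z.2 hz.1 hz.2, hcoef (cj z).1 (cj z).2 (by simpa [cj] using hz.1) (by simpa [cj] using hz.2)]
    rw [Complex.conj_tsum]
    refine tsum_congr fun m => ?_
    rw [Complex.conj_tsum]
    refine tsum_congr fun n => ?_
    simp [cj]
  · rw [hcoef 0 0 (by simpa) (by simpa), tsum_eq_single 0, tsum_eq_single 0]
    · simp
    · intro n hn; simp [hn]
    · intro m hm; simp [hm]

theorem taylor2 (K : ℂ → ℂ) (hK : AnalyticAt ℂ K 0) (h0 : K 0 = 0) (h1 : deriv K 0 = 0) :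
    ∀ ε > 0, ∀ᶠ t in 𝓝 (0 : ℂ), ‖K t - deriv (deriv K) 0 / 2 * t ^ 2‖ ≤ ε * ‖t‖ ^ 2 := by
  intro ε hε
  have hd : HasDerivAt (deriv K) (deriv (deriv K) 0) 0 := hK.deriv.differentiableAt.hasDerivAt
  have ho := hasDerivAt_iff_isLittleO.1 hd
  have hev := ho.def hε
  have hall := hev.and hK.eventually_analyticAt
  obtain ⟨δ, hδ, hball⟩ := Metric.eventually_nhds_iff_ball.1 hall
  filter_upwards [Metric.ball_mem_nhds (0 : ℂ) hδ] with t ht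
  set D := deriv (deriv K) 0 with hD
  have hsub : ∀ x ∈ Metric.closedBall (0:ℂ) ‖t‖, x ∈ Metric.ball (0:ℂ) δ := by
    intro x hx
    rw [mem_closedBall_zero_iff] at hx
    rw [mem_ball_zero_iff] at ht ⊢
    linarith
  have := Convex.norm_image_sub_le_of_norm_hasDerivWithin_le (s := Metric.closedBall (0:ℂ) ‖t‖)
    (f := fun t => K t - D / 2 * t ^ 2) (f' := fun t => deriv K t - D * t) (C := ε * ‖t‖) (x := 0) (y := t)
    (fun x hx => by
      have a := (hball x (hsub x hx)).2.differentiableAt.hasDerivAt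
      have b := a.sub ((hasDerivAt_pow 2 x).const_mul (D / 2))
      refine (b.congr_deriv ?_).hasDerivWithinAt
      simp; ring)
    (fun x hx => by
      have a := (hball x (hsub x hx)).1
      rw [h1] at a
      simp only [sub_zero, smul_eq_mul] at a
      rw [mul_comm D]
      refine a.trans ?_
      rw [mem_closedBall_zero_iff] at hx
      gcongr)
    (convex_closedBall _ _) (by simp) (by simp)
  simp only [h0, sub_zero] at this
  calc _ ≤ _ := by simpa using this
    _ = _ := by ring

theorem happ_of (lam : ℝ) (A D : ℂ) (h : ℂ × ℂ → ℂ) (hh : AnalyticAt ℂ h 0) (h0 : h 0 = 0)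
    (hd1 : fderiv ℂ h 0 (1, 0) = A) (hd2 : fderiv ℂ h 0 (0, 1) = A / lam)
    (hD : deriv (deriv (fun t : ℂ => h (-(t / lam), t))) 0 = D) :
    ∀ ε > 0, ∀ᶠ z in 𝓝 (0 : ℂ × ℂ),
      ‖h z - (A * (z.1 + z.2 / lam) + D / 2 * z.2 ^ 2)‖ ≤ ε * (‖z.1 + z.2 / lam‖ + ‖z.2‖ ^ 2) := by
  intro ε hε
  set γ : ℂ → ℂ × ℂ := fun t => (-(t / lam), t) with hγ
  have hγd : ∀ t, HasDerivAt γ (-(1 / lam), 1) t := by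
    intro t
    exact (((hasDerivAt_id t).div_const (lam:ℂ)).neg).prodMk (hasDerivAt_id t)
  have hγ0 : γ 0 = 0 := by simp [hγ]
  have hγan : AnalyticAt ℂ γ 0 := by
    have : DifferentiableOn ℂ γ Set.univ := fun t _ => (hγd t).differentiableAt.differentiableWithinAt
    exact this.analyticAt Filter.univ_mem
  have hKan : AnalyticAt ℂ (fun t => h (γ t)) 0 := AnalyticAt.fun_comp (by rw [hγ0]; exact hh) hγan
  have hK0 : h (γ 0) = 0 := by rw [hγ0, h0]
  have hlin : ∀ v : ℂ × ℂ, fderiv ℂ h 0 v = A * (v.1 + v.2 / lam) := by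
    intro v
    have : v = v.1 • ((1, 0) : ℂ × ℂ) + v.2 • ((0, 1) : ℂ × ℂ) := by ext <;> simp
    rw [this, map_add, map_smul, map_smul, hd1, hd2]
    simp; ring
  have hK1 : deriv (fun t => h (γ t)) 0 = 0 := by
    have a : HasFDerivAt h (fderiv ℂ h 0) (γ 0) := by rw [hγ0]; exact hh.differentiableAt.hasFDerivAt
    have := (a.comp_hasDerivAt (0:ℂ) (hγd 0)).deriv
    have e : (h ∘ γ) = fun t => h (γ t) := rfl
    rw [e] at this
    rw [this, hlin]; simp
  have hT := taylor2 _ hKan hK0 hK1 ε hε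
  have hT2 : ∀ᶠ z in 𝓝 (0 : ℂ × ℂ), ‖h (γ z.2) - D / 2 * z.2 ^ 2‖ ≤ ε * ‖z.2‖ ^ 2 := by
    have : Tendsto (fun z : ℂ × ℂ => z.2) (𝓝 0) (𝓝 0) := continuous_snd.tendsto' _ _ rfl
    have := this.eventually hT
    rw [← hD]
    exact this
  have hs : HasStrictFDerivAt h (fderiv ℂ h 0) 0 := hh.hasStrictFDerivAt
  have hs2 := (hasStrictFDerivAt_iff_isLittleO.1 hs).def hε
  have htend : Tendsto (fun z : ℂ × ℂ => (z, γ z.2)) (𝓝 0) (𝓝 (0, 0)) := by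
    refine Continuous.tendsto' ?_ _ _ ?_
    · simp only [hγ]; fun_prop
    · simp [hγ]
  filter_upwards [htend.eventually hs2, hT2] with z hz1 hz2
  have e1 : z - γ z.2 = (z.1 + z.2 / lam, 0) := by ext <;> simp [hγ]
  simp only [e1, hlin] at hz1
  have e2 : ‖((z.1 + z.2 / lam, 0) : ℂ × ℂ)‖ = ‖z.1 + z.2 / lam‖ := by simp [Prod.norm_def]
  rw [e2] at hz1
  calc ‖h z - (A * (z.1 + z.2 / lam) + D / 2 * z.2 ^ 2)‖
      = ‖(h z - h (γ z.2) - A * (z.1 + z.2 / lam + 0 / lam)) + (h (γ z.2) - D / 2 * z.2 ^ 2)‖ := by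
        congr 1; ring
    _ ≤ _ := norm_add_le _ _
    _ ≤ _ := by rw [mul_add ε]; exact add_le_add hz1 hz2

theorem K_second (G : ℂ × ℂ → ℂ) (p q a : ℂ) (hG : AnalyticAt ℂ G (p, q)) 
    (Hx Hy Hxx Hxy Hyy : ℂ)
    (hHx : Hx = deriv (fun x => G (x, q)) p)
    (hHy : Hy = deriv (fun y => G (p, y)) q)
    (hHxx : Hxx = iteratedDeriv 2 (fun x => G (x, q)) p)
    (hHxy : Hxy = deriv (fun y => deriv (fun x => G (x, y)) p) q)
    (hHyy : Hyy = iteratedDeriv 2 (fun y => G (p, y)) q) :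
    deriv (deriv (fun t : ℂ => G (p * Complex.exp (-(-(t * a))), q * Complex.exp (-t)))) 0 =
      a ^ 2 * p * Hx + q * Hy + a ^ 2 * p ^ 2 * Hxx - 2 * a * p * q * Hxy + q ^ 2 * Hyy := by
  set P : ℂ × ℂ := (p, q) with hP
  have hev := hG.eventually_analyticAt
  have hG' : AnalyticAt ℂ (fderiv ℂ G) P := hG.fderiv
  set D2 := fderiv ℂ (fderiv ℂ G) P with hD2
  have hD2' : HasFDerivAt (fderiv ℂ G) D2 P := hG'.differentiableAt.hasFDerivAt
  have hv : ∀ v : ℂ × ℂ, HasFDerivAt (fun z => fderiv ℂ G z v) (D2.flip v) P := by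
    intro v
    have := hD2'.clm_apply (hasFDerivAt_const v P)
    refine this.congr_fderiv ?_
    ext <;> simp
  have hsymm : ∀ v w, D2 v w = D2 w v := by
    have : IsSymmSndFDerivAt ℂ G P := (hG.contDiffAt (n := ⊤)).isSymmSndFDerivAt (by simp [minSmoothness])
    intro v w; exact this v w
  have cx : Tendsto (fun x : ℂ => ((x, q) : ℂ × ℂ)) (𝓝 p) (𝓝 P) := by
    refine Continuous.tendsto' (by fun_prop) _ _ rfl
  have cy : Tendsto (fun y : ℂ => ((p, y) : ℂ × ℂ)) (𝓝 q) (𝓝 P) := by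
    refine Continuous.tendsto' (by fun_prop) _ _ rfl
  have ex : Hx = fderiv ℂ G P (1, 0) := by rw [hHx]; exact (partial1 G P hG.differentiableAt).deriv
  have ey : Hy = fderiv ℂ G P (0, 1) := by rw [hHy]; exact (partial2 G P hG.differentiableAt).deriv
  have exx : Hxx = D2 (1, 0) (1, 0) := by
    rw [hHxx, iteratedDeriv_succ, iteratedDeriv_one]
    have : deriv (fun x => G (x, q)) =ᶠ[𝓝 p] fun x => fderiv ℂ G (x, q) (1, 0) := by
      filter_upwards [cx.eventually hev] with x hx
      exact (partial1 G (x, q) hx.differentiableAt).deriv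
    rw [this.deriv_eq]
    have := (partial1 _ P (hv (1, 0)).differentiableAt).deriv
    rw [(hv (1, 0)).fderiv] at this
    exact this
  have eyy : Hyy = D2 (0, 1) (0, 1) := by
    rw [hHyy, iteratedDeriv_succ, iteratedDeriv_one]
    have : deriv (fun y => G (p, y)) =ᶠ[𝓝 q] fun y => fderiv ℂ G (p, y) (0, 1) := by
      filter_upwards [cy.eventually hev] with x hx
      exact (partial2 G (p, x) hx.differentiableAt).deriv
    rw [this.deriv_eq]
    have := (partial2 _ P (hv (0, 1)).differentiableAt).deriv
    rw [(hv (0, 1)).fderiv] at this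
    exact this
  have exy : Hxy = D2 (0, 1) (1, 0) := by
    rw [hHxy]
    have : (fun y => deriv (fun x => G (x, y)) p) =ᶠ[𝓝 q] fun y => fderiv ℂ G (p, y) (1, 0) := by
      filter_upwards [cy.eventually hev] with x hx
      exact (partial1 G (p, x) hx.differentiableAt).deriv
    rw [this.deriv_eq]
    have := (partial2 _ P (hv (1, 0)).differentiableAt).deriv
    rw [(hv (1, 0)).fderiv] at this
    exact this
  set γ : ℂ → ℂ × ℂ := fun t => (p * Complex.exp (-(-(t * a))), q * Complex.exp (-t)) with hγ
  set γ' : ℂ → ℂ × ℂ := fun t => (a * p * Complex.exp (-(-(t * a))), -q * Complex.exp (-t)) with hγ'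
  have d1 : ∀ t : ℂ, HasDerivAt (fun t : ℂ => Complex.exp (-(-(t * a)))) (a * Complex.exp (-(-(t * a)))) t := by
    intro t
    refine (((hasDerivAt_id t).mul_const a).neg.neg.cexp).congr_deriv ?_
    simp; ring
  have d2 : ∀ t : ℂ, HasDerivAt (fun t : ℂ => Complex.exp (-t)) (-Complex.exp (-t)) t := by
    intro t
    refine ((hasDerivAt_id t).neg.cexp).congr_deriv ?_
    simp
  have hγd : ∀ t, HasDerivAt γ (γ' t) t := by
    intro t
    refine HasDerivAt.congr_deriv (((d1 t).const_mul p).prodMk ((d2 t).const_mul q)) ?_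
    simp only [hγ']; ext <;> simp; ring
  have hγ'd : HasDerivAt γ' (a ^ 2 * p, q) 0 := by
    refine HasDerivAt.congr_deriv (((d1 0).const_mul (a * p)).prodMk ((d2 0).const_mul (-q))) ?_
    ext <;> simp; ring
  have hγ0 : γ 0 = P := by simp [hγ, hP]
  have hγ'0 : γ' 0 = (a * p, -q) := by simp [hγ']
  have cγ : Tendsto γ (𝓝 0) (𝓝 P) := by
    rw [← hγ0]; exact (hγd 0).continuousAt
  have hK : deriv (fun t => G (γ t)) =ᶠ[𝓝 0] fun t => fderiv ℂ G (γ t) (γ' t) := by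
    filter_upwards [cγ.eventually hev] with t ht
    exact (ht.differentiableAt.hasFDerivAt.comp_hasDerivAt t (hγd t)).deriv
  rw [hK.deriv_eq]
  have hc : HasDerivAt (fun t => fderiv ℂ G (γ t)) (D2 (γ' 0)) 0 := by
    have : HasFDerivAt (fderiv ℂ G) D2 (γ 0) := by rw [hγ0]; exact hD2'
    exact this.comp_hasDerivAt (0:ℂ) (hγd 0)
  have hfin := (hc.clm_apply hγ'd).deriv
  rw [hfin, hγ0, hγ'0]
  have lin : ∀ (T : ℂ × ℂ →L[ℂ] ℂ) (u v : ℂ), T (u, v) = u * T (1, 0) + v * T (0, 1) := by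
    intro T u v
    have : ((u, v) : ℂ × ℂ) = u • ((1, 0) : ℂ × ℂ) + v • ((0, 1) : ℂ × ℂ) := by ext <;> simp
    rw [this, map_add, map_smul, map_smul]; simp
  have lin2 : ∀ (u v : ℂ), D2 (u, v) = u • D2 (1, 0) + v • D2 (0, 1) := by
    intro u v
    have : ((u, v) : ℂ × ℂ) = u • ((1, 0) : ℂ × ℂ) + v • ((0, 1) : ℂ × ℂ) := by ext <;> simp
    rw [this, map_add, map_smul, map_smul]
  rw [lin (fderiv ℂ G P), ← ex, ← ey, lin2, add_apply, smul_apply, smul_apply, lin (D2 (1, 0)), lin (D2 (0, 1)), ← exx, ← exy, ← eyy, hsymm (1, 0) (0, 1), ← exy]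
  simp only [smul_eq_mul]
  ring

theorem closed_nonneg : IsClosed {w : ℂ | w.im = 0 ∧ 0 ≤ w.re} :=
  (isClosed_eq Complex.continuous_im continuous_const).inter
    (isClosed_le continuous_const Complex.continuous_re)

theorem A_pos (A : ℂ) (h : ℂ × ℂ → ℂ) (hh : AnalyticAt ℂ h 0) (h0 : h 0 = 0)
    (hd1 : fderiv ℂ h 0 (1, 0) = A) (hA : A ≠ 0)
    (hpos : ∀ s : ℝ, 0 < s → ∃ v : ℝ, 0 < v ∧ h (s, 0) = v) : ∃ A' : ℝ, 0 < A' ∧ A = A' := by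
  have h1 : HasDerivAt (fun x : ℂ => h (x, 0)) A 0 := by
    rw [← hd1]; exact partial1 h 0 hh.differentiableAt
  have h2 : HasDerivAt (fun x : ℝ => h (x, 0)) A 0 := by
    have : HasDerivAt (fun x : ℂ => h (x, 0)) A ((0:ℝ):ℂ) := by simpa using h1
    exact this.comp_ofReal
  have h3 := h2.tendsto_slope_zero_right
  have hmem : A ∈ {w : ℂ | w.im = 0 ∧ 0 ≤ w.re} := by
    refine closed_nonneg.mem_of_tendsto h3 ?_
    filter_upwards [self_mem_nhdsWithin] with t ht
    obtain ⟨v, hv, e⟩ := hpos t ht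
    have e0 : h (((0:ℝ):ℂ), 0) = 0 := by rw [Complex.ofReal_zero]; exact h0
    rw [zero_add, e, e0, sub_zero, Complex.real_smul, ← Complex.ofReal_mul]
    refine ⟨Complex.ofReal_im _, ?_⟩
    rw [Complex.ofReal_re]
    have : (0:ℝ) < t := ht
    positivity
  have e : A = (A.re : ℂ) := by apply Complex.ext <;> simp [hmem.1]
  refine ⟨A.re, lt_of_le_of_ne hmem.2 ?_, e⟩
  intro hc
  apply hA; rw [e, ← hc]; simp

theorem D_real (K : ℂ → ℂ) (hK : AnalyticAt ℂ K 0) (h0 : K 0 = 0) (h1 : deriv K 0 = 0)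
    (hs : ∀ᶠ t : ℝ in 𝓝 0, (K t).im = 0) : (deriv (deriv K) 0).im = 0 := by
  have hT := taylor2 K hK h0 h1
  by_contra hne
  set D := deriv (deriv K) 0
  have hpos : 0 < |D.im| / 4 := by positivity
  have ev := (Complex.continuous_ofReal.tendsto' (0:ℝ) (0:ℂ) (by simp)).eventually (hT _ hpos)
  have := ((ev.and hs).filter_mono nhdsWithin_le_nhds).and (self_mem_nhdsWithin (a := (0:ℝ)) (s := Set.Ioi 0))
  obtain ⟨t, ⟨ht1, ht2⟩, ht3⟩ := this.exists
  have ht : 0 < t := ht3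
  have a : |(K t - D / 2 * (t:ℂ) ^ 2).im| ≤ |D.im| / 4 * ‖(t:ℂ)‖ ^ 2 := (Complex.abs_im_le_norm _).trans ht1
  have e : (K t - D / 2 * (t:ℂ) ^ 2).im = - (D.im / 2 * t ^ 2) := by
    rw [Complex.sub_im, ht2, ← Complex.ofReal_pow, Complex.im_mul_ofReal]
    simp
  rw [e, abs_neg, abs_mul, abs_div, abs_of_pos (pow_pos ht 2), Complex.norm_real, Real.norm_of_nonneg ht.le] at a
  have : (0:ℝ) < t ^ 2 := by positivity
  simp at a
  nlinarith

theorem D_neg (lam A D : ℝ) (hA : 0 < A) (h : ℂ × ℂ → ℂ) (hh : AnalyticAt ℂ h 0)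
    (happ : ∀ ε > 0, ∀ᶠ z in 𝓝 (0 : ℂ × ℂ),
      ‖h z - (A * (z.1 + z.2 / lam) + D / 2 * z.2 ^ 2)‖ ≤ ε * (‖z.1 + z.2 / lam‖ + ‖z.2‖ ^ 2))
    (hD : D ≠ 0)
    (hz : ∀ᶠ z in 𝓝 (0 : ℂ × ℂ), 0 < z.1.re → 0 ≤ z.2.re → h z ≠ 0) : D < 0 := by
  by_contra hcon
  have hD : 0 < D := lt_of_le_of_ne (not_lt.1 hcon) (Ne.symm hD)
  set E := 3 * D / (4 * A) + 1 with hE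
  have hEp : 0 < E := by positivity
  set ε := D / (32 * E) with hε
  have hεp : 0 < ε := by positivity
  have hall := (happ ε hεp).and (hz.and hh.eventually_analyticAt)
  obtain ⟨δ, hδ, hball⟩ := Metric.eventually_nhds_iff_ball.1 hall
  have htend : Tendsto (fun θ : ℝ => 3 * D / (4 * A) * θ ^ 2 + |θ| * |lam|⁻¹ + |θ|) (𝓝[>] 0) (𝓝 0) := by
    refine Tendsto.mono_left ?_ nhdsWithin_le_nhds
    exact Continuous.tendsto' (by fun_prop) _ _ (by simp)
  have := (htend.eventually (gt_mem_nhds hδ)).and (self_mem_nhdsWithin (a := (0:ℝ)) (s := Set.Ioi 0))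
  obtain ⟨θ, hθ1, hθ2⟩ := this.exists
  have hθ : 0 < θ := hθ2
  set w0 : ℝ := D * θ ^ 2 / (2 * A) with hw0
  have hw0p : 0 < w0 := by positivity
  set τ : ℂ := θ * Complex.I with hτ
  have hτn : ‖τ‖ = θ := by simp [hτ, abs_of_pos hθ]
  have hτ2 : τ ^ 2 = -(θ ^ 2 : ℝ) := by simp [hτ, mul_pow]
  set Z : ℂ → ℂ × ℂ := fun w => (w - τ / lam, τ) with hZ
  have hwn : ∀ w ∈ Metric.closedBall (w0 : ℂ) (w0 / 2), ‖w‖ ≤ 3 / 2 * w0 ∧ 0 < w.re := by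
    intro w hw
    rw [mem_closedBall_iff_norm] at hw
    constructor
    · calc ‖w‖ = ‖(w - w0) + w0‖ := by ring_nf
        _ ≤ _ := norm_add_le _ _
        _ ≤ _ := by rw [Complex.norm_real, Real.norm_of_nonneg hw0p.le]; linarith
    · have := (Complex.abs_re_le_norm _).trans hw
      rw [Complex.sub_re, Complex.ofReal_re, abs_le] at this
      linarith
  have hZb : ∀ w ∈ Metric.closedBall (w0 : ℂ) (w0 / 2), Z w ∈ Metric.ball (0 : ℂ × ℂ) δ := by
    intro w hw
    rw [mem_ball_zero_iff]
    refine lt_of_le_of_lt ?_ hθ1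
    rw [abs_of_pos hθ, Prod.norm_def]
    refine max_le ?_ ?_
    · simp only [hZ]
      refine (norm_sub_le _ _).trans ?_
      rw [norm_div, hτn, Complex.norm_real, Real.norm_eq_abs]
      have := (hwn w hw).1
      have e : 3 / 2 * w0 = 3 * D / (4 * A) * θ ^ 2 := by rw [hw0]; field_simp; norm_num
      rw [e] at this
      rw [div_eq_mul_inv]
      linarith
    · simp only [hZ, hτn]
      have : 0 ≤ 3 * D / (4 * A) * θ ^ 2 + θ * |lam|⁻¹ := by positivity
      linarith
  set f : ℂ → ℂ := fun w => h (Z w) with hf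
  have herr : ∀ w ∈ Metric.closedBall (w0 : ℂ) (w0 / 2), ‖f w - A * (w - w0)‖ ≤ D * θ ^ 2 / 32 := by
    intro w hw
    have := (hball _ (hZb w hw)).1
    simp only [hZ, sub_add_cancel, hτ2, hτn] at this
    have e : (A : ℂ) * w + D / 2 * -(θ ^ 2 : ℝ) = A * (w - w0) := by
      rw [hw0]; push_cast; have : (A:ℂ) ≠ 0 := by exact_mod_cast hA.ne'
      field_simp; ring
    rw [e] at this
    refine this.trans ?_
    calc ε * (‖w‖ + θ ^ 2) ≤ ε * (3 / 2 * w0 + θ ^ 2) := by gcongr; exact (hwn w hw).1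
      _ = D * θ ^ 2 / 32 := by
        rw [hε, hw0]
        have : 3 / 2 * (D * θ ^ 2 / (2 * A)) + θ ^ 2 = E * θ ^ 2 := by rw [hE]; field_simp; ring
        rw [this]; field_simp
  have hclos : closure (Metric.ball (w0:ℂ) (w0 / 2)) = Metric.closedBall (w0:ℂ) (w0 / 2) :=
    closure_ball _ (by positivity)
  have hne : ∀ w ∈ Metric.closedBall (w0 : ℂ) (w0 / 2), f w ≠ 0 := by
    intro w hw
    have := (hball _ (hZb w hw)).2.1
    refine this ?_ ?_
    · simp [hZ, hτ, Complex.div_re]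
      exact (hwn w hw).2
    · simp [hZ, hτ]
  have hfd : DifferentiableOn ℂ f (Metric.closedBall (w0 : ℂ) (w0 / 2)) := by
    intro w hw
    have := (hball _ (hZb w hw)).2.2.differentiableAt
    refine (DifferentiableAt.comp w this ?_).differentiableWithinAt
    simp only [hZ]; fun_prop
  have hdc : DiffContOnCl ℂ f (Metric.ball (w0 : ℂ) (w0 / 2)) := by
    apply DifferentiableOn.diffContOnCl; rw [hclos]; exact hfd
  have hinv := hdc.inv (by rw [hclos]; exact hne)
  have hmax := Complex.norm_le_of_forall_mem_frontier_norm_le (U := Metric.ball (w0 : ℂ) (w0 / 2)) Metric.isBounded_ball hinv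
    (C := (D * θ ^ 2 / 8)⁻¹) (fun z hz => ?_) (z := w0) (by rw [hclos]; exact Metric.mem_closedBall_self (by positivity))
  · have h1 := herr w0 (Metric.mem_closedBall_self (by positivity))
    simp only [sub_self, mul_zero, sub_zero] at h1
    have h2 : 0 < ‖f w0‖ := norm_pos_iff.2 (hne w0 (Metric.mem_closedBall_self (by positivity)))
    rw [Pi.inv_apply, norm_inv, inv_le_inv₀ h2 (by positivity)] at hmax
    have : 0 < D * θ ^ 2 := by positivity
    linarith
  · rw [frontier_ball _ (by positivity), mem_sphere_iff_norm] at hz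
    have hzc : z ∈ Metric.closedBall (w0 : ℂ) (w0 / 2) := by rw [mem_closedBall_iff_norm]; exact hz.le
    have h1 := herr z hzc
    have h2 : ‖(A:ℂ) * (z - w0)‖ = D * θ ^ 2 / 4 := by
      rw [norm_mul, hz, Complex.norm_real, Real.norm_of_nonneg hA.le, hw0]; field_simp; norm_num
    have h3 := norm_sub_norm_le ((A:ℂ) * (z - w0)) (f z)
    rw [norm_sub_rev] at h3
    have : 0 < D * θ ^ 2 := by positivity
    rw [Pi.inv_apply, norm_inv]
    apply inv_anti₀ (by positivity)
    linarith

theorem local_low (lam A B : ℝ) (hlam : 0 < lam) (hA : 0 < A) (hB : 0 < B) (h : ℂ × ℂ → ℂ)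
    (happ : ∀ ε > 0, ∀ᶠ z in 𝓝 (0 : ℂ × ℂ),
      ‖h z - (A * (z.1 + z.2 / lam) - A * B / 2 * z.2 ^ 2)‖ ≤ ε * (‖z.1 + z.2 / lam‖ + ‖z.2‖ ^ 2)) :
    ∃ c > 0, ∀ᶠ z in 𝓝 (0 : ℂ × ℂ), 0 ≤ z.1.re → 0 ≤ z.2.re →
      c * (‖z.1 + z.2 / (lam : ℂ)‖ + ‖z.2‖ ^ 2) ≤ ‖h z‖ ∧ (h z ≠ 0 → h z ∈ Complex.slitPlane) := by
  set C0 := 2 + 2 / B with hC0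
  have hC0p : 0 < C0 := by positivity
  refine ⟨A / (2 * C0), by positivity, ?_⟩
  have hsmall : ∀ᶠ z in 𝓝 (0 : ℂ × ℂ), B * lam * |z.2.re| < 1 := by
    have : Tendsto (fun z : ℂ × ℂ => B * lam * |z.2.re|) (𝓝 0) (𝓝 0) :=
      Continuous.tendsto' (by fun_prop) _ _ (by simp)
    exact this.eventually (gt_mem_nhds one_pos)
  filter_upwards [happ (A / (2 * C0)) (by positivity), hsmall] with z hz hs h1 h2
  set w := z.1 + z.2 / lam with hw
  set u := w - B / 2 * z.2 ^ 2 with hu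
  rw [abs_of_nonneg h2] at hs
  have hwre : w.re = z.1.re + z.2.re / lam := by
    rw [hw, Complex.add_re, Complex.div_ofReal_re]
  have hure : u.re = w.re - B / 2 * (z.2.re ^ 2 - z.2.im ^ 2) := by
    have e : ((B : ℂ) / 2 * z.2 ^ 2).re = B / 2 * (z.2.re ^ 2 - z.2.im ^ 2) := by
      have : ((B:ℂ) / 2) = ((B / 2 : ℝ) : ℂ) := by push_cast; rfl
      rw [this, Complex.re_ofReal_mul]; congr 1; rw [pow_two, Complex.mul_re]; ring
    rw [hu, Complex.sub_re, e]
  have hle : z.2.re ≤ lam * w.re := by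
    rw [hwre, mul_add, mul_div_cancel₀ _ hlam.ne']
    have := mul_nonneg hlam.le h1
    linarith
  have hwn : 0 ≤ w.re := by rw [hwre]; positivity
  have hq : B / 2 * z.2.re ^ 2 ≤ w.re / 2 := by
    have a : B * z.2.re * z.2.re ≤ B * z.2.re * (lam * w.re) := by gcongr
    have b : (B * lam * z.2.re) * w.re ≤ 1 * w.re := by gcongr
    nlinarith
  have hnsq : ‖z.2‖ ^ 2 = z.2.re ^ 2 + z.2.im ^ 2 := by
    rw [Complex.sq_norm, Complex.normSq_apply]; ring
  have hure2 : B / 2 * ‖z.2‖ ^ 2 ≤ u.re := by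
    rw [hure, hnsq]; nlinarith
  have hun : u.re ≤ ‖u‖ := Complex.re_le_norm u
  have hure0 : 0 ≤ u.re := le_trans (by positivity) hure2
  have hτu : ‖z.2‖ ^ 2 ≤ 2 / B * ‖u‖ := by
    have : B / 2 * ‖z.2‖ ^ 2 ≤ ‖u‖ := hure2.trans hun
    calc ‖z.2‖ ^ 2 = 2 / B * (B / 2 * ‖z.2‖ ^ 2) := by field_simp
      _ ≤ _ := by gcongr
  have hwu : ‖w‖ ≤ 2 * ‖u‖ := by
    have : w = u + B / 2 * z.2 ^ 2 := by rw [hu]; ring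
    have n : ‖(B:ℂ) / 2 * z.2 ^ 2‖ = B / 2 * ‖z.2‖ ^ 2 := by
      rw [norm_mul, norm_pow, norm_div, Complex.norm_real, Real.norm_of_nonneg hB.le]; simp
    have := norm_add_le u ((B:ℂ) / 2 * z.2 ^ 2)
    rw [n] at this
    rw [‹w = _›]
    linarith
  have hsum : ‖w‖ + ‖z.2‖ ^ 2 ≤ C0 * ‖u‖ := by rw [hC0, add_mul]; linarith
  have herr : ‖h z - A * u‖ ≤ A / 2 * ‖u‖ := by
    have e : (A : ℂ) * u = A * w - A * B / 2 * z.2 ^ 2 := by rw [hu]; ring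
    rw [e]
    refine hz.trans ?_
    calc A / (2 * C0) * (‖w‖ + ‖z.2‖ ^ 2) ≤ A / (2 * C0) * (C0 * ‖u‖) := by gcongr
      _ = _ := by field_simp
  have hAu : ‖(A:ℂ) * u‖ = A * ‖u‖ := by rw [norm_mul, Complex.norm_real, Real.norm_of_nonneg hA.le]
  constructor
  · calc A / (2 * C0) * (‖w‖ + ‖z.2‖ ^ 2) ≤ A / (2 * C0) * (C0 * ‖u‖) := by gcongr
      _ = A / 2 * ‖u‖ := by field_simp
      _ ≤ ‖h z‖ := by
        have := norm_sub_norm_le ((A:ℂ) * u) (h z)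
        rw [norm_sub_rev, hAu] at this
        linarith
  · intro hne
    have hu0 : 0 < ‖u‖ := by
      by_contra hcon
      have : ‖u‖ = 0 := le_antisymm (not_lt.1 hcon) (norm_nonneg _)
      rw [this, mul_zero] at herr
      have h3 : h z - A * u = 0 := norm_le_zero_iff.1 herr
      rw [norm_eq_zero.1 this] at h3
      apply hne; simpa using h3
    rw [Complex.mem_slitPlane_iff]
    by_contra hcon
    push Not at hcon
    have a : ‖(A:ℂ) * u‖ ≤ ‖h z - A * u‖ := by
      rw [← sq_le_sq₀ (norm_nonneg _) (norm_nonneg _), Complex.sq_norm, Complex.sq_norm, Complex.normSq_apply, Complex.normSq_apply]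
      simp only [Complex.sub_re, Complex.sub_im, Complex.re_ofReal_mul, Complex.im_ofReal_mul, hcon.2]
      have := mul_nonneg hA.le hure0
      nlinarith [hcon.1]
    rw [hAu] at a
    have := a.trans herr
    nlinarith

theorem global_low (lam : ℝ) (h : ℂ × ℂ → ℂ) (c0 : ℝ) (hc0 : 0 < c0)
    (hloc : ∀ᶠ z in 𝓝 (0 : ℂ × ℂ), 0 ≤ z.1.re → 0 ≤ z.2.re →
      c0 * (‖z.1 + z.2 / (lam : ℂ)‖ + ‖z.2‖ ^ 2) ≤ ‖h z‖)
    (hcont : ContinuousOn h {z | 0 ≤ z.1.re ∧ 0 ≤ z.2.re})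
    (hne : ∀ z : ℂ × ℂ, 0 ≤ z.1.re → |z.1.im| ≤ Real.pi → 0 ≤ z.2.re → |z.2.im| ≤ Real.pi → h z = 0 → z = 0) :
    ∃ c > 0, ∀ z : ℂ × ℂ, 0 ≤ z.1.re → z.1.re ≤ 1 → |z.1.im| ≤ Real.pi → 0 ≤ z.2.re → z.2.re ≤ 1 →
      |z.2.im| ≤ Real.pi → c * (‖z.1 + z.2 / lam‖ + ‖z.2‖ ^ 2) ≤ ‖h z‖ := by
  obtain ⟨δ, hδ, hball⟩ := Metric.eventually_nhds_iff_ball.1 hloc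
  set R : Set ℂ := Set.Icc 0 1 ×ℂ Set.Icc (-Real.pi) Real.pi with hR
  have hRc : IsCompact R := isCompact_Icc.reProdIm isCompact_Icc
  set S : Set (ℂ × ℂ) := (R ×ˢ R) ∩ (Metric.ball 0 δ)ᶜ with hS
  have hSc : IsCompact S := (hRc.prod hRc).inter_right Metric.isOpen_ball.isClosed_compl
  have hmemR : ∀ w : ℂ, w ∈ R ↔ (0 ≤ w.re ∧ w.re ≤ 1) ∧ |w.im| ≤ Real.pi := by
    intro w; rw [hR, Complex.mem_reProdIm, abs_le]; simp
  have hSQ : S ⊆ {z | 0 ≤ z.1.re ∧ 0 ≤ z.2.re} := by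
    intro z hz
    exact ⟨((hmemR _).1 hz.1.1).1.1, ((hmemR _).1 hz.1.2).1.1⟩
  obtain ⟨m, hm, hmin⟩ := hSc.exists_forall_le' (hcont.mono hSQ).norm (a := 0) (fun z hz => by
    rw [norm_pos_iff]
    intro h0
    have a := (hmemR _).1 hz.1.1
    have b := (hmemR _).1 hz.1.2
    have := hne z a.1.1 a.2 b.1.1 b.2 h0
    apply hz.2; rw [this]; simp [hδ])
  obtain ⟨T, hT⟩ := hSc.exists_bound_of_continuousOn (f := fun z : ℂ × ℂ => ‖z.1 + z.2 / lam‖ + ‖z.2‖ ^ 2) (by fun_prop)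
  refine ⟨min c0 (m / (|T| + 1)), by positivity, ?_⟩
  intro z h1 h2 h3 h4 h5 h6
  by_cases hz : z ∈ Metric.ball (0 : ℂ × ℂ) δ
  · refine le_trans ?_ (hball z hz h1 h4)
    gcongr; exact min_le_left _ _
  · have hzS : z ∈ S := ⟨⟨(hmemR _).2 ⟨⟨h1, h2⟩, h3⟩, (hmemR _).2 ⟨⟨h4, h5⟩, h6⟩⟩, hz⟩
    refine le_trans ?_ (hmin z hzS)
    have a := (le_abs_self _).trans (hT z hzS)
    have a' : ‖z.1 + z.2 / lam‖ + ‖z.2‖ ^ 2 ≤ |T| + 1 := by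
      have := le_abs_self T; linarith
    calc _ ≤ m / (|T| + 1) * (|T| + 1) := by
          gcongr; exact min_le_right _ _
      _ = m := by field_simp

theorem exp_one_const {X : Type*} [TopologicalSpace X] (S : Set X) (hS : IsPreconnected S) (f : X → ℂ)
    (hf : ContinuousOn f S) (he : ∀ x ∈ S, Complex.exp (f x) = 1) (x0 : X) (hx0 : x0 ∈ S) (h0 : f x0 = 0) :
    ∀ x ∈ S, f x = 0 := by
  intro x hx
  obtain ⟨n, hn⟩ := Complex.exp_eq_one_iff.1 (he x hx)
  by_contra hne
  have hn0 : n ≠ 0 := by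
    rintro rfl; apply hne; rw [hn]; simp
  have him : ∀ (m : ℤ), |((m : ℂ) * (2 * Real.pi * Complex.I)).im| = |(m:ℝ)| * (2 * Real.pi) := by
    intro m
    have : ((m : ℂ) * (2 * Real.pi * Complex.I)).im = m * (2 * Real.pi) := by simp
    rw [this, abs_mul, abs_of_pos Real.two_pi_pos]
  have hc : ContinuousOn (fun x => |(f x).im|) S := (Complex.continuous_im.comp_continuousOn hf).abs
  have hiv := hS.intermediate_value hx0 hx hc
  have h1 : (1:ℝ) ≤ |(n:ℝ)| := by exact_mod_cast Int.one_le_abs hn0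
  obtain ⟨y, hy, hyv⟩ := hiv (show Real.pi ∈ Set.Icc _ _ by
    refine ⟨by simp [h0, Real.pi_pos.le], ?_⟩
    rw [hn, him]; nlinarith [Real.pi_pos])
  obtain ⟨m, hm⟩ := Complex.exp_eq_one_iff.1 (he y hy)
  simp only [] at hyv
  rw [hm, him] at hyv
  have h2 : 2 * |(m:ℝ)| = 1 := by
    have := Real.pi_pos
    have e : Real.pi * (2 * |(m:ℝ)|) = Real.pi * 1 := by linarith
    exact mul_left_cancel₀ this.ne' e
  have h3 : 2 * |m| = 1 := by exact_mod_cast h2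
  omega

theorem diag_log (G l : ℂ × ℂ → ℂ) (p q : ℝ) (hp : 0 < p) (hq : 0 < q) (c0 : ℝ)
    (hG : AnalyticOnNhd ℂ G {z : ℂ × ℂ | ‖z.1‖ ≤ p ∧ ‖z.2‖ ≤ q})
    (hG0 : G 0 = c0) (hc0 : 0 < c0)
    (hl : ContinuousOn l (Metric.ball (0:ℂ) p ×ˢ Metric.ball (0:ℂ) q))
    (hle : ∀ z ∈ (Metric.ball (0:ℂ) p ×ˢ Metric.ball (0:ℂ) q), Complex.exp (l z) = G z)
    (hl0 : l 0 = (Real.log c0 : ℝ))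
    (hpos : ∀ x y : ℝ, 0 ≤ x → 0 ≤ y → x < p → y < q → ∃ v : ℝ, 0 < v ∧ G (x, y) = v) (t : ℝ) (ht : 0 ≤ t) (ht1 : t < 1) :
    l (((t * p : ℝ) : ℂ), ((t * q : ℝ) : ℂ)) = Complex.log (G (((t * p : ℝ) : ℂ), ((t * q : ℝ) : ℂ))) := by
  set γ : ℝ → ℂ × ℂ := fun t => (((t * p : ℝ) : ℂ), ((t * q : ℝ) : ℂ)) with hγ
  have hγc : Continuous γ := by simp only [hγ]; fun_prop
  have hlt : ∀ t ∈ Set.Ico (0:ℝ) 1, t * p < p ∧ t * q < q := fun t ht => ⟨by nlinarith [ht.2], by nlinarith [ht.2]⟩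
  have hmem : ∀ t ∈ Set.Ico (0:ℝ) 1, γ t ∈ (Metric.ball (0:ℂ) p ×ˢ Metric.ball (0:ℂ) q) := by
    intro t ht
    have h1 : 0 ≤ t * p := mul_nonneg ht.1 hp.le
    have h2 : 0 ≤ t * q := mul_nonneg ht.1 hq.le
    refine ⟨?_, ?_⟩
    · rw [mem_ball_zero_iff, Complex.norm_real, Real.norm_of_nonneg h1]; exact (hlt t ht).1
    · rw [mem_ball_zero_iff, Complex.norm_real, Real.norm_of_nonneg h2]; exact (hlt t ht).2
  have hv : ∀ t ∈ Set.Ico (0:ℝ) 1, ∃ v : ℝ, 0 < v ∧ G (γ t) = v := fun t ht =>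
    hpos _ _ (mul_nonneg ht.1 hp.le) (mul_nonneg ht.1 hq.le) (hlt t ht).1 (hlt t ht).2
  have hslit : ∀ t ∈ Set.Ico (0:ℝ) 1, G (γ t) ∈ Complex.slitPlane := by
    intro t ht
    obtain ⟨v, hv, e⟩ := hv t ht
    rw [e]; exact Complex.ofReal_mem_slitPlane.2 hv
  have hGc : ContinuousOn (fun t => G (γ t)) (Set.Ico (0:ℝ) 1) := by
    refine hG.continuousOn.comp hγc.continuousOn ?_
    intro t ht
    have := hmem t ht
    rw [Set.mem_prod, mem_ball_zero_iff, mem_ball_zero_iff] at this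
    exact ⟨this.1.le, this.2.le⟩
  have hγ0 : γ 0 = 0 := by simp [hγ]
  have key := exp_one_const (Set.Ico (0:ℝ) 1) isPreconnected_Ico (fun t => l (γ t) - Complex.log (G (γ t)))
    ((hl.comp hγc.continuousOn hmem).sub (hGc.clog hslit)) (fun t ht => by
      rw [Complex.exp_sub, hle _ (hmem t ht), Complex.exp_log (Complex.slitPlane_ne_zero (hslit t ht)),
        div_self (Complex.slitPlane_ne_zero (hslit t ht))]) 0 (by simp) (by
      simp only [hγ0, hG0, hl0]; rw [Complex.ofReal_log hc0.le, sub_self]) t ⟨ht, ht1⟩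
  exact sub_eq_zero.1 key

theorem L_log (h L : ℂ × ℂ → ℂ)
    (hh : ContinuousOn h {z | 0 < z.1.re ∧ 0 < z.2.re})
    (hLc : ContinuousOn L {z | 0 < z.1.re ∧ 0 < z.2.re})
    (hL : ∀ z : ℂ × ℂ, 0 < z.1.re → 0 < z.2.re → Complex.exp (L z) = h z)
    (hslit : ∀ᶠ z in 𝓝 (0 : ℂ × ℂ), 0 < z.1.re → 0 < z.2.re → h z ∈ Complex.slitPlane)
    (hdiag : ∀ s : ℝ, 0 < s → L (s, s) = Complex.log (h (s, s))) :
    ∀ᶠ z in 𝓝 (0 : ℂ × ℂ), 0 < z.1.re → 0 < z.2.re → L z = Complex.log (h z) := by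
  obtain ⟨δ, hδ, hball⟩ := Metric.eventually_nhds_iff_ball.1 hslit
  have hQc : Convex ℝ {z : ℂ × ℂ | 0 < z.1.re ∧ 0 < z.2.re} := by
    refine Convex.inter ?_ ?_
    · exact convex_halfSpace_gt (f := fun z : ℂ × ℂ => z.1.re) ⟨by intros; simp, by intros; simp⟩ 0
    · exact convex_halfSpace_gt (f := fun z : ℂ × ℂ => z.2.re) ⟨by intros; simp, by intros; simp⟩ 0
  have hc := (hQc.inter (convex_ball (0 : ℂ × ℂ) δ)).isPreconnected
  have hsl : ∀ z ∈ {z : ℂ × ℂ | 0 < z.1.re ∧ 0 < z.2.re} ∩ Metric.ball 0 δ, h z ∈ Complex.slitPlane :=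
    fun z hz => hball z hz.2 hz.1.1 hz.1.2
  have key := exp_one_const _ hc (fun z => L z - Complex.log (h z))
    ((hLc.mono Set.inter_subset_left).sub ((hh.mono Set.inter_subset_left).clog hsl)) (fun z hz => by
      rw [Complex.exp_sub, hL z hz.1.1 hz.1.2, Complex.exp_log (Complex.slitPlane_ne_zero (hsl z hz)),
        div_self (Complex.slitPlane_ne_zero (hsl z hz))]) (((δ / 2 : ℝ) : ℂ), ((δ / 2 : ℝ) : ℂ))
      ⟨⟨by simpa using hδ, by simpa using hδ⟩, by
        rw [mem_ball_zero_iff, Prod.norm_def, Complex.norm_real, Real.norm_of_nonneg (by positivity), max_self]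
        linarith⟩ (by rw [hdiag _ (by positivity), sub_self])
  filter_upwards [Metric.ball_mem_nhds (0 : ℂ × ℂ) hδ] with z hz h1 h2
  exact sub_eq_zero.1 (key z ⟨⟨h1, h2⟩, hz⟩)

/-- Corollary: for `H` analytic on a neighborhood of the closed polydisc
`{|x| ≤ p, |y| ≤ q}` with real Taylor coefficients, `H(0,0) > 0`, and `(p,q)` (with
`p, q > 0` real) its unique zero there and a smooth critical point in direction `λ`, the
Taylor coefficients `a_{r,s}` of the branch `g = H^{−β}` with `g(0,0) = H(0,0)^{−β} > 0`
satisfy `−p·H_x(p,q) > 0`, `−q²·M > 0`, and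
`a_{r,s} ~ r^{β−3/2}·p^{−r}·q^{−s}·(−H_x(p,q)·p)^{−β}/(Γ(β)·√(−2π·q²·M))`
along integer sequences `r, s → ∞` with `r − λs` bounded. -/
theorem bivariate_algebraic_coeff_asymptotics_real (lam : ℝ) (hlam : 0 < lam)
    (p q : ℝ) (hp : 0 < p) (hq : 0 < q) (β : ℝ) (hβ : ∀ m : ℕ, β ≠ -(m : ℝ))
    (H : ℂ → ℂ → ℂ)
    (hHan : AnalyticOnNhd ℂ (fun z : ℂ × ℂ => H z.1 z.2)
      {z : ℂ × ℂ | ‖z.1‖ ≤ p ∧ ‖z.2‖ ≤ q})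
    (c : ℕ → ℕ → ℝ) (ε : ℝ) (hε : 0 < ε)
    (hcoef : ∀ x y : ℂ, ‖x‖ < ε → ‖y‖ < ε →
      H x y = ∑' m : ℕ, ∑' n : ℕ, ((c m n : ℂ)) * x ^ m * y ^ n)
    (hH00 : 0 < c 0 0)
    (hzero : ∀ x y : ℂ, ‖x‖ ≤ p → ‖y‖ ≤ q →
      (H x y = 0 ↔ (x = (p : ℂ) ∧ y = (q : ℂ))))
    (Hx Hy Hxx Hxy Hyy : ℂ)
    (hHx : Hx = deriv (fun x => H x (q : ℂ)) (p : ℂ))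
    (hHy : Hy = deriv (fun y => H (p : ℂ) y) (q : ℂ))
    (hHxx : Hxx = iteratedDeriv 2 (fun x => H x (q : ℂ)) (p : ℂ))
    (hHxy : Hxy = deriv (fun y => deriv (fun x => H x y) (p : ℂ)) (q : ℂ))
    (hHyy : Hyy = iteratedDeriv 2 (fun y => H (p : ℂ) y) (q : ℂ))
    (hcrit : (lam : ℂ) * (q : ℂ) * Hy = (p : ℂ) * Hx)
    (hHxne : Hx ≠ 0)
    (g : ℂ → ℂ → ℂ)
    (hgan : AnalyticAt ℂ (fun z : ℂ × ℂ => g z.1 z.2) (0, 0))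
    (hg0 : g 0 0 = (((c 0 0) ^ (-β) : ℝ) : ℂ))
    (hgx : ∀ᶠ z : ℂ × ℂ in 𝓝 (0, 0),
      H z.1 z.2 * deriv (fun x => g x z.2) z.1
        = -(β : ℂ) * g z.1 z.2 * deriv (fun x => H x z.2) z.1)
    (hgy : ∀ᶠ z : ℂ × ℂ in 𝓝 (0, 0),
      H z.1 z.2 * deriv (fun y => g z.1 y) z.2
        = -(β : ℂ) * g z.1 z.2 * deriv (fun y => H z.1 y) z.2)
    (a : ℕ → ℕ → ℂ)
    (ha : ∀ x y : ℂ, ‖x‖ < ε → ‖y‖ < ε →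
      g x y = ∑' m : ℕ, ∑' n : ℕ, a m n * x ^ m * y ^ n)
    (χ₁ χ₂ M : ℂ)
    (hχ₁ : χ₁ = Hy / Hx)
    (hχ₂ : χ₂ = (χ₁ ^ 2 * Hxx - 2 * χ₁ * Hxy + Hyy) / (2 * Hx))
    (hM : M = -2 * χ₂ / (p : ℂ) - χ₁ ^ 2 / (p : ℂ) ^ 2 - 1 / ((lam : ℂ) * (q : ℂ) ^ 2))
    (hMne : M ≠ 0) :
    ∃ A B : ℝ, 0 < A ∧ 0 < B ∧ -(p : ℂ) * Hx = (A : ℂ) ∧ -(q : ℂ) ^ 2 * M = (B : ℂ) ∧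
      ∀ r s : ℕ → ℕ, Tendsto r atTop atTop → Tendsto s atTop atTop →
        (∃ C : ℝ, ∀ k, |(r k : ℝ) - lam * (s k : ℝ)| ≤ C) →
        Tendsto (fun k => a (r k) (s k) /
            ((((r k : ℝ) ^ (β - 3/2) * p ^ (-(r k : ℤ)) * q ^ (-(s k : ℤ)) * A ^ (-β) /
              (Real.Gamma β * Real.sqrt (2 * Real.pi * B)) : ℝ)) : ℂ))
          atTop (𝓝 1) := by
  set G : ℂ × ℂ → ℂ := fun z => H z.1 z.2 with hGdef
  set K : Set (ℂ × ℂ) := {z : ℂ × ℂ | ‖z.1‖ ≤ p ∧ ‖z.2‖ ≤ q} with hK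
  have hpc : (p : ℂ) ≠ 0 := by exact_mod_cast hp.ne'
  have hqc : (q : ℂ) ≠ 0 := by exact_mod_cast hq.ne'
  have hlc : (lam : ℂ) ≠ 0 := by exact_mod_cast hlam.ne'
  have hPK : (((p : ℂ), (q : ℂ)) : ℂ × ℂ) ∈ K := by
    simp [hK, abs_of_pos hp, abs_of_pos hq]
  have h0K : (0 : ℂ × ℂ) ∈ K := by simp [hK, hp.le, hq.le]
  have hGP : AnalyticAt ℂ G ((p : ℂ), (q : ℂ)) := hHan _ hPK
  obtain ⟨hnear, hH0⟩ := near_symm H c ε hε hcoef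
  have hG0 : G 0 = (c 0 0 : ℂ) := hH0
  obtain ⟨hsymmK, hsymmP⟩ := real_symm G p q hp hq hHan hnear
  have hGz : ∀ z : ℂ × ℂ, ‖z.1‖ ≤ p → ‖z.2‖ ≤ q → G z = 0 → z.1 = p ∧ z.2 = q :=
    fun z h1 h2 h3 => (hzero z.1 z.2 h1 h2).1 h3
  have hrpos := real_pos G p q hp hq hHan hsymmK (c 0 0) hH00 hG0 hGz
  set E : ℂ × ℂ → ℂ × ℂ := fun z => (p * Complex.exp (-z.1), q * Complex.exp (-z.2)) with hE
  have hEan : ∀ z, AnalyticAt ℂ E z := by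
    intro z
    have h1 : AnalyticAt ℂ (fun z : ℂ × ℂ => (p : ℂ) * Complex.exp (-z.1)) z :=
      analyticAt_const.mul (analyticAt_fst.neg.cexp)
    have h2 : AnalyticAt ℂ (fun z : ℂ × ℂ => (q : ℂ) * Complex.exp (-z.2)) z :=
      analyticAt_const.mul (analyticAt_snd.neg.cexp)
    exact h1.prod h2
  have hEdiff : Differentiable ℂ E := fun z => (hEan z).differentiableAt
  have hEc : Continuous E := hEdiff.continuous
  have hE0 : E 0 = ((p : ℂ), (q : ℂ)) := by simp [hE]
  have hn1 : ∀ z : ℂ × ℂ, ‖(E z).1‖ = p * Real.exp (-z.1.re) := by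
    intro z; simp [hE, Complex.norm_exp, abs_of_pos hp]
  have hn2 : ∀ z : ℂ × ℂ, ‖(E z).2‖ = q * Real.exp (-z.2.re) := by
    intro z; simp [hE, Complex.norm_exp, abs_of_pos hq]
  have hEK : ∀ z : ℂ × ℂ, 0 ≤ z.1.re → 0 ≤ z.2.re → E z ∈ K := by
    intro z h1 h2
    refine ⟨?_, ?_⟩
    · rw [hn1]; exact mul_le_of_le_one_right hp.le (Real.exp_le_one_iff.2 (by linarith))
    · rw [hn2]; exact mul_le_of_le_one_right hq.le (Real.exp_le_one_iff.2 (by linarith))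
  set U : Set (ℂ × ℂ) := Metric.ball (0:ℂ) p ×ˢ Metric.ball (0:ℂ) q with hU
  have hEU : ∀ z : ℂ × ℂ, 0 < z.1.re → 0 < z.2.re → E z ∈ U := by
    intro z h1 h2
    refine ⟨?_, ?_⟩
    · rw [mem_ball_zero_iff, hn1]; exact mul_lt_of_lt_one_right hp (Real.exp_lt_one_iff.2 (by linarith))
    · rw [mem_ball_zero_iff, hn2]; exact mul_lt_of_lt_one_right hq (Real.exp_lt_one_iff.2 (by linarith))
  have hexpp : ∀ w : ℂ, Complex.exp (-(w + 2 * Real.pi * Complex.I)) = Complex.exp (-w) := by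
    intro w
    rw [Complex.exp_eq_exp_iff_exists_int]
    exact ⟨-1, by push_cast; ring⟩
  have hEp1 : ∀ z : ℂ × ℂ, E (z + (2 * Real.pi * Complex.I, 0)) = E z := by
    intro z
    simp only [hE, Prod.fst_add, Prod.snd_add, hexpp, add_zero]
  have hEp2 : ∀ z : ℂ × ℂ, E (z + (0, 2 * Real.pi * Complex.I)) = E z := by
    intro z
    simp only [hE, Prod.fst_add, Prod.snd_add, hexpp, add_zero]
  set h : ℂ × ℂ → ℂ := fun z => G (E z) with hh
  have hhan : AnalyticOnNhd ℂ h {z | 0 ≤ z.1.re ∧ 0 ≤ z.2.re} := by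
    intro z hz
    exact AnalyticAt.fun_comp (hHan _ (hEK z hz.1 hz.2)) (hEan z)
  have hh0an : AnalyticAt ℂ h 0 := hhan 0 (by simp)
  have hh0 : h 0 = 0 := by
    simp only [hh, hE0]
    exact (hzero p q hPK.1 hPK.2).2 ⟨rfl, rfl⟩
  set A : ℂ := -(p : ℂ) * Hx with hA
  have hex : ∀ w : ℂ, HasDerivAt (fun w : ℂ => Complex.exp (-w)) (-Complex.exp (-w)) w := by
    intro w
    refine ((hasDerivAt_id w).neg.cexp).congr_deriv ?_
    simp
  have hd1 : fderiv ℂ h 0 (1, 0) = A := by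
    have a1 := partial1 h 0 hh0an.differentiableAt
    have a2 : HasDerivAt (fun x => G (x, (q:ℂ))) Hx ((p : ℂ) * Complex.exp (-0)) := by
      have := (partial1 G ((p:ℂ), (q:ℂ)) hGP.differentiableAt)
      have e : Hx = fderiv ℂ G ((p:ℂ), (q:ℂ)) (1, 0) := by rw [hHx]; exact this.deriv
      rw [e]; simpa using this
    have a3 := a2.comp (0:ℂ) ((hex 0).const_mul (p:ℂ))
    have a4 : ((fun x => G (x, (q:ℂ))) ∘ fun y => (p:ℂ) * Complex.exp (-y)) = fun x => h (x, (0 : ℂ × ℂ).2) := by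
      funext x; simp [hh, hE]
    rw [a4] at a3
    rw [a1.unique a3, hA]; simp; ring
  have hd2 : fderiv ℂ h 0 (0, 1) = A / lam := by
    have a1 := partial2 h 0 hh0an.differentiableAt
    have a2 : HasDerivAt (fun y => G ((p:ℂ), y)) Hy ((q : ℂ) * Complex.exp (-0)) := by
      have := (partial2 G ((p:ℂ), (q:ℂ)) hGP.differentiableAt)
      have e : Hy = fderiv ℂ G ((p:ℂ), (q:ℂ)) (0, 1) := by rw [hHy]; exact this.deriv
      rw [e]; simpa using this
    have a3 := a2.comp (0:ℂ) ((hex 0).const_mul (q:ℂ))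
    have a4 : ((fun y => G ((p:ℂ), y)) ∘ fun y => (q:ℂ) * Complex.exp (-y)) = fun x => h ((0 : ℂ × ℂ).1, x) := by
      funext x; simp [hh, hE]
    rw [a4] at a3
    rw [a1.unique a3, hA]; simp
    field_simp
    linear_combination (-1) * hcrit
  set D : ℂ := deriv (deriv (fun t : ℂ => h (-(t / lam), t))) 0 with hD
  have hDval : D = (p : ℂ) * Hx * (-(q : ℂ) ^ 2 * M) := by
    have a1 := K_second G p q (lam:ℂ)⁻¹ hGP Hx Hy Hxx Hxy Hyy hHx hHy hHxx hHxy hHyy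
    have a2 : (fun t : ℂ => h (-(t / lam), t)) = fun t : ℂ => G (p * Complex.exp (-(-(t * (lam:ℂ)⁻¹))), q * Complex.exp (-t)) := by
      funext t; simp only [hh, hE, div_eq_mul_inv]
    rw [hD, a2, a1]
    have hHy' : Hy = p * Hx / (lam * q) := by
      field_simp; linear_combination hcrit
    have hχ : χ₁ = p / (lam * q) := by
      rw [hχ₁, hHy']; field_simp
    rw [hM, hχ₂, hχ, hHy']
    field_simp
    ring
  have happC := happ_of lam A D h hh0an hh0 hd1 hd2 hD.symm
  have hAne : A ≠ 0 := mul_ne_zero (neg_ne_zero.2 hpc) hHxne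
  have hDne : D ≠ 0 := by
    rw [hDval]
    exact mul_ne_zero (mul_ne_zero hpc hHxne) (mul_ne_zero (neg_ne_zero.2 (pow_ne_zero _ hqc)) hMne)
  have hhpos : ∀ s t : ℝ, 0 ≤ s → 0 ≤ t → (0 < s ∨ 0 < t) → ∃ v : ℝ, 0 < v ∧ h (s, t) = v := by
    intro s t hs ht hst
    obtain ⟨v, hv, e⟩ := hrpos (p * Real.exp (-s)) (q * Real.exp (-t)) (by positivity) (by positivity)
      (mul_le_of_le_one_right hp.le (Real.exp_le_one_iff.2 (by linarith)))
      (mul_le_of_le_one_right hq.le (Real.exp_le_one_iff.2 (by linarith))) (by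
        rcases hst with h | h
        · left; exact (mul_lt_of_lt_one_right hp (Real.exp_lt_one_iff.2 (by linarith))).ne
        · right; exact (mul_lt_of_lt_one_right hq (Real.exp_lt_one_iff.2 (by linarith))).ne)
    refine ⟨v, hv, ?_⟩
    rw [← e]
    simp [hh, hE]
  obtain ⟨A', hA', hAA⟩ := A_pos A h hh0an hh0 hd1 hAne (fun s hs => by
    simpa using hhpos s 0 hs.le le_rfl (Or.inl hs))
  have hKan : AnalyticAt ℂ (fun t : ℂ => h (-(t / lam), t)) 0 := by
    have h1 : AnalyticAt ℂ (fun t : ℂ => ((-(t / lam), t) : ℂ × ℂ)) 0 := by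
      have a : AnalyticAt ℂ (fun t : ℂ => -(t / (lam:ℂ))) 0 := (analyticAt_id.div_const).neg
      exact a.prod analyticAt_id
    refine AnalyticAt.fun_comp ?_ h1
    have : ((-((0:ℂ) / lam), 0) : ℂ × ℂ) = 0 := by simp
    rw [this]; exact hh0an
  have hK1 : deriv (fun t : ℂ => h (-(t / lam), t)) 0 = 0 := by
    obtain ⟨γ, hγ⟩ : ∃ γ : ℂ → ℂ × ℂ, γ = fun t : ℂ => ((-(t / lam), t) : ℂ × ℂ) := ⟨_, rfl⟩
    have hγ0 : γ 0 = 0 := by rw [hγ]; simp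
    have a : HasFDerivAt h (fderiv ℂ h 0) (γ 0) := by
      rw [hγ0]; exact hh0an.differentiableAt.hasFDerivAt
    have b : HasDerivAt γ (-(1 / lam), 1) 0 := by
      rw [hγ]
      exact (((hasDerivAt_id (0:ℂ)).div_const (lam:ℂ)).neg).prodMk (hasDerivAt_id (0:ℂ))
    have := (a.comp_hasDerivAt (0:ℂ) b).deriv
    have e : (h ∘ γ) = fun t => h (-(t / lam), t) := by rw [hγ]; rfl
    rw [e] at this
    have e2 : ((-(1 / (lam:ℂ)), 1) : ℂ × ℂ) = (-(1 / (lam:ℂ))) • ((1, 0) : ℂ × ℂ) + (1:ℂ) • ((0, 1) : ℂ × ℂ) := by ext <;> simp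
    rw [this, e2, map_add, map_smul, map_smul, hd1, hd2]
    simp; field_simp; ring
  have hDim : D.im = 0 := by
    refine D_real _ hKan (by simp only [zero_div, neg_zero]; exact hh0) hK1 ?_
    have ct : Tendsto (fun t : ℝ => E (-((t:ℂ) / lam), (t:ℂ))) (𝓝 0) (𝓝 ((p:ℂ), (q:ℂ))) := by
      refine Continuous.tendsto' (hEc.comp (by fun_prop)) _ _ ?_
      rw [← hE0]
      have : ((-(((0:ℝ):ℂ) / lam), ((0:ℝ):ℂ)) : ℂ × ℂ) = 0 := by simp
      exact congrArg E this
    filter_upwards [ct.eventually hsymmP] with t ht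
    have e : cj (E (-((t:ℂ) / lam), (t:ℂ))) = E (-((t:ℂ) / lam), (t:ℂ)) := by
      simp [cj, hE, ← Complex.exp_conj]
    rw [e] at ht
    exact Complex.conj_eq_iff_im.1 ht
  set D' : ℝ := D.re with hD'
  have hDD : D = (D' : ℂ) := by apply Complex.ext <;> simp [hD', hDim]
  have hD'ne : D' ≠ 0 := by
    intro hc; apply hDne; rw [hDD, hc]; simp
  have hhz : ∀ z : ℂ × ℂ, 0 ≤ z.1.re → |z.1.im| ≤ Real.pi → 0 ≤ z.2.re → |z.2.im| ≤ Real.pi → h z = 0 → z = 0 := by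
    intro z h1 h2 h3 h4 h5
    have hk := hEK z h1 h3
    obtain ⟨e1, e2⟩ := hGz _ hk.1 hk.2 h5
    have aux : ∀ (P : ℂ) (w : ℂ), P ≠ 0 → |w.im| ≤ Real.pi → P * Complex.exp (-w) = P → w = 0 := by
      intro P w hP hw e
      have e' : Complex.exp (-w) = 1 := mul_left_cancel₀ hP (by rw [e, mul_one])
      obtain ⟨n, hn⟩ := Complex.exp_eq_one_iff.1 e'
      have him : w.im = -(n * (2 * Real.pi)) := by
        have := congrArg Complex.im hn
        simp at this; linarith
      have hn0 : n = 0 := by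
        by_contra hne
        have h1 : (1:ℝ) ≤ |(n:ℝ)| := by exact_mod_cast Int.one_le_abs hne
        rw [him, abs_neg, abs_mul, abs_of_pos Real.two_pi_pos] at hw
        nlinarith [Real.pi_pos]
      rw [hn0] at hn
      have : -w = 0 := by rw [hn]; simp
      exact neg_eq_zero.1 this
    exact Prod.ext (aux _ _ hpc h2 e1) (aux _ _ hqc h4 e2)
  have hhz' : ∀ z : ℂ × ℂ, 0 < z.1.re → 0 ≤ z.2.re → h z ≠ 0 := by
    intro z h1 h2 h3
    have hk := hEK z h1.le h2
    obtain ⟨e1, e2⟩ := hGz _ hk.1 hk.2 h3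
    have := hn1 z
    rw [e1, Complex.norm_real, Real.norm_of_nonneg hp.le] at this
    have h4 := mul_lt_of_lt_one_right hp (Real.exp_lt_one_iff.2 (show -z.1.re < 0 by linarith))
    linarith
  have hDneg : D' < 0 := by
    refine D_neg lam A' D' hA' h hh0an ?_ hD'ne (Eventually.of_forall hhz')
    rw [← hAA, ← hDD]; exact happC
  set B : ℝ := -D' / A' with hB
  have hBp : 0 < B := div_pos (neg_pos.2 hDneg) hA'
  have hBval : -(q : ℂ) ^ 2 * M = (B : ℂ) := by
    have hA'c : (A' : ℂ) ≠ 0 := by rw [← hAA]; exact hAne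
    rw [hB]; push_cast; rw [← hDD, hDval, ← hAA, hA]
    field_simp
  have happ : ∀ ε > 0, ∀ᶠ z in 𝓝 (0 : ℂ × ℂ),
      ‖h z - (A' * (z.1 + z.2 / (lam:ℂ)) - A' * B / 2 * z.2 ^ 2)‖ ≤ ε * (‖z.1 + z.2 / (lam:ℂ)‖ + ‖z.2‖ ^ 2) := by
    intro ε' hε'
    filter_upwards [happC ε' hε'] with z hz
    have e : (A' : ℂ) * (z.1 + z.2 / (lam:ℂ)) - A' * B / 2 * z.2 ^ 2 = A * (z.1 + z.2 / lam) + D / 2 * z.2 ^ 2 := by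
      have hA'c : (A' : ℂ) ≠ 0 := by rw [← hAA]; exact hAne
      have : (A' : ℂ) * B = -D := by
        rw [hB, hDD]; push_cast; field_simp
      rw [this, hAA]; ring
    rw [e]; exact hz
  obtain ⟨c1, hc1, hloc⟩ := local_low lam A' B hlam hA' hBp h happ
  obtain ⟨c2, hc2, hlow⟩ := global_low lam h c1 hc1 (hloc.mono fun z hz h1 h2 => (hz h1 h2).1) hhan.continuousOn hhz
  have hUK : U ⊆ K := by
    intro z hz
    rw [hU, Set.mem_prod, mem_ball_zero_iff, mem_ball_zero_iff] at hz
    exact ⟨hz.1.le, hz.2.le⟩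
  have hUo : IsOpen U := Metric.isOpen_ball.prod Metric.isOpen_ball
  have h0U : (0 : ℂ × ℂ) ∈ U := ⟨by simpa using hp, by simpa using hq⟩
  have hGne : ∀ z ∈ U, G z ≠ 0 := by
    intro z hz h3
    obtain ⟨e1, e2⟩ := hGz z (hUK hz).1 (hUK hz).2 h3
    have := hz.1
    rw [e1, mem_ball_zero_iff, Complex.norm_real, Real.norm_of_nonneg hp.le] at this
    exact lt_irrefl _ this
  obtain ⟨l, hld, hle, hl0⟩ := log_branch U hUo ((convex_ball _ _).prod (convex_ball _ _)) 0 h0U G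
    (fun z hz => (hHan z (hUK hz)).differentiableAt.differentiableWithinAt) hGne ((Real.log (c 0 0) : ℝ) : ℂ)
    (by rw [hG0, ← Complex.ofReal_exp, Real.exp_log hH00])
  have hUn : U ∈ 𝓝 (0 : ℂ × ℂ) := hUo.mem_nhds h0U
  have hbr := branch_eq β H g l (c 0 0) hH00
    (by filter_upwards [hUn] with z hz; exact hld.differentiableAt (hUo.mem_nhds hz))
    (by filter_upwards [hUn] with z hz; exact (hHan z (hUK hz)).differentiableAt)
    (by filter_upwards [hUn] with z hz; exact hle z hz) hl0 hgan hg0 hgx hgy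
  set L : ℂ × ℂ → ℂ := fun z => l (E z) with hL
  have hLd : DifferentiableOn ℂ L {z | 0 < z.1.re ∧ 0 < z.2.re} :=
    hld.comp hEdiff.differentiableOn (fun z hz => hEU z hz.1 hz.2)
  have hLe : ∀ z : ℂ × ℂ, 0 < z.1.re → 0 < z.2.re → Complex.exp (L z) = h z :=
    fun z h1 h2 => hle _ (hEU z h1 h2)
  have hLlog := L_log h L (hhan.continuousOn.mono fun z hz => ⟨hz.1.le, hz.2.le⟩) hLd.continuousOn hLe
    (hloc.mono fun z hz h1 h2 => (hz h1.le h2.le).2 (hhz' z h1 h2.le)) (by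
      intro s hs
      have := diag_log G l p q hp hq (c 0 0) hHan hG0 hH00 hld.continuousOn hle hl0
        (fun x y h1 h2 h3 h4 => hrpos x y h1 h2 h3.le h4.le (Or.inl h3.ne)) (Real.exp (-s)) (Real.exp_pos _).le
        (Real.exp_lt_one_iff.2 (by linarith))
      have e : ((((Real.exp (-s)) * p : ℝ) : ℂ), (((Real.exp (-s)) * q : ℝ) : ℂ)) = E (s, s) := by
        simp [hE, mul_comm]
      rw [e] at this
      exact this)
  refine ⟨A', B, hA', hBp, hAA, hBval, ?_⟩
  intro r s hr hs hb
  have hcore := core_gen lam A' B hlam hA' hBp h L c2 hc2 hlow happ hh0 (by rw [hd1, hAA]) hhan hLd hLe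
    (fun z => by simp only [hh, hEp1]) (fun z => by simp only [hL, hEp1]) hLlog r s hr hb (⌈4 - β⌉₊) β hβ
    (by have := Nat.le_ceil (4 - β); linarith) (fun _ => 1) (fun z _ => analyticAt_const) (fun z => rfl)
  set f : ℂ × ℂ → ℂ := fun z => Complex.exp (-(β : ℂ) * L z) with hf
  have hfe : (fun z : ℂ × ℂ => (1:ℂ) * Complex.exp (-(β : ℂ) * L z)) = f := by funext z; simp [hf]
  rw [hfe] at hcore
  set Cst : ℝ := A' ^ (-β) / (Real.Gamma β * Real.sqrt (2 * Real.pi * B)) with hCst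
  have hΓ : Real.Gamma β ≠ 0 := Real.Gamma_ne_zero hβ
  have hsq : Real.sqrt (2 * Real.pi * B) ≠ 0 := by
    have := Real.pi_pos
    positivity
  have hCne : Cst ≠ 0 := by
    have := (Real.rpow_pos_of_pos hA' (-β)).ne'
    exact div_ne_zero this (mul_ne_zero hΓ hsq)
  have hfd : DifferentiableOn ℂ f {z | 0 < z.1.re ∧ 0 < z.2.re} := (hLd.const_mul _).cexp
  obtain ⟨δ, hδ, hbrb⟩ := Metric.eventually_nhds_iff_ball.1 hbr
  obtain ⟨T, hT0, hTp, hTq⟩ : ∃ T : ℝ, 0 < T ∧ p * Real.exp (-T) < min δ ε ∧ q * Real.exp (-T) < min δ ε := by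
    have hm : 0 < min δ ε := lt_min hδ hε
    have t1 : ∀ x : ℝ, Tendsto (fun T : ℝ => x * Real.exp (-T)) atTop (𝓝 0) := by
      intro x
      simpa using (Real.tendsto_exp_neg_atTop_nhds_zero).const_mul x
    have := (eventually_gt_atTop (0:ℝ)).and (((t1 p).eventually (gt_mem_nhds hm)).and ((t1 q).eventually (gt_mem_nhds hm)))
    exact this.exists
  have hgeq : ∀ x y : ℂ, ‖x‖ = p * Real.exp (-T) → ‖y‖ = q * Real.exp (-T) →
      Complex.exp (-(β:ℂ) * l (x, y)) = ∑' m : ℕ, ∑' n : ℕ, a m n * x ^ m * y ^ n := by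
    intro x y hx hy
    rw [← hx, lt_min_iff] at hTp
    rw [← hy, lt_min_iff] at hTq
    rw [← ha x y hTp.2 hTq.2]
    refine (hbrb (x, y) ?_).symm
    rw [mem_ball_zero_iff, Prod.norm_def]
    exact max_lt hTp.1 hTq.1
  have hrp : ∀ᶠ k in atTop, 0 < r k := hr.eventually (eventually_gt_atTop 0)
  have hlim0 : (4 * (Real.pi:ℂ) ^ 2 * 1 * (Cst : ℂ)) ≠ 0 := by
    have h1 : (Real.pi : ℂ) ≠ 0 := by exact_mod_cast Real.pi_ne_zero
    have h2 : (Cst : ℂ) ≠ 0 := by exact_mod_cast hCne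
    simp [h1, h2]
  have hne := hcore.eventually_ne hlim0
  have hdiv := hcore.div_const (4 * (Real.pi:ℂ) ^ 2 * 1 * (Cst : ℂ))
  rw [div_self hlim0] at hdiv
  refine hdiv.congr' ?_
  filter_upwards [hne, hrp] with k hk hrk
  have hrk' : (0:ℝ) < r k := by exact_mod_cast hrk
  have hrad : Iint f ((r k : ℝ)⁻¹) ((r k : ℝ)⁻¹) (r k) (s k) = Iint f T T (r k) (s k) :=
    Iint_radius f hfd (fun z => by simp only [hf, hL, hEp1]) (fun z => by simp only [hf, hL, hEp2]) _ _ _ _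
      (by positivity) (by positivity) hT0 hT0 _ _
  have hne2 : Iint f T T (r k) (s k) ≠ 0 := by
    rw [← hrad]; exact right_ne_zero_of_mul hk
  have hco := coef_extract p q T hp hq a (fun x y => Complex.exp (-(β:ℂ) * l (x, y))) hgeq
    (fun x y _ _ => Complex.exp_ne_zero _) (r k) (s k) hne2
  have hco2 : Iint f T T (r k) (s k) = 4 * Real.pi ^ 2 * a (r k) (s k) * (p : ℂ) ^ (r k) * (q : ℂ) ^ (s k) := hco
  rw [hrad, hco2]
  have epow : (r k : ℝ) ^ (β - 3 / 2) = ((r k : ℝ) ^ (3 / 2 - β))⁻¹ := by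
    rw [← Real.rpow_neg hrk'.le]; congr 1; ring
  have erp : (r k : ℝ) ^ (3 / 2 - β) ≠ 0 := (Real.rpow_pos_of_pos hrk' _).ne'
  have efin : (r k : ℝ) ^ (β - 3 / 2) * p ^ (-(r k : ℤ)) * q ^ (-(s k : ℤ)) * A' ^ (-β) /
      (Real.Gamma β * Real.sqrt (2 * Real.pi * B)) = ((r k : ℝ) ^ (3 / 2 - β))⁻¹ * (p ^ (r k))⁻¹ * (q ^ (s k))⁻¹ * Cst := by
    rw [epow, hCst, zpow_neg, zpow_neg, zpow_natCast, zpow_natCast]; ring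
  rw [efin]
  push_cast
  have h1 : (Real.pi : ℂ) ≠ 0 := by exact_mod_cast Real.pi_ne_zero
  have h2 : (Cst : ℂ) ≠ 0 := by exact_mod_cast hCne
  have h3 : (((r k : ℝ) ^ (3 / 2 - β) : ℝ) : ℂ) ≠ 0 := by exact_mod_cast erp
  have h4 : (p : ℂ) ^ (r k) ≠ 0 := pow_ne_zero _ hpc
  have h5 : (q : ℂ) ^ (s k) ≠ 0 := pow_ne_zero _ hqc
  field_simp
end

section
/- Let p, q ∈ ℂ with p ≠ 0, let χ₁, χ₂ ∈ ℂ, and let C > 0. For each positive integer r, let u_r, v_r ∈ ℂ satisfy 1/r ≤ |u_r − p| ≤ r^{−7/10} and |v_r − q| ≤ C·r^{−2/5}. Then, with a(v) := χ₁(v − q) + χ₂(v − q)², the quantity K_r := [(1 − a(v_r)/u_r)/(1 − a(v_r)/p)]^{−(r+1)} is well defined for all sufficiently large r (both base factors being nonzero), and K_r → 1 as r → ∞, uniformly over all such choices of (u_r, v_r). -/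
open Filter Topology

lemma ckt_pow_bound (w : ℂ) (n : ℕ) : ‖(1 + w) ^ n - 1‖ ≤ (1 + ‖w‖) ^ n - 1 := by
  induction n with
  | zero => simp
  | succ n ih =>
    have h1 : (1 + w) ^ (n + 1) - 1 = ((1 + w) ^ n - 1) * (1 + w) + w := by ring
    have h2 : ‖1 + w‖ ≤ 1 + ‖w‖ := by simpa using norm_add_le (1 : ℂ) w
    calc ‖(1 + w) ^ (n + 1) - 1‖ ≤ ‖(1 + w) ^ n - 1‖ * ‖1 + w‖ + ‖w‖ := by
          rw [h1, ← norm_mul]; exact norm_add_le _ _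
      _ ≤ ((1 + ‖w‖) ^ n - 1) * (1 + ‖w‖) + ‖w‖ := by
          have := mul_le_mul ih h2 (norm_nonneg _) ((norm_nonneg _).trans ih)
          linarith
      _ = (1 + ‖w‖) ^ (n + 1) - 1 := by ring

lemma ckt_exp_bound (w : ℂ) (n : ℕ) : ‖(1 + w) ^ n - 1‖ ≤ Real.exp (n * ‖w‖) - 1 := by
  refine (ckt_pow_bound w n).trans ?_
  have h : (1 + ‖w‖) ^ n ≤ (Real.exp ‖w‖) ^ n :=
    pow_le_pow_left₀ (by positivity) (by linarith [Real.add_one_le_exp ‖w‖]) n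
  rw [← Real.exp_nat_mul] at h
  linarith

lemma ckt_rpow (s : ℝ) (hs : s < 0) : Tendsto (fun r : ℕ => (r : ℝ) ^ s) atTop (𝓝 0) := by
  have := (tendsto_rpow_neg_atTop (y := -s) (by linarith)).comp
    (tendsto_natCast_atTop_atTop (R := ℝ))
  simpa [Function.comp_def] using this

/-- bound on the size of `a` -/
lemma ckt_a (χ₁ χ₂ z : ℂ) (y : ℝ) (h : ‖z‖ ≤ y) :
    ‖χ₁ * z + χ₂ * z ^ 2‖ ≤ ‖χ₁‖ * y + ‖χ₂‖ * y ^ 2 := by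
  refine (norm_add_le _ _).trans ?_
  rw [norm_mul, norm_mul, norm_pow]
  gcongr

lemma ckt_lower (p u a : ℂ) (x A : ℝ) (hu : ‖u - p‖ ≤ x) (ha : ‖a‖ ≤ A)
    (hA0 : x + A < ‖p‖ / 2) : ‖p‖ / 2 ≤ ‖u - a‖ ∧ u ≠ 0 ∧ p - a ≠ 0 := by
  have hx := norm_nonneg (u - p)
  have hA := norm_nonneg a
  have hp := norm_nonneg p
  refine ⟨?_, ?_, ?_⟩
  · have : ‖p‖ ≤ ‖u - a‖ + ‖u - p‖ + ‖a‖ := by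
      have h : p = (u - a) - (u - p) + a := by ring
      calc ‖p‖ = ‖(u - a) - (u - p) + a‖ := by rw [← h]
        _ ≤ ‖(u - a) - (u - p)‖ + ‖a‖ := norm_add_le _ _
        _ ≤ _ := by gcongr; exact norm_sub_le _ _
    linarith
  · rintro rfl
    rw [zero_sub, norm_neg] at hu
    linarith
  · intro h
    rw [sub_eq_zero.1 h] at hA0 hp
    linarith

lemma ckt_main (p u a : ℂ) (hp : p ≠ 0) (x A : ℝ) (hu : ‖u - p‖ ≤ x) (ha : ‖a‖ ≤ A)
    (hA0 : x + A < ‖p‖ / 2) (r : ℕ) :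
    ‖((1 - a / u) / (1 - a / p)) ^ (-((r : ℤ) + 1)) - 1‖
      ≤ Real.exp (((r : ℝ) + 1) * (A * x / (‖p‖ * (‖p‖ / 2)))) - 1 := by
  obtain ⟨h1, hu0, hpa⟩ := ckt_lower p u a x A hu ha hA0
  have hpp : 0 < ‖p‖ := norm_pos_iff.2 hp
  have hua : u - a ≠ 0 := norm_pos_iff.1 (by linarith)
  have e1 : 1 - a / u = (u - a) / u := by field_simp
  have e2 : 1 - a / p = (p - a) / p := by field_simp
  have key : ((1 - a / u) / (1 - a / p))⁻¹ = 1 + a * (p - u) / (p * (u - a)) := by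
    rw [e1, e2]
    field_simp
    ring
  have e3 : ((1 - a / u) / (1 - a / p)) ^ (-((r : ℤ) + 1))
      = (1 + a * (p - u) / (p * (u - a))) ^ (r + 1) := by
    rw [← key, zpow_neg, ← inv_zpow]
    norm_cast
  rw [e3]
  refine (ckt_exp_bound _ _).trans ?_
  have hw : ‖a * (p - u) / (p * (u - a))‖ ≤ A * x / (‖p‖ * (‖p‖ / 2)) := by
    rw [norm_div, norm_mul, norm_mul, norm_sub_rev p u]
    have hA := (norm_nonneg a).trans ha
    have hx := (norm_nonneg _).trans hu
    gcongr
  push_cast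
  gcongr

lemma ckt_small (c₁ c₂ C P : ℝ) (hP : 0 < P) :
    ∀ᶠ r : ℕ in atTop, (r : ℝ) ^ (-(7:ℝ)/10) + (c₁ * (C * (r : ℝ) ^ (-(2:ℝ)/5)) +
      c₂ * (C * (r : ℝ) ^ (-(2:ℝ)/5)) ^ 2) < P := by
  have h1 := ckt_rpow (-(7:ℝ)/10) (by norm_num)
  have h2 := (ckt_rpow (-(2:ℝ)/5) (by norm_num)).const_mul C
  have h := h1.add ((h2.const_mul c₁).add ((h2.pow 2).const_mul c₂))
  simp only [mul_zero, add_zero, ne_eq, OfNat.ofNat_ne_zero, not_false_eq_true, zero_pow] at h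
  exact h.eventually_lt_const hP

lemma ckt_exp_small (c₁ c₂ C D ε : ℝ) (hε : 0 < ε) :
    ∀ᶠ r : ℕ in atTop, Real.exp (((r : ℝ) + 1) * ((c₁ * (C * (r : ℝ) ^ (-(2:ℝ)/5)) +
      c₂ * (C * (r : ℝ) ^ (-(2:ℝ)/5)) ^ 2) * (r : ℝ) ^ (-(7:ℝ)/10) / D)) - 1 < ε := by
  have h1 := ckt_rpow (-(1:ℝ)/10) (by norm_num)
  have h2 := ckt_rpow (-(2:ℝ)/5) (by norm_num)
  have h3 := ckt_rpow (-(11:ℝ)/10) (by norm_num)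
  have h := ((h1.add h3).mul (((h2.const_mul (c₂ * C ^ 2)).const_add (c₁ * C)))).div_const D
  simp only [add_zero, zero_mul, zero_div] at h
  have h' := ((Real.continuous_exp.tendsto 0).comp h).sub_const 1
  simp only [Real.exp_zero, sub_self] at h'
  filter_upwards [h'.eventually_lt_const hε, eventually_gt_atTop 0] with r hr hr0
  have hr0 : (0 : ℝ) < r := by exact_mod_cast hr0
  have e3 : (r : ℝ) ^ (-(11:ℝ)/10) = (r : ℝ) ^ (-(2:ℝ)/5) * (r : ℝ) ^ (-(7:ℝ)/10) := by
    rw [← Real.rpow_add hr0]; norm_num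
  have e1 : (r : ℝ) ^ (-(1:ℝ)/10) = r * ((r : ℝ) ^ (-(2:ℝ)/5) * (r : ℝ) ^ (-(7:ℝ)/10)) := by
    rw [← e3]
    nth_rewrite 2 [← Real.rpow_one (r : ℝ)]
    rw [← Real.rpow_add hr0]; norm_num
  simp only [Function.comp_def, e1, e3] at hr
  refine lt_of_eq_of_lt (congrArg (fun t => Real.exp t - 1) ?_) hr
  ring

/-- with `a(v) := χ₁(v−q) + χ₂(v−q)²`, for `u_r, v_r` satisfying
`1/r ≤ |u_r − p| ≤ r^{−7/10}` and `|v_r − q| ≤ C·r^{−2/5}`, the correction factor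
`K_r = [(1 − a(v_r)/u_r)/(1 − a(v_r)/p)]^{−(r+1)}` is well defined for large `r` and
tends to `1`, uniformly over all such choices. -/
theorem correction_factor_K_tendsto_one (p q χ₁ χ₂ : ℂ) (hp : p ≠ 0) (C : ℝ) (hC : 0 < C) :
    (∃ N : ℕ, ∀ r : ℕ, N ≤ r → ∀ u v : ℂ,
        1 / (r : ℝ) ≤ ‖u - p‖ → ‖u - p‖ ≤ (r : ℝ) ^ (-(7:ℝ)/10) →
        ‖v - q‖ ≤ C * (r : ℝ) ^ (-(2:ℝ)/5) →
        (1 - (χ₁ * (v - q) + χ₂ * (v - q) ^ 2) / u ≠ 0 ∧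
         1 - (χ₁ * (v - q) + χ₂ * (v - q) ^ 2) / p ≠ 0))
    ∧ ∀ ε : ℝ, 0 < ε → ∃ N : ℕ, ∀ r : ℕ, N ≤ r → ∀ u v : ℂ,
        1 / (r : ℝ) ≤ ‖u - p‖ → ‖u - p‖ ≤ (r : ℝ) ^ (-(7:ℝ)/10) →
        ‖v - q‖ ≤ C * (r : ℝ) ^ (-(2:ℝ)/5) →
        ‖((1 - (χ₁ * (v - q) + χ₂ * (v - q) ^ 2) / u) /
            (1 - (χ₁ * (v - q) + χ₂ * (v - q) ^ 2) / p)) ^ (-((r : ℤ) + 1)) - 1‖ < ε := by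
  have hP : 0 < ‖p‖ / 2 := by have := norm_pos_iff.2 hp; linarith
  obtain ⟨N₀, hN₀⟩ := eventually_atTop.1 (ckt_small ‖χ₁‖ ‖χ₂‖ C _ hP)
  constructor
  · refine ⟨N₀, fun r hr u v _ hu hv => ?_⟩
    have ha := ckt_a χ₁ χ₂ _ _ hv
    obtain ⟨h1, hu0, hpa⟩ := ckt_lower p u _ _ _ hu ha (hN₀ r hr)
    have hua := norm_pos_iff.1 (hP.trans_le h1)
    rw [one_sub_div hu0, one_sub_div hp]
    exact ⟨div_ne_zero hua hu0, div_ne_zero hpa hp⟩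
  · intro ε hε
    obtain ⟨N₁, hN₁⟩ := eventually_atTop.1
      (ckt_exp_small ‖χ₁‖ ‖χ₂‖ C (‖p‖ * (‖p‖ / 2)) ε hε)
    refine ⟨max N₀ N₁, fun r hr u v _ hu hv => ?_⟩
    have ha := ckt_a χ₁ χ₂ _ _ hv
    exact (ckt_main p u _ hp _ _ hu ha (hN₀ r (le_of_max_le_left hr)) r).trans_lt
      (hN₁ r (le_of_max_le_right hr))
end

section
/- Let (p,q) ∈ ℂ² and let H̃ be analytic in a neighborhood of (p,q) with Taylor expansion H̃(u,v) = Σ_{m,n≥0} d_{mn}(u−p)^m(v−q)^n satisfying d₀₀ = d₀₁ = d₀₂ = 0 and d₁₀ ≠ 0. Let β ∈ ℝ and C > 0. For each positive integer r, let u_r, v_r ∈ ℂ satisfy 1/r ≤ |u_r − p| ≤ r^{−7/10} and |v_r − q| ≤ C·r^{−2/5}. Then H̃(u_r, v_r)/(d₁₀·(u_r − p)) → 1 as r → ∞ (uniformly over all such choices), and consequently the principal power L_r := [H̃(u_r,v_r)/(d₁₀·(u_r − p))]^{−β} is well defined for large r and L_r → 1 as r → ∞. -/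
open Filter Topology

/-- for `H̃` analytic at `(p,q)` with Taylor coefficients satisfying
`d₀₀ = d₀₁ = d₀₂ = 0` and `d₁₀ ≠ 0`, and `u_r, v_r` with `1/r ≤ |u_r − p| ≤ r^{−7/10}`,
`|v_r − q| ≤ C·r^{−2/5}`, the ratio `H̃(u_r,v_r)/(d₁₀·(u_r−p))` tends to `1` uniformly,
and so does the principal power `L_r = [H̃(u_r,v_r)/(d₁₀·(u_r−p))]^{−β}`. -/
theorem correction_factor_L_tendsto_one (p q : ℂ) (Ht : ℂ → ℂ → ℂ) (β : ℝ)
    (C : ℝ) (hC : 0 < C)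
    (hAn : AnalyticAt ℂ (fun z : ℂ × ℂ => Ht z.1 z.2) (p, q))
    (h00 : Ht p q = 0)
    (h01 : deriv (fun v => Ht p v) q = 0)
    (h02 : iteratedDeriv 2 (fun v => Ht p v) q = 0)
    (d10 : ℂ) (hd10 : d10 = deriv (fun u => Ht u q) p) (hne : d10 ≠ 0) :
    ∀ ε : ℝ, 0 < ε → ∃ N : ℕ, ∀ r : ℕ, N ≤ r → ∀ u v : ℂ,
      1 / (r : ℝ) ≤ ‖u - p‖ → ‖u - p‖ ≤ (r : ℝ) ^ (-(7:ℝ)/10) →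
      ‖v - q‖ ≤ C * (r : ℝ) ^ (-(2:ℝ)/5) →
      ‖Ht u v / (d10 * (u - p)) - 1‖ < ε ∧
      ‖(Ht u v / (d10 * (u - p))) ^ (-(β : ℂ)) - 1‖ < ε := by
  intro ε hε
  -- the principal power is continuous at 1
  have hcont : ContinuousAt (fun w : ℂ => w ^ (-(β : ℂ))) 1 :=
    continuousAt_cpow_const (by simp)
  obtain ⟨η₀, hη₀, hpow⟩ := Metric.continuousAt_iff.1 hcont ε hε
  obtain ⟨η, hη, hηε, hηη₀⟩ : ∃ η : ℝ, 0 < η ∧ η ≤ ε ∧ η ≤ η₀ :=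
    ⟨min ε η₀, lt_min hε hη₀, min_le_left _ _, min_le_right _ _⟩
  have hd : 0 < ‖d10‖ := norm_pos_iff.2 hne
  -- cubic vanishing along u = p
  have hf : AnalyticAt ℂ (fun v => Ht p v) q := by
    have h2 : AnalyticAt ℂ (fun v : ℂ => ((p, v) : ℂ × ℂ)) q :=
      analyticAt_const.prod analyticAt_id
    exact AnalyticAt.comp (g := fun z : ℂ × ℂ => Ht z.1 z.2) (f := fun v : ℂ => (p, v)) hAn h2
  have hord : ((3 : ℕ) : ℕ∞) ≤ analyticOrderAt (fun v => Ht p v) q := by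
    rw [natCast_le_analyticOrderAt_iff_iteratedDeriv_eq_zero hf]
    intro i hi
    interval_cases i
    · simpa using h00
    · simpa [iteratedDeriv_one] using h01
    · exact h02
  obtain ⟨g, hg, hfg⟩ := (natCast_le_analyticOrderAt hf).1 hord
  obtain ⟨K, hK, hgK⟩ : ∃ K : ℝ, 0 < K ∧ ∀ᶠ v in 𝓝 q, ‖g v‖ < K := by
    refine ⟨‖g q‖ + 1, by positivity, ?_⟩
    exact hg.continuousAt.norm.eventually_lt continuousAt_const (by simp)
  obtain ⟨δ₁, hδ₁, hv₁⟩ := Metric.eventually_nhds_iff.1 (hfg.and hgK)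
  -- strict differentiability
  have hst := hAn.hasStrictFDerivAt
  have hL : (fderiv ℂ (fun z : ℂ × ℂ => Ht z.1 z.2) (p, q)) (1, 0) = d10 := by
    have h1 : HasDerivAt (fun u : ℂ => ((u, q) : ℂ × ℂ)) (1, 0) p :=
      (hasDerivAt_id p).prodMk (hasDerivAt_const p q)
    have h2 := HasFDerivAt.comp_hasDerivAt (l := fun z : ℂ × ℂ => Ht z.1 z.2)
      (f := fun u : ℂ => (u, q)) p hst.hasFDerivAt h1
    rw [hd10]
    exact h2.deriv.symm
  have hlit := (hasStrictFDerivAt_iff_isLittleO.1 hst).def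
    (show 0 < η * ‖d10‖ / 2 by positivity)
  obtain ⟨δ₂, hδ₂, hs⟩ := Metric.eventually_nhds_iff.1 hlit
  -- powers of r
  have t1 : Tendsto (fun r : ℕ => (r : ℝ) ^ (-(7:ℝ)/10)) atTop (𝓝 0) := by
    rw [neg_div]
    exact (tendsto_rpow_neg_atTop (by norm_num)).comp tendsto_natCast_atTop_atTop
  have t2 : Tendsto (fun r : ℕ => C * (r : ℝ) ^ (-(2:ℝ)/5)) atTop (𝓝 0) := by
    rw [neg_div, ← mul_zero C]
    exact ((tendsto_rpow_neg_atTop (by norm_num)).comp tendsto_natCast_atTop_atTop).const_mul C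
  have t3 : Tendsto (fun r : ℕ => K * C ^ 3 * (r : ℝ) ^ (-(1/5:ℝ))) atTop (𝓝 0) := by
    rw [← mul_zero (K * C ^ 3)]
    exact ((tendsto_rpow_neg_atTop (by norm_num)).comp
      tendsto_natCast_atTop_atTop).const_mul (K * C ^ 3)
  have hev := (((t1.eventually_lt_const hδ₂).and (t2.eventually_lt_const hδ₂)).and
    ((t2.eventually_lt_const hδ₁).and
      (t3.eventually_lt_const (show 0 < η * ‖d10‖ / 2 by positivity)))).and
      (eventually_ge_atTop 1)
  obtain ⟨N, hN⟩ := eventually_atTop.1 hev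
  refine ⟨N, fun r hr u v hu1 hu2 hv => ?_⟩
  obtain ⟨⟨⟨a1, a2⟩, a3, a4⟩, hr1⟩ := hN r hr
  have hrpos : (0 : ℝ) < r := by exact_mod_cast hr1
  have hupos : 0 < ‖u - p‖ := lt_of_lt_of_le (by positivity) hu1
  have hune : u - p ≠ 0 := norm_pos_iff.1 hupos
  -- linear part
  have b1 : ‖Ht u v - Ht p v - d10 * (u - p)‖ ≤ η * ‖d10‖ / 2 * ‖u - p‖ := by
    have hdist : dist (((u, v), (p, v)) : (ℂ × ℂ) × (ℂ × ℂ)) ((p, q), (p, q)) < δ₂ := by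
      simp only [Prod.dist_eq, dist_self, Complex.dist_eq, max_lt_iff]
      refine ⟨⟨?_, ?_⟩, ?_, ?_⟩ <;> linarith
    have h := hs hdist
    have e : ((u, v) : ℂ × ℂ) - (p, v) = (u - p) • ((1, 0) : ℂ × ℂ) := by
      ext <;> simp
    have e2 : ‖((u, v) : ℂ × ℂ) - (p, v)‖ = ‖u - p‖ := by
      rw [e, norm_smul]; simp
    simp only [e2] at h
    rw [e, map_smul, hL, smul_eq_mul, mul_comm (u - p)] at h
    exact h
  -- cubic part
  have b2 : ‖Ht p v‖ < η * ‖d10‖ / 2 * ‖u - p‖ := by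
    obtain ⟨h1, h2⟩ := hv₁ (show dist v q < δ₁ by rw [Complex.dist_eq]; linarith)
    have hpw : ((r : ℝ) ^ (-(2:ℝ)/5)) ^ 3 = (r : ℝ) ^ (-(1/5:ℝ)) * (1 / (r : ℝ)) := by
      rw [← Real.rpow_natCast, ← Real.rpow_mul hrpos.le, one_div (r : ℝ), ← Real.rpow_neg_one,
        ← Real.rpow_add hrpos]
      norm_num
    calc ‖Ht p v‖ = ‖v - q‖ ^ 3 * ‖g v‖ := by rw [h1, norm_smul, norm_pow]
      _ ≤ (C * (r : ℝ) ^ (-(2:ℝ)/5)) ^ 3 * K := by gcongr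
      _ = K * C ^ 3 * (r : ℝ) ^ (-(1/5:ℝ)) * (1 / (r : ℝ)) := by
        rw [mul_pow, hpw]; ring
      _ ≤ K * C ^ 3 * (r : ℝ) ^ (-(1/5:ℝ)) * ‖u - p‖ := by gcongr
      _ < η * ‖d10‖ / 2 * ‖u - p‖ := by gcongr
  have key : ‖Ht u v / (d10 * (u - p)) - 1‖ < η := by
    have hne2 : d10 * (u - p) ≠ 0 := mul_ne_zero hne hune
    rw [div_sub_one hne2, norm_div, norm_mul, div_lt_iff₀ (by positivity)]
    have e : Ht u v - d10 * (u - p) = (Ht u v - Ht p v - d10 * (u - p)) + Ht p v := by ring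
    rw [e]
    refine (norm_add_le _ _).trans_lt ?_
    linarith
  refine ⟨key.trans_le hηε, ?_⟩
  have h := hpow (x := Ht u v / (d10 * (u - p)))
    (by rw [Complex.dist_eq]; exact key.trans_le hηη₀)
  simpa [Complex.dist_eq] using h
end
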